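/- Let d ≥ 2, Ω = (−1,1)^d, and 1 < p_− < p_+ < ∞. Then there exists a measurable variable exponent p : Ω → {p_−, p_+} and a function u ∈ W^{1,1}(Ω) with ∫_Ω |∇u|^{p(x)} dx < ∞ such that u is a local minimizer of the functional F(w) = ∫_Ω |∇w|^{p(x)}/p(x) dx, and ∇u ∉ L^s(Ω) for every s > p_−. If moreover p_− < d, then there exists a closed set Σ ⊂ Ω consisting of non-Lebesgue points of u whose Hausdorff dimension equals d − p_−. -/

import Mathlib

open MeasureTheory Real Set Metric Filter Topology NNReal ENNReal

noncomputable section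

/-- `ℝ^n` with the Euclidean structure. -/
abbrev Euc (n : ℕ) := EuclideanSpace ℝ (Fin n)

/-- The open cube `(-1,1)^n`. -/
def Box (n : ℕ) : Set (Euc n) := {x | ∀ i, |x i| < 1}

/-- The last coordinate `x_d` of `x ∈ ℝ^{n+1}`. -/
def lastC {n : ℕ} (x : Euc (n + 1)) : ℝ := x (Fin.last n)

/-- The first `n` coordinates `x̄` of `x ∈ ℝ^{n+1}`. -/
def frontC {n : ℕ} (x : Euc (n + 1)) : Euc n := WithLp.toLp 2 fun i => x i.castSucc

/-- Assemble a point of `ℝ^{n+1}` from `x̄ ∈ ℝ^n` and a last coordinate. -/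
def snocC {n : ℕ} (xb : Euc n) (t : ℝ) : Euc (n + 1) :=
  WithLp.toLp 2 (Fin.snoc (α := fun _ => ℝ) xb.ofLp t)

/-- The first `m` coordinates of `x ∈ ℝ^{m+k}`. -/
def barPart {m k : ℕ} (x : Euc (m + k)) : Euc m := WithLp.toLp 2 fun i => x (Fin.castAdd k i)

/-- The last `k` coordinates of `x ∈ ℝ^{m+k}`. -/
def hatPart {m k : ℕ} (x : Euc (m + k)) : Euc k := WithLp.toLp 2 fun i => x (Fin.natAdd m i)

/-- Admissibility of a sequence of interval lengths for the generalized `(λ,γ)`-Cantor set: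
`l 0 = 1`, the lengths decrease fast enough (`l_{j-1} > 2 l_j`, removed gaps decreasing), and
`l j` is comparable to `λ^j j^γ`. -/
def IsCantorLengths (lam gam : ℝ) (l : ℕ → ℝ) : Prop :=
  l 0 = 1 ∧ (∀ j, 0 < l j) ∧ (∀ j, 2 * l (j + 1) < l j) ∧
    (∀ j, l (j + 1) - 2 * l (j + 2) < l j - 2 * l (j + 1)) ∧
    ∃ C : ℝ, 1 ≤ C ∧ ∀ j : ℕ, 1 ≤ j →
      C⁻¹ * lam ^ j * (j : ℝ) ^ gam ≤ l j ∧ l j ≤ C * lam ^ j * (j : ℝ) ^ gam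

/-- The point of the generalized Cantor set with address `ε` (left endpoints of the nested
intervals converge to this point). -/
def gCantorPoint (l : ℕ → ℝ) (ε : ℕ → Bool) : ℝ :=
  -(1 / 2 : ℝ) + ∑' j : ℕ, if ε j then l j - l (j + 1) else 0

/-- The generalized Cantor set determined by the lengths `l`. -/
def gCantorSet (l : ℕ → ℝ) : Set ℝ := Set.range (gCantorPoint l)

/-- The `m`-fold Cartesian power of the generalized Cantor set, inside `ℝ^m`. -/
def gCantorSetPi (l : ℕ → ℝ) (m : ℕ) : Set (Euc m) := {x | ∀ i, x i ∈ gCantorSet l}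

/-- The `j`-th binary digit of `t`. -/
def binDigit (t : ℝ) (j : ℕ) : Bool := ⌊t * 2 ^ (j + 1)⌋ % 2 = 1

/-- The Cantor measure attached to the lengths `l`: the image of the uniform distribution on
`[0,1)` under the map sending `t` to the Cantor point whose address is the binary digit
sequence of `t` (the digits being i.i.d. fair coins, this is the weak limit of the uniform
distributions on the pre-Cantor sets). -/
def gCantorMeasure (l : ℕ → ℝ) : Measure ℝ :=
  Measure.map (fun t => gCantorPoint l (binDigit t)) (volume.restrict (Set.Ico (0 : ℝ) 1))

/-- The `m`-fold product of the Cantor measure, as a measure on `ℝ^m`. -/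
def gCantorMeasurePi (l : ℕ → ℝ) (m : ℕ) : Measure (Euc m) :=
  Measure.map (⇑(MeasurableEquiv.toLp 2 (Fin m → ℝ)))
    (Measure.pi fun _ : Fin m => gCantorMeasure l)

/-- The fractal dimension `𝔇 = m log 2 / log(1/λ)`. -/
def frD (m : ℕ) (lam : ℝ) : ℝ := m * Real.log 2 / Real.log lam⁻¹

/-- `G` is the weak (distributional) differential of `u` on `Ω`:
integration by parts against smooth compactly supported test functions holds. -/
def HasWeakFDerivOn {n : ℕ} (Ω : Set (Euc n)) (u : Euc n → ℝ)
    (G : Euc n → Euc n →L[ℝ] ℝ) : Prop :=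
  ∀ φ : Euc n → ℝ, ContDiff ℝ (⊤ : ℕ∞) φ → HasCompactSupport φ → tsupport φ ⊆ Ω →
    ∫ x in Ω, u x • fderiv ℝ φ x = -∫ x in Ω, φ x • G x

/-- `u ∈ W^{1,1}(Ω)` with weak differential `G`. -/
def W11On {n : ℕ} (Ω : Set (Euc n)) (u : Euc n → ℝ) (G : Euc n → Euc n →L[ℝ] ℝ) : Prop :=
  IntegrableOn u Ω ∧ IntegrableOn G Ω ∧ HasWeakFDerivOn Ω u G

/-- `w ∈ W^{1,1}_0(Ω)` (with weak differential `G`): the extensions by zero form a Sobolev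
function on all of `ℝ^n`. -/
def ZeroBoundary {n : ℕ} (Ω : Set (Euc n)) (w : Euc n → ℝ)
    (G : Euc n → Euc n →L[ℝ] ℝ) : Prop :=
  Integrable (Set.indicator Ω w) ∧ Integrable (Set.indicator Ω G) ∧
    HasWeakFDerivOn Set.univ (Set.indicator Ω w) (Set.indicator Ω G)

/-- The energy `∫_Ω φ(x, g x) dx` for a scalar field `g` (typically `g = |∇w|`). -/
def energyOf {n : ℕ} (Ω : Set (Euc n)) (φ : Euc n → ℝ → ℝ) (g : Euc n → ℝ) : ℝ≥0∞ :=
  ∫⁻ x in Ω, ENNReal.ofReal (φ x (g x))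

/-- The Young (Legendre–Fenchel) conjugate `φ*(s) = sup_{t ≥ 0} (s t − φ(t))`. -/
def conjOrlicz (φ : ℝ → ℝ) (s : ℝ) : ℝ≥0∞ :=
  ⨆ t : ℝ≥0, ENNReal.ofReal (s * t - φ t)

/-- The conjugate energy `∫_Ω φ*(x, g x) dx`. -/
def energyConj {n : ℕ} (Ω : Set (Euc n)) (φ : Euc n → ℝ → ℝ) (g : Euc n → ℝ) : ℝ≥0∞ :=
  ∫⁻ x in Ω, conjOrlicz (φ x) (g x)

/-- `u` (with weak differential `G`, finite energy) is a local minimizer of the functional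
`w ↦ ∫_Ω φ(x,|∇w|) dx`: its energy does not exceed that of any Sobolev competitor that agrees
with `u` a.e. outside a compact subset of `Ω`. -/
def IsLocalMinimizer {n : ℕ} (Ω : Set (Euc n)) (φ : Euc n → ℝ → ℝ) (u : Euc n → ℝ)
    (G : Euc n → Euc n →L[ℝ] ℝ) : Prop :=
  W11On Ω u G ∧ energyOf Ω φ (fun x => ‖G x‖) < ⊤ ∧
    ∀ v Gv, W11On Ω v Gv →
      (∃ K : Set (Euc n), IsCompact K ∧ K ⊆ Ω ∧ ∀ᵐ x ∂(volume.restrict Ω), x ∉ K → v x = u x) →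
      energyOf Ω φ (fun x => ‖G x‖) ≤ energyOf Ω φ (fun x => ‖Gv x‖)

/-- `x` is a non-Lebesgue point of `u`: the averages of `|u − c|` on small balls around `x`
do not converge to `0` for any constant `c`. -/
def IsNonLebesguePoint {n : ℕ} (u : Euc n → ℝ) (x : Euc n) : Prop :=
  ¬ ∃ c : ℝ, Tendsto (fun r : ℝ => ⨍ y in Metric.ball x r, |u y - c| ∂volume)
      (𝓝[>] (0 : ℝ)) (𝓝 0)

/-- Membership in the Hölder class `C^α` on `s` (for `α ≥ 1` interpreted via
`C^{⌊α⌋, α − ⌊α⌋}`). -/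
def InHolderCls {n : ℕ} (α : ℝ) (s : Set (Euc n)) (a : Euc n → ℝ) : Prop :=
  ContDiffOn ℝ (⌊α⌋₊ : ℕ) a s ∧
    ∃ C : ℝ≥0, HolderOnWith C (Real.toNNReal (α - ⌊α⌋₊))
      (fun x => iteratedFDerivWithin ℝ ⌊α⌋₊ a s x) s

/-- The restricted Riesz potential `I₁^⋈(|f|)(x̄,0) = ∫_{C((x̄,0))} |f(y)| |x−y|^{1−d} dy`,
where `C(x)` is the double cone `{y : |ȳ − x̄| ≤ |y_d − x_d|/2}` (here `d = n+1`). -/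
def rieszBow {n : ℕ} (f : Euc (n + 1) → ℝ) (xb : Euc n) : ℝ≥0∞ :=
  ∫⁻ y : Euc (n + 1),
    ENNReal.ofReal ((if dist (frontC y) xb ≤ |lastC y| / 2 then (1 : ℝ) else 0) *
      |f y| * Real.sqrt (dist (frontC y) xb ^ 2 + lastC y ^ 2) ^ (-(n : ℝ)))

/-- The upper average `⟨f⟩⁺_{x̄,r} = ∫_{B_1} ω(y) f(x̄ + |r| ȳ, |r| y_d + |r|) dy`. -/
def avgPlus {n : ℕ} (ω : Euc (n + 1) → ℝ) (f : Euc (n + 1) → ℝ) (xb : Euc n) (r : ℝ) : ℝ :=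
  ∫ y in Metric.ball (0 : Euc (n + 1)) 1,
    ω y * f (snocC (xb + |r| • frontC y) (|r| * lastC y + |r|))

/-- The lower average `⟨f⟩⁻_{x̄,r} = ∫_{B_1} ω(y) f(x̄ + |r| ȳ, |r| y_d − |r|) dy`. -/
def avgMinus {n : ℕ} (ω : Euc (n + 1) → ℝ) (f : Euc (n + 1) → ℝ) (xb : Euc n) (r : ℝ) : ℝ :=
  ∫ y in Metric.ball (0 : Euc (n + 1)) 1,
    ω y * f (snocC (xb + |r| • frontC y) (|r| * lastC y - |r|))

open Classical in
/-- The function `u_d(x) = (1/2) sgn(x_d) θ(|x_d|/|x̄|)` (extended by its natural limit value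
`(1/2) sgn(x_d)` on the line `x̄ = 0`). -/
def uD {n : ℕ} (θ : ℝ → ℝ) (x : Euc (n + 1)) : ℝ :=
  if frontC x = 0 then (1 / 2) * Real.sign (lastC x)
  else (1 / 2) * Real.sign (lastC x) * θ (|lastC x| / ‖frontC x‖)

/-- Hypotheses on the profile function `θ`:
smooth on `(0,∞)`, `1_{(1/2,∞)} ≤ θ ≤ 1_{(1/4,∞)}` and `‖θ'‖_∞ ≤ 6`. -/
def IsProfile (θ : ℝ → ℝ) : Prop :=
  ContDiffOn ℝ (⊤ : ℕ∞) θ (Set.Ioi 0) ∧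
    (∀ t : ℝ, 0 < t → (if 1 / 2 < t then (1 : ℝ) else 0) ≤ θ t) ∧
    (∀ t : ℝ, 0 < t → θ t ≤ if 1 / 4 < t then 1 else 0) ∧
    (∀ t : ℝ, 0 < t → |deriv θ t| ≤ 6)

end

noncomputable section PB
open Convolution ContinuousLinearMap

/-- bump of radius `h` -/
def bmp (d : ℕ) (h : ℝ) (hh : 0 < h) : ContDiffBump (0 : Euc d) := ⟨h / 2, h, by linarith, by linarith⟩

def kern (d : ℕ) (h : ℝ) (x : Euc d) : ℝ :=
  if hh : 0 < h then (bmp d h hh).normed volume x else 0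

def avg {d : ℕ} {V : Type*} [NormedAddCommGroup V] [NormedSpace ℝ V] (h : ℝ) (u : Euc d → V) :
    Euc d → V := kern d h ⋆[lsmul ℝ ℝ, volume] u

variable {d : ℕ} {V : Type*} [NormedAddCommGroup V] [NormedSpace ℝ V]

lemma kern_eq {h : ℝ} (hh : 0 < h) : kern d h = (bmp d h hh).normed volume := by
  funext x; simp [kern, hh]

lemma kern_contDiff {h : ℝ} (hh : 0 < h) {n : ℕ∞} : ContDiff ℝ n (kern d h) := by
  rw [kern_eq hh]; exact (bmp d h hh).contDiff_normed

lemma kern_compact {h : ℝ} (hh : 0 < h) : HasCompactSupport (kern d h) := by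
  rw [kern_eq hh]; exact (bmp d h hh).hasCompactSupport_normed

lemma kern_nonneg (h : ℝ) (x : Euc d) : 0 ≤ kern d h x := by
  unfold kern; split_ifs with hh
  · exact (bmp d h hh).nonneg_normed x
  · exact le_rfl

lemma kern_zero {h : ℝ} (x : Euc d) (hx : h ≤ ‖x‖) : kern d h x = 0 := by
  unfold kern; split_ifs with hh
  · have : x ∉ Function.support ((bmp d h hh).normed volume) := by
      rw [ContDiffBump.support_normed_eq]; simpa [bmp] using hx
    simpa using this
  · rfl

/-- constant in the sup bound -/
def kc (d : ℕ) : ℝ := 2 ^ d / volume.real (closedBall (0 : Euc d) 1)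

lemma kc_nonneg : 0 ≤ kc d := by unfold kc; positivity

lemma kern_le {h : ℝ} (hh : 0 < h) (x : Euc d) : kern d h x ≤ kc d * (h⁻¹) ^ d := by
  rw [kern_eq hh]
  refine ((bmp d h hh).normed_le_div_measure_closedBall_rOut (μ := volume) 2 ?_ x).trans ?_
  · simp [bmp]; linarith
  · have : volume.real (closedBall (0 : Euc d) (bmp d h hh).rOut)
        = h ^ d * volume.real (closedBall (0 : Euc d) 1) := by
      have := Measure.addHaar_real_closedBall (volume : Measure (Euc d)) (0 : Euc d) (r := h) hh.le
      simp only [finrank_euclideanSpace, Fintype.card_fin] at this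
      rw [show (bmp d h hh).rOut = h from rfl, this,
        Measure.real, Measure.real, Measure.addHaar_unitClosedBall_eq_addHaar_unitBall]
    rw [this]
    simp only [finrank_euclideanSpace, Fintype.card_fin]
    unfold kc
    apply le_of_eq
    rw [inv_pow]
    field_simp

lemma kern_integral {h : ℝ} (hh : 0 < h) : ∫ x, kern d h x = 1 := by
  rw [kern_eq hh]; exact (bmp d h hh).integral_normed

lemma avg_eq (h : ℝ) (u : Euc d → V) (x : Euc d) : avg h u x = ∫ y, kern d h (x - y) • u y := by
  unfold avg; rw [convolution_lsmul_swap]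

lemma avg_enorm_le {h : ℝ} (hh : 0 < h) (G : Euc d → V) (x : Euc d) :
    ‖avg h G x‖ₑ ≤ ENNReal.ofReal (kc d * (h⁻¹) ^ d) * ∫⁻ y in closedBall x h, ‖G y‖ₑ := by
  rw [avg_eq]
  refine (enorm_integral_le_lintegral_enorm _).trans ?_
  rw [← lintegral_const_mul' _ _ ENNReal.ofReal_ne_top, ← lintegral_indicator isClosed_closedBall.measurableSet]
  refine lintegral_mono fun y => ?_
  by_cases hy : y ∈ closedBall x h
  · rw [indicator_of_mem hy, enorm_smul]
    gcongr
    rw [Real.enorm_of_nonneg (kern_nonneg _ _)]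
    exact ENNReal.ofReal_le_ofReal (kern_le hh _)
  · rw [kern_zero, zero_smul]; · simp
    rw [mem_closedBall, not_le, dist_eq_norm, norm_sub_rev] at hy; exact hy.le

lemma avg_congr {h : ℝ} {u v : Euc d → V} (x : Euc d)
    (huv : ∀ᵐ y, y ∈ closedBall x h → u y = v y) : avg h u x = avg h v x := by
  rw [avg_eq, avg_eq]
  refine integral_congr_ae ?_
  filter_upwards [huv] with y hy
  by_cases h1 : y ∈ closedBall x h
  · rw [hy h1]
  · rw [kern_zero, zero_smul, zero_smul]
    rw [mem_closedBall, not_le, dist_eq_norm, norm_sub_rev] at h1; exact h1.le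

lemma avg_const [CompleteSpace V] {h : ℝ} (hh : 0 < h) (c : V) (x : Euc d) :
    avg h (fun _ => c) x = c := by
  rw [avg_eq, integral_smul_const, integral_sub_left_eq_self (fun y => kern d h y) volume x,
    kern_integral hh, one_smul]

lemma avg_integrable {h : ℝ} (hh : 0 < h) {u : Euc d → V} (hu : LocallyIntegrable u) (x : Euc d) :
    Integrable (fun y => kern d h (x - y) • u y) := by
  have := (kern_compact (d := d) hh).convolutionExists_left (lsmul ℝ ℝ)
    (kern_contDiff (n := 0) hh).continuous hu x
  have h2 := this.integrable_swap
  simpa using h2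

lemma avg_add {h : ℝ} (hh : 0 < h) {u v : Euc d → V} (hu : LocallyIntegrable u)
    (hv : LocallyIntegrable v) (x : Euc d) :
    avg h (fun y => u y + v y) x = avg h u x + avg h v x := by
  rw [avg_eq, avg_eq, avg_eq, ← integral_add (avg_integrable hh hu x) (avg_integrable hh hv x)]
  simp

lemma avg_sub_const_le {h : ℝ} (hh : 0 < h) {u : Euc d → ℝ} (hu : LocallyIntegrable u) (c : ℝ)
    (x : Euc d) : |avg h u x - c| ≤ kc d * (h⁻¹) ^ d * ∫ y in closedBall x h, |u y - c| := by
  have h1 : avg h u x - c = avg h (fun y => u y + (-c)) x := by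
    rw [avg_add hh hu (locallyIntegrable_const _), avg_const hh]; ring
  rw [h1, avg_eq, ← integral_const_mul, ← integral_indicator isClosed_closedBall.measurableSet, ← Real.norm_eq_abs]
  refine norm_integral_le_of_norm_le ?_ ?_
  · refine IntegrableOn.integrable_indicator ?_ isClosed_closedBall.measurableSet
    refine Integrable.const_mul ?_ _
    refine Integrable.abs (Integrable.sub ?_ ?_)
    · exact hu.integrableOn_isCompact (isCompact_closedBall _ _)
    · exact integrableOn_const measure_closedBall_lt_top.ne
  · refine Eventually.of_forall fun y => ?_
    by_cases hy : y ∈ closedBall x h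
    · rw [indicator_of_mem hy, norm_smul, Real.norm_eq_abs, Real.norm_eq_abs,
        abs_of_nonneg (kern_nonneg _ _), ← sub_eq_add_neg]
      exact mul_le_mul_of_nonneg_right (kern_le hh _) (abs_nonneg _)
    · rw [indicator_of_notMem hy, kern_zero, zero_smul, norm_zero]
      rw [mem_closedBall, not_le, dist_eq_norm, norm_sub_rev] at hy; exact hy.le

lemma avg_hasFDerivAt {h : ℝ} (hh : 0 < h) {u : Euc d → ℝ} {G : Euc d → Euc d →L[ℝ] ℝ}
    (hu : LocallyIntegrable u) (hw : HasWeakFDerivOn univ u G) (x : Euc d) :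
    HasFDerivAt (avg h u) (avg h G x) x := by
  have h1 := (kern_compact (d := d) hh).hasFDerivAt_convolution_left (lsmul ℝ ℝ)
    (kern_contDiff (n := 1) hh) hu x
  have h2 : (fderiv ℝ (kern d h) ⋆[(lsmul ℝ ℝ).precompL (Euc d), volume] u) x = avg h G x := by
    rw [convolution_eq_swap, avg_eq]
    have h3 := hw (fun y => kern d h (x - y))
      ((kern_contDiff hh).comp (contDiff_const.sub contDiff_id)) ?_ (subset_univ _)
    · simp only [Measure.restrict_univ] at h3
      have h4 : ∀ y, fderiv ℝ (fun y => kern d h (x - y)) y = - fderiv ℝ (kern d h) (x - y) := by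
        intro y
        have h5 : HasFDerivAt (kern d h) (fderiv ℝ (kern d h) (x - y)) (x - y) :=
          ((kern_contDiff (n := 1) hh).differentiable (by norm_num) _).hasFDerivAt
        have h6 : HasFDerivAt (fun y : Euc d => x - y) (-ContinuousLinearMap.id ℝ _) y :=
          (hasFDerivAt_id y).const_sub x
        have := (h5.comp y h6).fderiv
        rw [show (fun y => kern d h (x - y)) = kern d h ∘ (fun y => x - y) from rfl, this]
        ext v; simp
      simp only [h4, smul_neg, integral_neg, neg_inj] at h3
      rw [← h3]
      refine integral_congr_ae (Eventually.of_forall fun y => ?_)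
      ext v
      simp [ContinuousLinearMap.precompL_apply, mul_comm]
    · have := (kern_compact (d := d) hh).comp_homeomorph (Homeomorph.subLeft x)
      exact this
  rw [← h2]; exact h1

lemma avg_seg {h : ℝ} (hh : 0 < h) {u : Euc d → ℝ} {G : Euc d → Euc d →L[ℝ] ℝ}
    (hu : LocallyIntegrable u) (hw : HasWeakFDerivOn univ u G)
    {p q : Euc d} {E : Set (Euc d)} (hE : ∀ x ∈ segment ℝ p q, closedBall x h ⊆ E) :
    ‖avg h u q - avg h u p‖ₑ ≤
      ENNReal.ofReal (‖q - p‖ * (kc d * (h⁻¹) ^ d)) * ∫⁻ y in E, ‖G y‖ₑ := by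
  rcases eq_or_ne q p with rfl | hqp
  · simp
  have hk : 0 < kc d * (h⁻¹) ^ d := by
    have : 0 < volume.real (closedBall (0 : Euc d) 1) :=
      ENNReal.toReal_pos (measure_closedBall_pos _ _ one_pos).ne' measure_closedBall_lt_top.ne
    unfold kc; positivity
  have hn : 0 < ‖q - p‖ := norm_pos_iff.2 (sub_ne_zero.2 hqp)
  by_cases hT : ∫⁻ y in E, ‖G y‖ₑ = ⊤
  · rw [hT, ENNReal.mul_top]; · exact le_top
    exact (ENNReal.ofReal_pos.2 (mul_pos hn hk)).ne'
  set K := ENNReal.ofReal (kc d * (h⁻¹) ^ d) * ∫⁻ y in E, ‖G y‖ₑ with hK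
  have hKt : K ≠ ⊤ := ENNReal.mul_ne_top ENNReal.ofReal_ne_top hT
  have hb : ∀ x ∈ segment ℝ p q, ‖avg h G x‖ ≤ K.toReal := by
    intro x hx
    have := (avg_enorm_le hh G x).trans (mul_le_mul_right (lintegral_mono_set (hE x hx)) _)
    rw [← toReal_enorm]
    exact ENNReal.toReal_mono hKt this
  have := (convex_segment p q).norm_image_sub_le_of_norm_hasFDerivWithin_le (𝕜 := ℝ)
    (fun x _ => (avg_hasFDerivAt hh hu hw x).hasFDerivWithinAt) hb
    (left_mem_segment ℝ p q) (right_mem_segment ℝ p q)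
  rw [ENNReal.ofReal_mul hn.le, mul_comm (ENNReal.ofReal ‖q - p‖), mul_right_comm, ← hK,
    ← ENNReal.ofReal_toReal hKt, ← ENNReal.ofReal_mul ENNReal.toReal_nonneg, ← ofReal_norm]
  exact ENNReal.ofReal_le_ofReal this

lemma avg_continuous {h : ℝ} (hh : 0 < h) {u : Euc d → V} (hu : LocallyIntegrable u) :
    Continuous (avg h u) :=
  (kern_compact (d := d) hh).continuous_convolution_left _ (kern_contDiff (n := 0) hh).continuous hu

lemma avg_comm {h k : ℝ} (hh : 0 < h) (hk : 0 < k) {u : Euc d → ℝ}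
    (hu : LocallyIntegrable u) (x : Euc d) : avg h (avg k u) x = avg k (avg h u) x := by
  have key : ∀ {a b : ℝ}, 0 < a → 0 < b → avg a (avg b u) x =
      ((kern d a ⋆[lsmul ℝ ℝ, volume] kern d b) ⋆[lsmul ℝ ℝ, volume] u) x := by
    intro a b ha hb
    symm
    unfold avg
    refine convolution_assoc (lsmul ℝ ℝ) (lsmul ℝ ℝ) (lsmul ℝ ℝ) (lsmul ℝ ℝ)
      (fun x y z => by simp [mul_assoc]) ?_ ?_ hu.aestronglyMeasurable ?_ ?_ ?_
    · exact (kern_contDiff (n := 0) ha).continuous.aestronglyMeasurable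
    · exact (kern_contDiff (n := 0) hb).continuous.aestronglyMeasurable
    · exact Eventually.of_forall ((kern_compact ha).convolutionExists_left _
        (kern_contDiff (n := 0) ha).continuous (kern_contDiff (n := 0) hb).continuous.locallyIntegrable)
    · exact Eventually.of_forall ((kern_compact hb).norm.convolutionExists_left _
        (kern_contDiff (n := 0) hb).continuous.norm (fun z => (hu z).norm))
    · refine (kern_compact ha).norm.convolutionExists_left _
        (kern_contDiff (n := 0) ha).continuous.norm (Continuous.locallyIntegrable ?_) _
      exact (kern_compact hb).norm.continuous_convolution_left _
        (kern_contDiff (n := 0) hb).continuous.norm (fun z => (hu z).norm)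
  rw [key hh hk, key hk hh]
  congr 1
  rw [← convolution_flip (L := lsmul ℝ ℝ) (f := kern d h)]
  congr 1
  ext; simp

lemma avg_near {h : ℝ} (hh : 0 < h) {v : Euc d → ℝ} (hv : Continuous v) {x : Euc d} {K : ℝ≥0∞}
    (hK : ∀ y ∈ ball x h, ‖v y - v x‖ₑ ≤ K) : ‖avg h v x - v x‖ₑ ≤ K := by
  by_cases hT : K = ⊤
  · simp [hT]
  have := (bmp d h hh).dist_normed_convolution_le (μ := volume) (g := v) (x₀ := x) (ε := K.toReal)
    hv.aestronglyMeasurable (fun y hy => by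
      rw [dist_eq_norm, ← toReal_enorm]; exact ENNReal.toReal_mono hT (hK y hy))
  rw [← kern_eq hh, dist_eq_norm] at this
  rw [← ENNReal.ofReal_toReal hT, ← ofReal_norm]
  exact ENNReal.ofReal_le_ofReal this

lemma avg_dil {h : ℝ} (hh : 0 < h) {u : Euc d → ℝ} {G : Euc d → Euc d →L[ℝ] ℝ}
    (hu : LocallyIntegrable u) (hw : HasWeakFDerivOn univ u G) (p : Euc d) :
    ‖avg h u p - avg (h / 2) u p‖ₑ ≤
      ENNReal.ofReal (2 ^ (d + 1) * h * (kc d * (h⁻¹) ^ d)) * ∫⁻ y in closedBall p (2 * h), ‖G y‖ₑ := by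
  have hh2 : 0 < h / 2 := by linarith
  have e1 : ‖avg (h / 2) (avg h u) p - avg h u p‖ₑ ≤
      ENNReal.ofReal (h * (kc d * (h⁻¹) ^ d)) * ∫⁻ y in closedBall p (2 * h), ‖G y‖ₑ := by
    refine avg_near hh2 (avg_continuous hh hu) fun y hy => ?_
    refine (avg_seg hh hu hw (E := closedBall p (2 * h)) ?_).trans ?_
    · intro x hx z hz
      have : dist x p ≤ h := by
        have := (convex_closedBall p h).segment_subset (mem_closedBall_self hh.le)
          (mem_closedBall.2 ((mem_ball.1 hy).le.trans (by linarith))) hx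
        exact this
      rw [mem_closedBall] at hz ⊢
      linarith [dist_triangle z x p]
    · gcongr
      · have := kc_nonneg (d := d); positivity
      · rw [← dist_eq_norm]; exact (mem_ball.1 hy).le.trans (by linarith)
  have e2 : ‖avg h (avg (h / 2) u) p - avg (h / 2) u p‖ₑ ≤
      ENNReal.ofReal (h * (kc d * ((h / 2)⁻¹) ^ d)) * ∫⁻ y in closedBall p (2 * h), ‖G y‖ₑ := by
    refine avg_near hh (avg_continuous hh2 hu) fun y hy => ?_
    refine (avg_seg hh2 hu hw (E := closedBall p (2 * h)) ?_).trans ?_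
    · intro x hx z hz
      have : dist x p ≤ h := by
        have := (convex_closedBall p h).segment_subset (mem_closedBall_self hh.le)
          (mem_closedBall.2 ((mem_ball.1 hy).le)) hx
        exact this
      rw [mem_closedBall] at hz ⊢
      linarith [dist_triangle z x p]
    · gcongr
      · have := kc_nonneg (d := d); positivity
      · rw [← dist_eq_norm]; exact (mem_ball.1 hy).le
  rw [avg_comm hh hh2 hu] at e2
  have e3 : avg h u p - avg (h / 2) u p = -(avg (h / 2) (avg h u) p - avg h u p) +
    (avg (h / 2) (avg h u) p - avg (h / 2) u p) := by ring
  rw [e3]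
  refine (enorm_add_le _ _).trans ?_
  rw [enorm_neg]
  refine (add_le_add e1 e2).trans ?_
  have := kc_nonneg (d := d)
  rw [← add_mul, ← ENNReal.ofReal_add (by positivity) (by positivity)]
  gcongr
  rw [show (h / 2)⁻¹ = 2 * h⁻¹ by field_simp, mul_pow, pow_succ]
  have h1 : (1:ℝ) ≤ 2 ^ d := one_le_pow₀ (by norm_num)
  have : 0 ≤ h * (kc d * h⁻¹ ^ d) := by positivity
  nlinarith

end PB



noncomputable section Poinc
variable {d : ℕ}

structure ZC (w : Euc d → ℝ) (H : Euc d → Euc d →L[ℝ] ℝ) : Prop where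
  iw : Integrable w
  iH : Integrable H
  w0 : ∀ x, x ∉ Box d → w x = 0
  H0 : ∀ x, x ∉ Box d → H x = 0
  wk : HasWeakFDerivOn univ w H

lemma box_open (d : ℕ) : IsOpen (Box d) := by
  have : Box d = ⋂ i, {x : Euc d | |x i| < 1} := by ext; simp [Box]
  rw [this]
  exact isOpen_iInter_of_finite fun i => isOpen_lt (by fun_prop) continuous_const

lemma box_sub (d : ℕ) : Box d ⊆ closedBall 0 (d : ℝ) := by
  intro x hx
  rw [mem_closedBall, dist_zero_right, EuclideanSpace.norm_eq]
  refine Real.sqrt_le_iff.2 ⟨by positivity, ?_⟩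
  calc ∑ i, ‖x i‖ ^ 2 ≤ ∑ i : Fin d, (1:ℝ) := by
        refine Finset.sum_le_sum fun i _ => ?_
        have := hx i
        rw [Real.norm_eq_abs]; exact pow_le_one₀ (abs_nonneg _) this.le
    _ = d := by simp
    _ ≤ (d:ℝ) ^ 2 := by
      rcases Nat.eq_zero_or_pos d with h | h
      · simp [h]
      · have : (1:ℝ) ≤ d := by exact_mod_cast h
        nlinarith

lemma box_fin (d : ℕ) : volume (Box d) < ⊤ :=
  (measure_mono (box_sub d)).trans_lt measure_closedBall_lt_top

lemma avg_L1 {h : ℝ} (hh : 0 < h) {V : Type*} [NormedAddCommGroup V] [NormedSpace ℝ V]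
    {G : Euc d → V} (hG : Integrable G) :
    ∫⁻ x, ‖avg h G x‖ₑ ≤ ∫⁻ x, ‖G x‖ₑ := by
  calc ∫⁻ x, ‖avg h G x‖ₑ ≤ ∫⁻ x, ∫⁻ y, ENNReal.ofReal (kern d h (x - y)) * ‖G y‖ₑ := by
        refine lintegral_mono fun x => ?_
        rw [avg_eq]
        refine (enorm_integral_le_lintegral_enorm _).trans (lintegral_mono fun y => ?_)
        rw [enorm_smul, Real.enorm_of_nonneg (kern_nonneg _ _)]
    _ = ∫⁻ y, ∫⁻ x, ENNReal.ofReal (kern d h (x - y)) * ‖G y‖ₑ := by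
        refine lintegral_lintegral_swap ?_
        have hm : Measurable fun p : Euc d × Euc d => kern d h (p.1 - p.2) :=
          ((kern_contDiff (n := 0) hh).continuous.comp
            (by fun_prop : Continuous fun p : Euc d × Euc d => p.1 - p.2)).measurable
        refine AEMeasurable.mul (f := fun p : Euc d × Euc d => ENNReal.ofReal (kern d h (p.1 - p.2)))
          (g := fun p : Euc d × Euc d => ‖G p.2‖ₑ) ?_ ?_
        · exact hm.ennreal_ofReal.aemeasurable
        · exact hG.aestronglyMeasurable.enorm.comp_snd
    _ = ∫⁻ y, ‖G y‖ₑ := by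
        refine lintegral_congr fun y => ?_
        rw [lintegral_mul_const' _ _ enorm_ne_top, lintegral_sub_right_eq_self
          (fun x => ENNReal.ofReal (kern d h x)) y, ← ofReal_integral_eq_lintegral_ofReal, kern_integral hh]
        · simp
        · rw [kern_eq hh]; exact (bmp d h hh).integrable_normed
        · exact Eventually.of_forall fun x => kern_nonneg _ _

lemma avg_line {h : ℝ} (hh : 0 < h) {w : Euc d → ℝ} {H : Euc d → Euc d →L[ℝ] ℝ}
    (hz : ZC w H) (x e : Euc d) :
    ‖avg h w (x + e) - avg h w x‖ₑ ≤ ‖e‖ₑ * ∫⁻ s in Ioc (0:ℝ) 1, ‖avg h H (x + s • e)‖ₑ := by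
  have hd : ∀ s : ℝ, HasDerivAt (fun s : ℝ => avg h w (x + s • e)) (avg h H (x + s • e) e) s := by
    intro s
    have h1 := avg_hasFDerivAt hh hz.iw.locallyIntegrable hz.wk (x + s • e)
    have h2 : HasDerivAt (fun s : ℝ => x + s • e) e s := by
      simpa using ((hasDerivAt_id s).smul_const e).const_add x
    exact h1.comp_hasDerivAt s h2
  have hc : Continuous fun s : ℝ => avg h H (x + s • e) e := by
    have := avg_continuous hh hz.iH.locallyIntegrable
    exact (this.comp (by fun_prop : Continuous fun s : ℝ => x + s • e)).clm_apply continuous_const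
  have := intervalIntegral.integral_eq_sub_of_hasDerivAt (a := 0) (b := 1) (fun s _ => hd s)
    (hc.intervalIntegrable _ _)
  simp only [one_smul, zero_smul, add_zero] at this
  rw [← this, intervalIntegral.integral_of_le zero_le_one,
    ← lintegral_const_mul' _ _ enorm_ne_top]
  refine (enorm_integral_le_lintegral_enorm _).trans (lintegral_mono fun s => ?_)
  rw [mul_comm]
  exact ContinuousLinearMap.le_opENorm _ _

lemma poincare (hd : 0 < d) {w : Euc d → ℝ} {H : Euc d → Euc d →L[ℝ] ℝ} (hz : ZC w H) :
    ∫⁻ x, ‖w x‖ₑ ≤ 4 * ∫⁻ x, ‖H x‖ₑ := by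
  let i : Fin d := ⟨0, hd⟩
  let e : Euc d := EuclideanSpace.single i 4
  have he : ‖e‖ₑ = 4 := by
    rw [← ofReal_norm]; simp [e]
  have hpos : ∀ n : ℕ, (0:ℝ) < 1 / (n + 1) := fun n => by positivity
  have step : ∀ n : ℕ, ∫⁻ x in Box d, ‖avg (1 / (n + 1 : ℝ)) w x‖ₑ ≤ 4 * ∫⁻ x, ‖H x‖ₑ := by
    intro n
    set h : ℝ := 1 / (n + 1 : ℝ) with hh
    have h0 : 0 < h := hpos n
    have h1 : h ≤ 1 := by
      rw [hh, div_le_one (by positivity)]; linarith [(Nat.cast_nonneg n : (0:ℝ) ≤ n)]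
    have hz0 : ∀ x ∈ Box d, avg h w (x + e) = 0 := by
      intro x hx
      have h2 : avg h w (x + e) = avg h (fun _ => (0:ℝ)) (x + e) := by
        refine avg_congr _ (Eventually.of_forall fun y hy => hz.w0 y fun hb => ?_)
        have h3 : |(y - (x + e)) i| ≤ ‖y - (x + e)‖ := by
          simpa using PiLp.norm_apply_le (y - (x + e)) i
        rw [← dist_eq_norm] at h3
        have h4 := h3.trans ((mem_closedBall.1 hy).trans h1)
        have h5 := hx i
        have h6 := hb i
        simp [e] at h4
        rw [abs_lt] at h5 h6
        rw [abs_le] at h4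
        linarith [h4.1]
      rw [h2, avg_const h0]
    calc ∫⁻ x in Box d, ‖avg h w x‖ₑ
        ≤ ∫⁻ x in Box d, ‖e‖ₑ * ∫⁻ s in Ioc (0:ℝ) 1, ‖avg h H (x + s • e)‖ₑ := by
          refine setLIntegral_mono_ae' (box_open d).measurableSet (Eventually.of_forall fun x hx => ?_)
          have := avg_line h0 hz x e
          rwa [hz0 x hx, zero_sub, enorm_neg] at this
      _ ≤ ∫⁻ x, ‖e‖ₑ * ∫⁻ s in Ioc (0:ℝ) 1, ‖avg h H (x + s • e)‖ₑ :=
          setLIntegral_le_lintegral _ _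
      _ = 4 * ∫⁻ s in Ioc (0:ℝ) 1, ∫⁻ x, ‖avg h H (x + s • e)‖ₑ := by
          rw [lintegral_const_mul' _ _ enorm_ne_top, he, lintegral_lintegral_swap]
          have := avg_continuous h0 hz.iH.locallyIntegrable
          refine Measurable.aemeasurable ?_
          exact (this.comp (by fun_prop : Continuous fun p : Euc d × ℝ => p.1 + p.2 • e)).enorm.measurable
      _ = 4 * ∫⁻ s in Ioc (0:ℝ) 1, ∫⁻ x, ‖avg h H x‖ₑ := by
          congr 1
          refine lintegral_congr fun s => ?_
          exact lintegral_add_right_eq_self (fun x => ‖avg h H x‖ₑ) (s • e)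
      _ = 4 * ∫⁻ x, ‖avg h H x‖ₑ := by simp
      _ ≤ 4 * ∫⁻ x, ‖H x‖ₑ := mul_le_mul_right (avg_L1 h0 hz.iH) _
  have hconv : ∀ᵐ x, Tendsto (fun n : ℕ => avg (1 / (n + 1 : ℝ)) w x) atTop (𝓝 (w x)) := by
    have := ContDiffBump.ae_convolution_tendsto_right_of_locallyIntegrable (μ := volume)
      (φ := fun n : ℕ => bmp d (1 / (n + 1 : ℝ)) (hpos n)) (l := atTop) (K := 2)
      tendsto_one_div_add_atTop_nhds_zero_nat
      (Eventually.of_forall fun n => by simp only [bmp]; linarith) hz.iw.locallyIntegrable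
    filter_upwards [this] with x hx
    refine hx.congr fun n => ?_
    rw [avg, kern_eq (hpos n)]
  calc ∫⁻ x, ‖w x‖ₑ = ∫⁻ x in Box d, ‖w x‖ₑ := by
        rw [← lintegral_indicator (box_open d).measurableSet]
        refine lintegral_congr fun x => ?_
        by_cases hx : x ∈ Box d
        · simp [hx]
        · simp [hx, hz.w0 x hx]
    _ ≤ ∫⁻ x in Box d, liminf (fun n : ℕ => ‖avg (1 / (n + 1 : ℝ)) w x‖ₑ) atTop := by
        refine lintegral_mono_ae ((ae_restrict_of_ae hconv).mono fun x hx => ?_)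
        exact ((continuous_enorm.tendsto _).comp hx).liminf_eq.ge
    _ ≤ liminf (fun n : ℕ => ∫⁻ x in Box d, ‖avg (1 / (n + 1 : ℝ)) w x‖ₑ) atTop :=
        lintegral_liminf_le fun n => (avg_continuous (hpos n) hz.iw.locallyIntegrable).enorm.measurable
    _ ≤ 4 * ∫⁻ x, ‖H x‖ₑ := by
        refine (liminf_le_liminf (Eventually.of_forall step)).trans ?_
        simp

end Poinc



noncomputable section UC
variable {d : ℕ}

lemma dual_mid {a b : Euc d →L[ℝ] ℝ} (hab : a ≠ b) (h : ‖a‖ = ‖b‖) :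
    ‖(2⁻¹ : ℝ) • (a + b)‖ < ‖a‖ := by
  obtain ⟨α, rfl⟩ := (InnerProductSpace.toDual ℝ (Euc d)).surjective a
  obtain ⟨β, rfl⟩ := (InnerProductSpace.toDual ℝ (Euc d)).surjective b
  have hne : α ≠ β := fun h => hab (by rw [h])
  rw [← map_add, norm_smul, LinearIsometryEquiv.norm_map, LinearIsometryEquiv.norm_map]
  rw [LinearIsometryEquiv.norm_map, LinearIsometryEquiv.norm_map] at h
  have := norm_add_lt_of_not_sameRay (x := α) (y := β) (fun hs => hne (hs.eq_of_norm_eq h))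
  norm_num
  linarith

def Dp (p : ℝ) (a b : Euc d →L[ℝ] ℝ) : ℝ :=
  (‖a‖ ^ p + ‖b‖ ^ p) / 2 - ‖(2⁻¹ : ℝ) • (a + b)‖ ^ p

lemma mid_norm_le (a b : Euc d →L[ℝ] ℝ) : ‖(2⁻¹ : ℝ) • (a + b)‖ ≤ (‖a‖ + ‖b‖) / 2 := by
  rw [norm_smul]; norm_num; linarith [norm_add_le a b]

lemma Dp_nonneg {p : ℝ} (hp : 1 < p) (a b : Euc d →L[ℝ] ℝ) : 0 ≤ Dp p a b := by
  unfold Dp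
  have h1 : ‖(2⁻¹ : ℝ) • (a + b)‖ ^ p ≤ ((‖a‖ + ‖b‖) / 2) ^ p :=
    Real.rpow_le_rpow (norm_nonneg _) (mid_norm_le a b) (by linarith)
  have h2 := (convexOn_rpow hp.le).2 (mem_Ici.2 (norm_nonneg a)) (mem_Ici.2 (norm_nonneg b))
    (by norm_num : (0:ℝ) ≤ 2⁻¹) (by norm_num : (0:ℝ) ≤ 2⁻¹) (by norm_num)
  simp only [smul_eq_mul] at h2
  have : (2⁻¹ * ‖a‖ + 2⁻¹ * ‖b‖) = (‖a‖ + ‖b‖) / 2 := by ring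
  rw [this] at h2
  linarith

lemma Dp_pos {p : ℝ} (hp : 1 < p) {a b : Euc d →L[ℝ] ℝ} (hab : a ≠ b) : 0 < Dp p a b := by
  unfold Dp
  by_cases h : ‖a‖ = ‖b‖
  · have := dual_mid hab h
    have := Real.rpow_lt_rpow (norm_nonneg _) this (by linarith : 0 < p)
    rw [← h]; linarith
  · have h1 : ‖(2⁻¹ : ℝ) • (a + b)‖ ^ p ≤ ((‖a‖ + ‖b‖) / 2) ^ p :=
      Real.rpow_le_rpow (norm_nonneg _) (mid_norm_le a b) (by linarith)
    have h2 := (strictConvexOn_rpow hp).2 (mem_Ici.2 (norm_nonneg a)) (mem_Ici.2 (norm_nonneg b)) h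
      (by norm_num : (0:ℝ) < 2⁻¹) (by norm_num : (0:ℝ) < 2⁻¹) (by norm_num)
    simp only [smul_eq_mul] at h2
    have : (2⁻¹ * ‖a‖ + 2⁻¹ * ‖b‖) = (‖a‖ + ‖b‖) / 2 := by ring
    rw [this] at h2
    linarith

lemma Dp_cont {p : ℝ} (hp : 1 < p) :
    Continuous fun ab : (Euc d →L[ℝ] ℝ) × (Euc d →L[ℝ] ℝ) => Dp p ab.1 ab.2 := by
  unfold Dp
  have hc := Real.continuous_rpow_const (q := p) (by linarith)
  refine Continuous.sub (Continuous.div_const (Continuous.add ?_ ?_) _) ?_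
  · exact hc.comp (by fun_prop : Continuous fun ab : (Euc d →L[ℝ] ℝ) × (Euc d →L[ℝ] ℝ) => ‖ab.1‖)
  · exact hc.comp (by fun_prop : Continuous fun ab : (Euc d →L[ℝ] ℝ) × (Euc d →L[ℝ] ℝ) => ‖ab.2‖)
  · exact hc.comp (by fun_prop :
      Continuous fun ab : (Euc d →L[ℝ] ℝ) × (Euc d →L[ℝ] ℝ) => ‖(2⁻¹ : ℝ) • (ab.1 + ab.2)‖)

lemma uc {p : ℝ} (hp : 1 < p) {ε : ℝ} (hε : 0 < ε) : ∃ C : ℝ, 0 ≤ C ∧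
    ∀ a b : Euc d →L[ℝ] ℝ, ‖a - b‖ ≤ ε * (1 + ‖a‖ ^ p + ‖b‖ ^ p) + C * Dp p a b := by
  obtain ⟨R, hR1, hR⟩ : ∃ R : ℝ, 1 ≤ R ∧ 2 / ε ≤ R ^ (p - 1) := by
    have := (_root_.tendsto_rpow_atTop (by linarith : 0 < p - 1)).eventually_ge_atTop (2 / ε)
    exact ((eventually_ge_atTop 1).and this).exists
  set K : Set ((Euc d →L[ℝ] ℝ) × (Euc d →L[ℝ] ℝ)) :=
    closedBall 0 R ∩ {ab | ε ≤ ‖ab.1 - ab.2‖} with hK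
  have hKc : IsCompact K := (isCompact_closedBall _ _).inter_right
    (isClosed_le continuous_const (by fun_prop))
  obtain ⟨m, hm, hmK⟩ : ∃ m : ℝ, 0 < m ∧ ∀ ab ∈ K, m ≤ Dp p ab.1 ab.2 := by
    rcases K.eq_empty_or_nonempty with h | h
    · exact ⟨1, one_pos, by simp [h]⟩
    · obtain ⟨z, hz, hz2⟩ := hKc.exists_isMinOn h (Dp_cont hp).continuousOn
      refine ⟨Dp p z.1 z.2, Dp_pos hp ?_, fun ab hab => hz2 hab⟩
      rintro h
      have := hz.2
      simp [h] at this
      linarith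
  refine ⟨2 * R / m, by positivity, fun a b => ?_⟩
  have hD := Dp_nonneg hp a b
  have ha : 0 ≤ ‖a‖ ^ p := by positivity
  have hb : 0 ≤ ‖b‖ ^ p := by positivity
  have hCD : 0 ≤ 2 * R / m * Dp p a b := by positivity
  by_cases h1 : ‖a - b‖ < ε
  · nlinarith
  push Not at h1
  have big : ∀ s : ℝ, R ≤ s → 2 * s ≤ ε * s ^ p := by
    intro s hs
    have hs0 : 0 < s := by linarith
    have : s ^ p = s ^ (p - 1) * s := by
      rw [← Real.rpow_add_one hs0.ne']; ring_nf
    rw [this]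
    have h3 : 2 / ε ≤ s ^ (p - 1) := hR.trans (Real.rpow_le_rpow (by linarith) hs (by linarith))
    rw [div_le_iff₀ hε] at h3
    nlinarith
  have tri := norm_sub_le a b
  by_cases h2 : ‖a‖ ≤ R ∧ ‖b‖ ≤ R
  · have : m ≤ Dp p a b := hmK (a, b) ⟨by simpa [Prod.norm_def] using h2, h1⟩
    have : 2 * R ≤ 2 * R / m * Dp p a b := by
      rw [div_mul_eq_mul_div, le_div_iff₀ hm]
      exact mul_le_mul_of_nonneg_left this (by linarith)
    have : 0 ≤ ε * (1 + ‖a‖ ^ p + ‖b‖ ^ p) := by positivity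
    linarith [h2.1, h2.2]
  · have : R < max ‖a‖ ‖b‖ := by
      by_contra h; push Not at h
      exact h2 ⟨(le_max_left _ _).trans h, (le_max_right _ _).trans h⟩
    rcases le_total ‖a‖ ‖b‖ with h | h
    · rw [max_eq_right h] at this
      have := big _ this.le
      nlinarith
    · rw [max_eq_left h] at this
      have := big _ this.le
      nlinarith

end UC



noncomputable section WK
variable {d : ℕ}

lemma ism1 {Ω : Set (Euc d)} {u : Euc d → ℝ} (hu : IntegrableOn u Ω) {φ : Euc d → ℝ}
    (h1 : ContDiff ℝ (⊤ : ℕ∞) φ) (h2 : HasCompactSupport φ) :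
    IntegrableOn (fun x => u x • fderiv ℝ φ x) Ω := by
  have hc : Continuous (fderiv ℝ φ) := h1.continuous_fderiv (by simp)
  obtain ⟨C, hC⟩ := (h2.fderiv ℝ).exists_bound_of_continuous hc
  refine Integrable.mono' (hu.norm.mul_const C) (hu.1.smul hc.aestronglyMeasurable) ?_
  refine Eventually.of_forall fun x => ?_
  rw [norm_smul]
  exact mul_le_mul_of_nonneg_left (hC x) (norm_nonneg _)

lemma ism2 {Ω : Set (Euc d)} {G : Euc d → Euc d →L[ℝ] ℝ} (hG : IntegrableOn G Ω) {φ : Euc d → ℝ}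
    (h1 : ContDiff ℝ (⊤ : ℕ∞) φ) (h2 : HasCompactSupport φ) :
    IntegrableOn (fun x => φ x • G x) Ω := by
  obtain ⟨C, hC⟩ := h2.exists_bound_of_continuous h1.continuous
  refine Integrable.mono' (hG.norm.const_mul C) (h1.continuous.aestronglyMeasurable.smul hG.1) ?_
  refine Eventually.of_forall fun x => ?_
  rw [norm_smul]
  exact mul_le_mul_of_nonneg_right (hC x) (norm_nonneg _)

lemma wk_lin {Ω : Set (Euc d)} {u v : Euc d → ℝ} {G H : Euc d → Euc d →L[ℝ] ℝ}
    (hu : W11On Ω u G) (hv : W11On Ω v H) (a b : ℝ) :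
    W11On Ω (fun x => a * u x + b * v x) (fun x => a • G x + b • H x) := by
  refine ⟨(hu.1.const_mul a).add (hv.1.const_mul b), (hu.2.1.smul a).add (hv.2.1.smul b), ?_⟩
  intro φ h1 h2 h3
  have e1 := hu.2.2 φ h1 h2 h3
  have e2 := hv.2.2 φ h1 h2 h3
  have l1 : ∀ x, (a * u x + b * v x) • fderiv ℝ φ x
      = a • (u x • fderiv ℝ φ x) + b • (v x • fderiv ℝ φ x) := by
    intro x; rw [add_smul, mul_smul, mul_smul]
  have l2 : ∀ x, φ x • (a • G x + b • H x) = a • (φ x • G x) + b • (φ x • H x) := by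
    intro x; rw [smul_add, smul_comm, smul_comm (φ x) b]
  simp_rw [l1, l2]
  have k1 := integral_add ((ism1 hu.1 h1 h2).smul a) ((ism1 hv.1 h1 h2).smul b)
  have k2 := integral_add ((ism2 hu.2.1 h1 h2).smul a) ((ism2 hv.2.1 h1 h2).smul b)
  simp only [Pi.smul_apply, integral_smul] at k1 k2
  rw [k1, k2]
  rw [e1, e2]; simp only [smul_neg, neg_add]

lemma wk_closed {Ω : Set (Euc d)} {u : ℕ → Euc d → ℝ} {G : ℕ → Euc d → Euc d →L[ℝ] ℝ}
    {v : Euc d → ℝ} {H : Euc d → Euc d →L[ℝ] ℝ} (hu : ∀ n, W11On Ω (u n) (G n))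
    (hv : IntegrableOn v Ω) (hH : IntegrableOn H Ω)
    (t1 : Tendsto (fun n => ∫⁻ x in Ω, ‖u n x - v x‖ₑ) atTop (𝓝 0))
    (t2 : Tendsto (fun n => ∫⁻ x in Ω, ‖G n x - H x‖ₑ) atTop (𝓝 0)) : W11On Ω v H := by
  refine ⟨hv, hH, ?_⟩
  intro φ h1 h2 h3
  have hc : Continuous (fderiv ℝ φ) := h1.continuous_fderiv (by simp)
  obtain ⟨C, hC⟩ := (h2.fderiv ℝ).exists_bound_of_continuous hc
  obtain ⟨D, hD⟩ := h2.exists_bound_of_continuous h1.continuous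
  have s1 : Tendsto (fun n => ∫ x in Ω, u n x • fderiv ℝ φ x) atTop
      (𝓝 (∫ x in Ω, v x • fderiv ℝ φ x)) := by
    refine tendsto_integral_of_L1 _ (ism1 hv h1 h2).1
      (Eventually.of_forall fun n => ism1 (hu n).1 h1 h2) ?_
    have := ENNReal.Tendsto.const_mul (a := ENNReal.ofReal C) t1 (Or.inr ENNReal.ofReal_ne_top)
    rw [mul_zero] at this
    refine tendsto_of_tendsto_of_tendsto_of_le_of_le tendsto_const_nhds this
      (fun n => zero_le) (fun n => ?_)
    rw [← lintegral_const_mul' _ _ ENNReal.ofReal_ne_top]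
    refine lintegral_mono fun x => ?_
    rw [← sub_smul, enorm_smul, mul_comm]
    gcongr
    rw [← ofReal_norm]; exact ENNReal.ofReal_le_ofReal (hC x)
  have s2 : Tendsto (fun n => ∫ x in Ω, φ x • G n x) atTop
      (𝓝 (∫ x in Ω, φ x • H x)) := by
    refine tendsto_integral_of_L1 _ (ism2 hH h1 h2).1
      (Eventually.of_forall fun n => ism2 (hu n).2.1 h1 h2) ?_
    have := ENNReal.Tendsto.const_mul (a := ENNReal.ofReal D) t2 (Or.inr ENNReal.ofReal_ne_top)
    rw [mul_zero] at this
    refine tendsto_of_tendsto_of_tendsto_of_le_of_le tendsto_const_nhds this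
      (fun n => zero_le) (fun n => ?_)
    rw [← lintegral_const_mul' _ _ ENNReal.ofReal_ne_top]
    refine lintegral_mono fun x => ?_
    rw [show φ x • G n x - φ x • H x = φ x • (G n x - H x) from (smul_sub (φ x) (G n x) (H x)).symm, enorm_smul]
    gcongr
    rw [← ofReal_norm]; exact ENNReal.ofReal_le_ofReal (hD x)
  have s3 : Tendsto (fun n => ∫ x in Ω, u n x • fderiv ℝ φ x) atTop
      (𝓝 (-∫ x in Ω, φ x • H x)) := by
    refine s2.neg.congr fun n => ?_
    rw [(hu n).2.2 φ h1 h2 h3]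
  exact tendsto_nhds_unique s1 s3

lemma ZC.w11 {w : Euc d → ℝ} {H : Euc d → Euc d →L[ℝ] ℝ} (h : ZC w H) : W11On univ w H :=
  ⟨h.iw.integrableOn, h.iH.integrableOn, h.wk⟩

lemma ZC.w11box {w : Euc d → ℝ} {H : Euc d → Euc d →L[ℝ] ℝ} (h : ZC w H) : W11On (Box d) w H := by
  refine ⟨h.iw.integrableOn, h.iH.integrableOn, fun φ h1 h2 h3 => ?_⟩
  have := h.wk φ h1 h2 (subset_univ _)
  rw [setIntegral_eq_integral_of_forall_compl_eq_zero, setIntegral_eq_integral_of_forall_compl_eq_zero]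
  · simpa using this
  · intro x hx; rw [h.H0 x hx, smul_zero]
  · intro x hx; rw [h.w0 x hx, zero_smul]

lemma ZC.lin {w z : Euc d → ℝ} {H Z : Euc d → Euc d →L[ℝ] ℝ} (h : ZC w H) (h' : ZC z Z) (a b : ℝ) :
    ZC (fun x => a * w x + b * z x) (fun x => a • H x + b • Z x) := by
  obtain ⟨i1, i2, i3⟩ := wk_lin h.w11 h'.w11 a b
  refine ⟨by simpa using i1, by simpa using i2, ?_, ?_, i3⟩
  · intro x hx; simp [h.w0 x hx, h'.w0 x hx]
  · intro x hx; simp [h.H0 x hx, h'.H0 x hx]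

lemma ZC.zero : ZC (fun _ : Euc d => (0:ℝ)) (fun _ => 0) := by
  refine ⟨integrable_zero _ _ _, integrable_zero (Euc d) (Euc d →L[ℝ] ℝ) volume, fun _ _ => rfl, fun _ _ => rfl, ?_⟩
  intro φ _ _ _; simp

lemma exists_cutoff {K U : Set (Euc d)} (hK : IsCompact K) (hU : IsOpen U) (hKU : K ⊆ U) :
    ∃ χ : Euc d → ℝ, ContDiff ℝ (⊤ : ℕ∞) χ ∧ HasCompactSupport χ ∧ tsupport χ ⊆ U ∧
      ∀ x ∈ K, ∀ᶠ y in 𝓝 x, χ y = 1 := by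
  obtain ⟨L, hL, hKL, hLU⟩ := exists_compact_between hK hU hKU
  obtain ⟨M, hM, hLM, hMU⟩ := exists_compact_between hL hU hLU
  obtain ⟨f, hf, -, hs, h1⟩ := exists_contMDiff_support_eq_eq_one_iff (modelWithCornersSelf ℝ (Euc d))
    (n := (⊤ : ℕ∞)) isOpen_interior hL.isClosed hLM
  refine ⟨f, hf.contDiff, ?_, ?_, ?_⟩
  · refine HasCompactSupport.of_support_subset_isCompact hM ?_
    rw [hs]; exact interior_subset
  · refine (closure_minimal ?_ hM.isClosed).trans hMU
    rw [hs]; exact interior_subset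
  · intro x hx
    filter_upwards [isOpen_interior.mem_nhds (hKL hx)] with y hy
    exact (h1 y).1 (interior_subset hy)

lemma ZC_aux {z : Euc d → ℝ} {Z : Euc d → Euc d →L[ℝ] ℝ} (h : W11On (Box d) z Z)
    {K : Set (Euc d)} (hK : IsCompact K)
    (h0 : ∀ᵐ x ∂(volume.restrict (Box d)), x ∉ K → z x = 0) :
    ∀ᵐ x, x ∈ Box d \ K → Z x = 0 := by
  refine ((box_open d).sdiff hK.isClosed).ae_eq_zero_of_integral_contDiff_smul_eq_zero
    (h.2.1.mono_set sdiff_subset).locallyIntegrableOn fun g hg1 hg2 hg3 => ?_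
  have e := h.2.2 g hg1 hg2 (hg3.trans sdiff_subset)
  have e0 : ∫ x in Box d, z x • fderiv ℝ g x = 0 := by
    refine integral_eq_zero_of_ae ?_
    filter_upwards [h0] with x hx
    by_cases hxK : x ∈ K
    · have : x ∉ tsupport g := fun hh => (hg3 hh).2 hxK
      have : fderiv ℝ g x = 0 := by
        by_contra hne
        exact this (tsupport_fderiv_subset ℝ (subset_tsupport _ hne))
      simp [this]
    · simp [hx hxK]
  rw [e0, zero_eq_neg] at e
  rw [← e, setIntegral_eq_integral_of_forall_compl_eq_zero]
  intro x hx
  have : x ∉ tsupport g := fun hh => hx (hg3 hh).1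
  rw [image_eq_zero_of_notMem_tsupport this, zero_smul]

lemma ZC_of_compact {z : Euc d → ℝ} {Z : Euc d → Euc d →L[ℝ] ℝ} (h : W11On (Box d) z Z)
    {K : Set (Euc d)} (hK : IsCompact K) (hKB : K ⊆ Box d)
    (h0 : ∀ᵐ x ∂(volume.restrict (Box d)), x ∉ K → z x = 0) :
    ZC ((Box d).indicator z) ((Box d).indicator Z) := by
  have hBm := (box_open d).measurableSet
  have hZ0 := ZC_aux h hK h0
  have iz : Integrable ((Box d).indicator z) := (integrable_indicator_iff hBm).2 h.1
  have iZ : Integrable ((Box d).indicator Z) := IntegrableOn.integrable_indicator (f := Z) h.2.1 hBm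
  refine ZC.mk iz iZ (fun x hx => indicator_of_notMem hx _) (fun x hx => indicator_of_notMem hx _) ?_
  intro φ h1 h2 _
  obtain ⟨χ, c1, c2, c3, c4⟩ := exists_cutoff hK (box_open d) hKB
  have e := h.2.2 (fun x => χ x * φ x) (c1.mul h1) c2.mul_right
    ((tsupport_mul_subset_left).trans c3)
  have i1 : ∫ x in univ, (Box d).indicator z x • fderiv ℝ φ x = ∫ x in Box d, z x • fderiv ℝ φ x := by
    rw [Measure.restrict_univ, ← integral_indicator hBm]
    congr 1; funext x; by_cases hx : x ∈ Box d <;> simp [hx]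
  have i2 : ∫ x in univ, φ x • (Box d).indicator Z x = ∫ x in Box d, φ x • Z x := by
    rw [Measure.restrict_univ, ← integral_indicator hBm]
    congr 1; funext x; by_cases hx : x ∈ Box d <;> simp [hx]
  rw [i1, i2]
  have j1 : ∫ x in Box d, z x • fderiv ℝ (fun x => χ x * φ x) x = ∫ x in Box d, z x • fderiv ℝ φ x := by
    refine integral_congr_ae ?_
    filter_upwards [h0] with x hx
    by_cases hxK : x ∈ K
    · have : (fun x => χ x * φ x) =ᶠ[𝓝 x] φ := by
        filter_upwards [c4 x hxK] with y hy; rw [hy, one_mul]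
      simp only [this.fderiv_eq]
    · simp [hx hxK]
  have j2 : ∫ x in Box d, (χ x * φ x) • Z x = ∫ x in Box d, φ x • Z x := by
    refine setIntegral_congr_ae hBm ?_
    filter_upwards [hZ0] with x hx hxB
    by_cases hxK : x ∈ K
    · rw [(c4 x hxK).self_of_nhds, one_mul]
    · simp [hx ⟨hxB, hxK⟩]
  exact j1.symm.trans (e.trans (congrArg Neg.neg j2))

end WK



noncomputable section EX
variable {d : ℕ}

lemma L1_complete {V : Type*} [NormedAddCommGroup V] [CompleteSpace V]
    {f : ℕ → Euc d → V} (hf : ∀ n, Integrable (f n))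
    (hC : ∀ η : ℝ, 0 < η → ∃ N, ∀ n ≥ N, ∀ k ≥ N, ∫⁻ x, ‖f n x - f k x‖ₑ ≤ ENNReal.ofReal η) :
    ∃ g : Euc d → V, Integrable g ∧ Tendsto (fun n => ∫⁻ x, ‖f n x - g x‖ₑ) atTop (𝓝 0) := by
  have hcs : CauchySeq fun n => (hf n).toL1 (f n) := by
    rw [EMetric.cauchySeq_iff]
    intro ε hε
    obtain ⟨r, hr0, hr⟩ := ENNReal.lt_iff_exists_nnreal_btwn.1 hε
    obtain ⟨N, hN⟩ := hC r (by exact_mod_cast hr0)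
    refine ⟨N, fun m hm n hn => lt_of_le_of_lt ?_ hr⟩
    rw [Integrable.edist_toL1_toL1]
    simp_rw [edist_eq_enorm_sub]
    simpa using hN m hm n hn
  obtain ⟨g, hg⟩ := cauchySeq_tendsto_of_complete hcs
  refine ⟨g, L1.integrable_coeFn g, ?_⟩
  rw [tendsto_iff_edist_tendsto_0] at hg
  refine hg.congr fun n => ?_
  conv_lhs => rw [← Integrable.toL1_coeFn g (L1.integrable_coeFn g)]
  rw [Integrable.edist_toL1_toL1]
  simp_rw [edist_eq_enorm_sub]

def en (p : Euc d → ℝ) (G : Euc d → Euc d →L[ℝ] ℝ) : ℝ≥0∞ :=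
  energyOf (Box d) (fun x t => t ^ p x / p x) (fun x => ‖G x‖)

lemma en_def (p : Euc d → ℝ) (G : Euc d → Euc d →L[ℝ] ℝ) :
    en p G = ∫⁻ x in Box d, ENNReal.ofReal (‖G x‖ ^ p x / p x) := rfl

variable {p : Euc d → ℝ} {pm pp : ℝ}

lemma en_meas (hp : Measurable p) {G : Euc d → Euc d →L[ℝ] ℝ} {μ : Measure (Euc d)}
    (hG : AEStronglyMeasurable G μ) :
    AEMeasurable (fun x => ENNReal.ofReal (‖G x‖ ^ p x / p x)) μ :=
  ((hG.norm.aemeasurable.pow hp.aemeasurable).div hp.aemeasurable).ennreal_ofReal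

lemma mid_energy (hp : Measurable p) (hp1 : ∀ x, 1 < p x) {G H : Euc d → Euc d →L[ℝ] ℝ}
    (hG : AEStronglyMeasurable G (volume.restrict (Box d))) :
    (∫⁻ x in Box d, ENNReal.ofReal (Dp (p x) (G x) (H x) / p x))
      + en p (fun x => (2⁻¹ : ℝ) • (G x + H x)) ≤ (en p G + en p H) / 2 := by
  rw [en_def, en_def, en_def]
  refine (le_lintegral_add _ _).trans ?_
  rw [← lintegral_add_left' (en_meas hp hG), div_eq_mul_inv, ← lintegral_mul_const' _ _ (by simp)]
  refine lintegral_mono fun x => ?_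
  have h0 : 0 < p x := by linarith [hp1 x]
  have h2 : (2 : ℝ≥0∞)⁻¹ = ENNReal.ofReal 2⁻¹ := by
    rw [ENNReal.ofReal_inv_of_pos two_pos]; simp
  simp only []
  rw [← ENNReal.ofReal_add (div_nonneg (Dp_nonneg (hp1 x) _ _) h0.le) (by positivity),
    ← ENNReal.ofReal_add (by positivity) (by positivity), h2,
    ← ENNReal.ofReal_mul (by positivity)]
  refine ENNReal.ofReal_le_ofReal (le_of_eq ?_)
  unfold Dp; field_simp; ring

lemma L1_bound (hpm : 1 < pm) (hpp : 1 < pp) (hp : Measurable p) (hpv : ∀ x, p x = pm ∨ p x = pp)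
    {ε : ℝ} (hε : 0 < ε) : ∃ C : ℝ, 0 ≤ C ∧ ∀ G H : Euc d → Euc d →L[ℝ] ℝ,
    AEStronglyMeasurable G (volume.restrict (Box d)) →
    AEStronglyMeasurable H (volume.restrict (Box d)) →
    ∫⁻ x in Box d, ‖G x - H x‖ₑ ≤ ENNReal.ofReal ε * (volume (Box d) +
      ENNReal.ofReal (pm + pp) * (en p G + en p H)) +
      ENNReal.ofReal C * ∫⁻ x in Box d, ENNReal.ofReal (Dp (p x) (G x) (H x) / p x) := by
  obtain ⟨C1, hC1, h1⟩ := uc (d := d) hpm hε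
  obtain ⟨C2, hC2, h2⟩ := uc (d := d) hpp hε
  refine ⟨(C1 + C2) * (pm + pp), by positivity, fun G H hG hH => ?_⟩
  have mG := en_meas hp hG
  have mH := en_meas hp hH
  rw [en_def, en_def, ← lintegral_add_left' mG, ← lintegral_const_mul' _ _ ENNReal.ofReal_ne_top,
    ← lintegral_const_mul' _ _ ENNReal.ofReal_ne_top, ← setLIntegral_one, ← lintegral_add_left (by fun_prop),
    ← lintegral_const_mul' _ _ ENNReal.ofReal_ne_top, ← lintegral_add_left']
  · refine lintegral_mono fun x => ?_
    have hp1 : 1 < p x := by rcases hpv x with h | h <;> rw [h] <;> assumption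
    have hle : p x ≤ pm + pp := by rcases hpv x with h | h <;> rw [h] <;> linarith
    have hD := Dp_nonneg hp1 (G x) (H x)
    have h0 : 0 < p x := by linarith
    have key : ‖G x - H x‖ ≤ ε * (1 + ‖G x‖ ^ p x + ‖H x‖ ^ p x) + (C1 + C2) * Dp (p x) (G x) (H x) := by
      rcases hpv x with h | h <;> rw [h] at hD ⊢
      · refine (h1 (G x) (H x)).trans ?_
        nlinarith
      · refine (h2 (G x) (H x)).trans ?_
        nlinarith
    have d1 : ∀ t : ℝ, 0 ≤ t → t ≤ (pm + pp) * (t / p x) := by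
      intro t ht
      rw [mul_div_assoc', le_div_iff₀ h0]; nlinarith
    have hg : 0 ≤ ‖G x‖ ^ p x := by positivity
    have hh : 0 ≤ ‖H x‖ ^ p x := by positivity
    simp only []
    have hpp0 : 0 ≤ pm + pp := by linarith
    rw [← ENNReal.ofReal_add (by positivity) (by positivity), ← ENNReal.ofReal_mul hpp0,
      ← ENNReal.ofReal_one, ← ENNReal.ofReal_add (by positivity) (by positivity),
      ← ENNReal.ofReal_mul hε.le, ← ENNReal.ofReal_mul (by positivity),
      ← ENNReal.ofReal_add (by positivity) (by positivity), ← ofReal_norm]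
    refine ENNReal.ofReal_le_ofReal (key.trans (add_le_add ?_ ?_))
    · refine mul_le_mul_of_nonneg_left ?_ hε.le
      have := d1 _ hg
      have := d1 _ hh
      linarith
    · rw [mul_assoc]
      refine mul_le_mul_of_nonneg_left (d1 _ hD) (by positivity)
  · exact (((mG.add mH).const_mul _).const_add _).const_mul _

lemma ind_conv {V : Type*} [NormedAddCommGroup V] {f : ℕ → Euc d → V} {g : Euc d → V}
    (hf : ∀ n x, x ∉ Box d → f n x = 0)
    (h : Tendsto (fun n => ∫⁻ x, ‖f n x - g x‖ₑ) atTop (𝓝 0)) :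
    Tendsto (fun n => ∫⁻ x, ‖f n x - (Box d).indicator g x‖ₑ) atTop (𝓝 0) := by
  refine tendsto_of_tendsto_of_tendsto_of_le_of_le tendsto_const_nhds h (fun n => zero_le)
    (fun n => lintegral_mono fun x => ?_)
  by_cases hx : x ∈ Box d
  · simp [hx]
  · simp [hx, hf n x hx]

theorem exists_min (hd : 0 < d) (hpm : 1 < pm) (hpp : 1 < pp) (hp : Measurable p)
    (hpv : ∀ x, p x = pm ∨ p x = pp) {u0 : Euc d → ℝ} {G0 : Euc d → Euc d →L[ℝ] ℝ}
    (h0 : W11On (Box d) u0 G0) (hfin : en p G0 < ⊤) :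
    ∃ w H, ZC w H ∧ en p (fun x => G0 x + H x) ≤ en p G0 ∧
      IsLocalMinimizer (Box d) (fun x t => t ^ p x / p x) (fun x => u0 x + w x)
        (fun x => G0 x + H x) := by
  have hp1 : ∀ x, 1 < p x := fun x => by rcases hpv x with h | h <;> rw [h] <;> assumption
  set S : Set ℝ≥0∞ := {e | ∃ w H, ZC w H ∧ en p (fun x => G0 x + H x) = e} with hS
  set m := sInf S with hm
  have hm0 : m ≤ en p G0 := by
    refine sInf_le ⟨_, _, ZC.zero, ?_⟩
    simp
  have hmt : m < ⊤ := hm0.trans_lt hfin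
  have hseq : ∀ n : ℕ, ∃ w H, ZC w H ∧ en p (fun x => G0 x + H x) ≤ m + ENNReal.ofReal (1 / (n + 1 : ℝ)) := by
    intro n
    have : sInf S < m + ENNReal.ofReal (1 / (n + 1 : ℝ)) := by
      rw [← hm]
      refine ENNReal.lt_add_right hmt.ne ?_
      rw [Ne, ENNReal.ofReal_eq_zero, not_le]; positivity
    obtain ⟨e, ⟨w, H, h, rfl⟩, he⟩ := sInf_lt_iff.1 this
    exact ⟨w, H, h, he.le⟩
  choose w H hZ hE using hseq
  have mG : ∀ n, AEStronglyMeasurable (fun x => G0 x + H n x) (volume.restrict (Box d)) :=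
    fun n => h0.2.1.1.add (hZ n).iH.1.restrict
  have hdiffb : ∀ n k, ∫⁻ x, ‖H n x - H k x‖ₑ =
      ∫⁻ x in Box d, ‖(G0 x + H n x) - (G0 x + H k x)‖ₑ := by
    intro n k
    simp only [add_sub_add_left_eq_sub]
    rw [← lintegral_indicator (box_open d).measurableSet]
    refine lintegral_congr fun x => ?_
    by_cases hx : x ∈ Box d
    · simp [hx]
    · rw [indicator_of_notMem hx, (hZ n).H0 x hx, (hZ k).H0 x hx,
        show (0 : Euc d →L[ℝ] ℝ) - 0 = 0 from sub_self _]
      exact enorm_zero (E := Euc d →L[ℝ] ℝ)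
  have hD : ∀ N n k : ℕ, N ≤ n → N ≤ k → ∫⁻ x in Box d, ENNReal.ofReal
      (Dp (p x) (G0 x + H n x) (G0 x + H k x) / p x) ≤ ENNReal.ofReal (1 / (N + 1 : ℝ)) := by
    intro N n k hn hk
    have hmono : ∀ n : ℕ, N ≤ n → en p (fun x => G0 x + H n x) ≤ m + ENNReal.ofReal (1 / (N + 1 : ℝ)) := by
      intro n hn
      refine (hE n).trans ?_
      gcongr
    have h1 := mid_energy hp hp1 (H := fun x => G0 x + H k x) (mG n)
    have h2 : m ≤ en p (fun x => (2⁻¹ : ℝ) • ((G0 x + H n x) + (G0 x + H k x))) := by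
      refine sInf_le ⟨_, _, (hZ n).lin (hZ k) 2⁻¹ 2⁻¹, ?_⟩
      congr 1; funext x
      rw [show (G0 x + H n x) + (G0 x + H k x) = (2:ℝ) • G0 x + (H n x + H k x) by
        rw [two_smul]; abel, smul_add, smul_smul, smul_add]
      norm_num
    have h3 : (en p (fun x => G0 x + H n x) + en p (fun x => G0 x + H k x)) / 2
        ≤ m + ENNReal.ofReal (1 / (N + 1 : ℝ)) := by
      refine (ENNReal.div_le_div_right (add_le_add (hmono n hn) (hmono k hk)) 2).trans ?_
      rw [← two_mul, mul_comm, mul_div_assoc, ENNReal.div_self (by simp) (by simp), mul_one]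
    have h4 := (add_le_add le_rfl h2).trans (h1.trans h3)
    rw [add_comm m] at h4
    exact (ENNReal.add_le_add_iff_right hmt.ne).1 h4
  have hCauchy : ∀ η : ℝ, 0 < η → ∃ N, ∀ n ≥ N, ∀ k ≥ N, ∫⁻ x, ‖H n x - H k x‖ₑ ≤ ENNReal.ofReal η := by
    intro η hη
    set M := (volume (Box d) + ENNReal.ofReal (pm + pp) * ((m + 1) + (m + 1))) with hM
    have hMt : M ≠ ⊤ := by
      refine ENNReal.add_ne_top.2 ⟨(box_fin d).ne, ENNReal.mul_ne_top ENNReal.ofReal_ne_top ?_⟩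
      simp [hmt.ne]
    set ε := η / (2 * (M.toReal + 1)) with hεd
    have hMp : 0 ≤ M.toReal := ENNReal.toReal_nonneg
    have hε : 0 < ε := by positivity
    obtain ⟨C, hC, hb⟩ := L1_bound (d := d) hpm hpp hp hpv hε
    obtain ⟨N, hN⟩ := exists_nat_gt (2 * C / η)
    refine ⟨N, fun n hn k hk => ?_⟩
    rw [hdiffb]
    refine (hb _ _ (mG n) (mG k)).trans ?_
    have hle1 : ∀ n : ℕ, en p (fun x => G0 x + H n x) ≤ m + 1 := by
      intro n
      refine (hE n).trans (add_le_add le_rfl ?_)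
      rw [← ENNReal.ofReal_one]
      refine ENNReal.ofReal_le_ofReal ?_
      rw [div_le_one (by positivity)]; linarith [(Nat.cast_nonneg n : (0:ℝ) ≤ n)]
    calc _ ≤ ENNReal.ofReal ε * M + ENNReal.ofReal C * ENNReal.ofReal (1 / (N + 1 : ℝ)) := by
          rw [hM]
          refine add_le_add (mul_le_mul_right (add_le_add le_rfl (mul_le_mul_right
            (add_le_add (hle1 n) (hle1 k)) _)) _) (mul_le_mul_right (hD N n k hn hk) _)
      _ = ENNReal.ofReal (ε * M.toReal + C * (1 / (N + 1 : ℝ))) := by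
          rw [ENNReal.ofReal_add (by positivity) (by positivity), ENNReal.ofReal_mul hε.le,
            ENNReal.ofReal_mul hC, ENNReal.ofReal_toReal hMt]
      _ ≤ ENNReal.ofReal η := by
          refine ENNReal.ofReal_le_ofReal ?_
          have a1 : ε * M.toReal ≤ η / 2 := by
            rw [hεd, div_mul_eq_mul_div, div_le_div_iff₀ (by positivity) two_pos]
            nlinarith
          have a2 : C * (1 / (N + 1 : ℝ)) ≤ η / 2 := by
            rw [mul_one_div, div_le_div_iff₀ (by positivity) two_pos]
            rw [div_lt_iff₀ hη] at hN
            nlinarith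
          linarith
  obtain ⟨H', iH', tH'⟩ := L1_complete (fun n => (hZ n).iH) hCauchy
  have hCw : ∀ η : ℝ, 0 < η → ∃ N, ∀ n ≥ N, ∀ k ≥ N, ∫⁻ x, ‖w n x - w k x‖ₑ ≤ ENNReal.ofReal η := by
    intro η hη
    obtain ⟨N, hN⟩ := hCauchy (η / 4) (by positivity)
    refine ⟨N, fun n hn k hk => ?_⟩
    have h1 := poincare hd ((hZ n).lin (hZ k) 1 (-1))
    have hs : ∀ x, (1:ℝ) • H n x + (-1:ℝ) • H k x = H n x - H k x := fun x => by
      ext v; simp; ring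
    simp only [hs, one_mul, neg_mul, ← sub_eq_add_neg] at h1
    refine h1.trans ((mul_le_mul_right (hN n hn k hk) 4).trans (le_of_eq ?_))
    rw [show (4 : ℝ≥0∞) = ENNReal.ofReal 4 by simp, ← ENNReal.ofReal_mul (by norm_num)]
    congr 1; ring
  obtain ⟨w', iw', tw'⟩ := L1_complete (fun n => (hZ n).iw) hCw
  have tH := ind_conv (fun n => (hZ n).H0) tH'
  have tw := ind_conv (fun n => (hZ n).w0) tw'
  set Hf := (Box d).indicator H' with hHf
  set wf := (Box d).indicator w' with hwf
  have iH : Integrable Hf := iH'.indicator (box_open d).measurableSet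
  have iw : Integrable wf := iw'.indicator (box_open d).measurableSet
  have hwk : W11On univ wf Hf := wk_closed (fun n => (hZ n).w11) iw.integrableOn iH.integrableOn
    (by simpa using tw) (by simpa using tH)
  have hZf : ZC wf Hf := ZC.mk iw iH (fun x hx => indicator_of_notMem hx _)
    (fun x hx => indicator_of_notMem hx _) hwk.2.2
  have hEm : en p (fun x => G0 x + Hf x) ≤ m := by
    have htm : TendstoInMeasure volume H atTop Hf := by
      refine tendstoInMeasure_of_tendsto_eLpNorm (p := 1) one_ne_zero (fun n => (hZ n).iH.1) iH.1 ?_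
      simp_rw [eLpNorm_one_eq_lintegral_enorm]
      exact tH
    obtain ⟨ns, hns, hae⟩ := htm.exists_seq_tendsto_ae
    calc en p (fun x => G0 x + Hf x)
        ≤ ∫⁻ x in Box d, liminf (fun i => ENNReal.ofReal (‖G0 x + H (ns i) x‖ ^ p x / p x)) atTop := by
          rw [en_def]
          refine lintegral_mono_ae ((ae_restrict_of_ae hae).mono fun x hx => ?_)
          have h1 : Tendsto (fun i => ENNReal.ofReal (‖G0 x + H (ns i) x‖ ^ p x / p x)) atTop
              (𝓝 (ENNReal.ofReal (‖G0 x + Hf x‖ ^ p x / p x))) := by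
            refine ENNReal.tendsto_ofReal (Tendsto.div_const ?_ _)
            exact ((hx.const_add (G0 x)).norm).rpow_const (Or.inr (by linarith [hp1 x]))
          exact h1.liminf_eq.ge
      _ ≤ liminf (fun i => en p (fun x => G0 x + H (ns i) x)) atTop :=
          lintegral_liminf_le' fun i => en_meas hp (mG (ns i))
      _ ≤ liminf (fun i => m + ENNReal.ofReal (1 / ((ns i : ℕ) + 1 : ℝ))) atTop :=
          liminf_le_liminf (Eventually.of_forall fun i => hE (ns i))
      _ = m := by
          have h1 : Tendsto (fun i => m + ENNReal.ofReal (1 / ((ns i : ℕ) + 1 : ℝ))) atTop (𝓝 (m + 0)) := by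
            refine Tendsto.const_add _ ?_
            have := ENNReal.tendsto_ofReal
              ((tendsto_one_div_add_atTop_nhds_zero_nat (𝕜 := ℝ)).comp hns.tendsto_atTop)
            simpa using this
          rw [add_zero] at h1
          exact h1.liminf_eq
  have hW : W11On (Box d) (fun x => u0 x + wf x) (fun x => G0 x + Hf x) := by
    have := wk_lin h0 hZf.w11box 1 1
    simpa using this
  refine ⟨wf, Hf, hZf, hEm.trans hm0, hW, hEm.trans_lt hmt, ?_⟩
  rintro v Gv hv ⟨K, hK, hKB, hKe⟩
  refine hEm.trans ?_
  have hz := wk_lin hv hW 1 (-1)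
  have hzz := ZC_of_compact hz hK hKB (hKe.mono fun x hx hxK => by rw [hx hxK]; ring)
  have hfinal := hZf.lin hzz 1 1
  have e : en p (fun x => Gv x) = en p (fun x => G0 x + ((1:ℝ) • Hf x + (1:ℝ) • (Box d).indicator
      (fun x => (1:ℝ) • Gv x + (-1:ℝ) • (G0 x + Hf x)) x)) := by
    rw [en_def, en_def]
    refine setLIntegral_congr_fun (box_open d).measurableSet fun x hx => ?_
    have hs : Gv x = G0 x + ((1:ℝ) • Hf x + (1:ℝ) • ((1:ℝ) • Gv x + (-1:ℝ) • (G0 x + Hf x))) := by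
      ext v; simp; ring
    simp only [indicator_of_mem hx]
    rw [← hs]
  change m ≤ en p (fun x => Gv x)
  rw [e]
  exact sInf_le ⟨_, _, hfinal, rfl⟩

end EX


noncomputable section RM

variable {d : ℕ}

lemma il1 {u : Euc d → ℝ} (hu : LocallyIntegrable u) {φ : Euc d → ℝ}
    (h1 : ContDiff ℝ (⊤ : ℕ∞) φ) (h2 : HasCompactSupport φ) :
    Integrable (fun x => u x • fderiv ℝ φ x) := by
  have hc : Continuous (fderiv ℝ φ) := h1.continuous_fderiv (by simp)
  exact hu.integrable_smul_right_of_hasCompactSupport hc (h2.fderiv ℝ)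

lemma il2 {G : Euc d → Euc d →L[ℝ] ℝ} (hG : LocallyIntegrable G) {φ : Euc d → ℝ}
    (h1 : ContDiff ℝ (⊤ : ℕ∞) φ) (h2 : HasCompactSupport φ) :
    Integrable (fun x => φ x • G x) :=
  hG.integrable_smul_left_of_hasCompactSupport h1.continuous h2

lemma wk_add_loc {u v : Euc d → ℝ} {G H : Euc d → Euc d →L[ℝ] ℝ}
    (hu : LocallyIntegrable u) (hG : LocallyIntegrable G)
    (hv : LocallyIntegrable v) (hH : LocallyIntegrable H)
    (h1 : HasWeakFDerivOn univ u G) (h2 : HasWeakFDerivOn univ v H) :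
    HasWeakFDerivOn univ (fun x => u x + v x) (fun x => G x + H x) := by
  intro φ p1 p2 p3
  have e1 := h1 φ p1 p2 p3
  have e2 := h2 φ p1 p2 p3
  simp only [Measure.restrict_univ] at e1 e2 ⊢
  have k1 := integral_add (il1 hu p1 p2) (il1 hv p1 p2)
  have k2 := integral_add (il2 hG p1 p2) (il2 hH p1 p2)
  calc _ = ∫ x, (u x • fderiv ℝ φ x + v x • fderiv ℝ φ x) := by
        congr 1; funext x; exact add_smul _ _ _
    _ = -∫ x, (φ x • G x + φ x • H x) := by
        rw [k1, k2, e1, e2, neg_add]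
    _ = _ := by
        congr 2; funext x; exact (smul_add _ _ _).symm

lemma wk_smul {u : Euc d → ℝ} {G : Euc d → Euc d →L[ℝ] ℝ} (t : ℝ)
    (h1 : HasWeakFDerivOn univ u G) :
    HasWeakFDerivOn univ (fun x => t * u x) (fun x => t • G x) := by
  intro φ p1 p2 p3
  have e1 := h1 φ p1 p2 p3
  simp only [Measure.restrict_univ] at e1 ⊢
  calc _ = ∫ x, t • (u x • fderiv ℝ φ x) := by
        congr 1; funext x; rw [smul_smul]
    _ = -∫ x, t • (φ x • G x) := by
        rw [integral_smul, e1, integral_smul, smul_neg]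
    _ = _ := by
        congr 2; funext x; exact smul_comm _ _ _

lemma loc_box {V : Type*} [NormedAddCommGroup V] {G : Euc d → V} (hG : LocallyIntegrable G) :
    IntegrableOn G (Box d) :=
  (hG.integrableOn_isCompact (isCompact_closedBall 0 (d:ℝ))).mono_set (box_sub d)

lemma w11_of_loc {u : Euc d → ℝ} {G : Euc d → Euc d →L[ℝ] ℝ}
    (hu : LocallyIntegrable u) (hG : LocallyIntegrable G)
    (h1 : HasWeakFDerivOn univ u G) : W11On (Box d) u G := by
  refine ⟨loc_box hu, loc_box hG, fun φ p1 p2 p3 => ?_⟩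
  have := h1 φ p1 p2 (subset_univ _)
  rw [setIntegral_eq_integral_of_forall_compl_eq_zero, setIntegral_eq_integral_of_forall_compl_eq_zero]
  · simpa using this
  · intro x hx
    rw [image_eq_zero_of_notMem_tsupport (fun h => hx (p3 h)), zero_smul]
  · intro x hx
    rw [image_eq_zero_of_notMem_tsupport (fun h => hx (p3 (tsupport_fderiv_subset ℝ h))), smul_zero]

lemma wk_lip {u : Euc d → ℝ} {K : ℝ≥0} (hu : LipschitzWith K u) :
    HasWeakFDerivOn univ u (fderiv ℝ u) := by
  intro φ p1 p2 p3
  simp only [Measure.restrict_univ]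
  have lu : LocallyIntegrable u := hu.continuous.locallyIntegrable
  have lG : LocallyIntegrable (fderiv ℝ u) := by
    refine (locallyIntegrable_const (K:ℝ)).mono (measurable_fderiv ℝ u).aestronglyMeasurable ?_
    refine Eventually.of_forall fun x => ?_
    exact (norm_fderiv_le_of_lipschitz ℝ hu).trans (le_abs_self _)
  ext v
  obtain ⟨D, hD⟩ := (p1.of_le (m := 1) (by simp)).lipschitzWith_of_hasCompactSupport p2 (by simp)
  have key := hu.integral_lineDeriv_mul_eq (μ := volume) hD p2 v
  rw [ContinuousLinearMap.integral_apply (il1 lu p1 p2)]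
  change _ = -((∫ x, φ x • fderiv ℝ u x) v)
  rw [ContinuousLinearMap.integral_apply (il2 lG p1 p2), ← integral_neg]
  have k1 : ∫ x, lineDeriv ℝ u x v * φ x = ∫ x, (φ x • fderiv ℝ u x) v := by
    refine integral_congr_ae ?_
    filter_upwards [hu.ae_differentiableAt] with x hx
    rw [hx.lineDeriv_eq_fderiv]; simp [mul_comm]
  have k2 : ∫ x, lineDeriv ℝ φ x (-v) * u x = ∫ x, -(u x • fderiv ℝ φ x) v := by
    refine integral_congr_ae (Eventually.of_forall fun x => ?_)
    have : DifferentiableAt ℝ φ x := (p1.differentiable (by simp)) x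
    simp only [this.lineDeriv_eq_fderiv]; simp [mul_comm]
  rw [k1, k2] at key
  rw [integral_neg, key, integral_neg, neg_neg]

lemma removable {U : ℕ → Euc d → ℝ} {u : Euc d → ℝ} {Z : Set (Euc d)} {g : Euc d → ℝ} {M : ℝ}
    (hL : ∀ k, ∃ K, LipschitzWith K (U k)) (hM : ∀ k x, |U k x| ≤ M)
    (hZ : volume Z = 0) (hloc : ∀ x, x ∉ Z → ∀ᶠ k in atTop, U k =ᶠ[𝓝 x] u)
    (hg : LocallyIntegrable g) (hder : ∀ k x, x ∉ Z → ‖fderiv ℝ (U k) x‖ ≤ g x) :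
    LocallyIntegrable u ∧ LocallyIntegrable (fderiv ℝ u) ∧ HasWeakFDerivOn univ u (fderiv ℝ u) ∧
      ∀ x, x ∉ Z → ‖fderiv ℝ u x‖ ≤ g x := by
  have hZae : ∀ᵐ x, x ∉ Z := measure_eq_zero_iff_ae_notMem.1 hZ
  have hcont : ∀ k, Continuous (U k) := fun k => (hL k).choose_spec.continuous
  have t1 : ∀ᵐ x, Tendsto (fun k => U k x) atTop (𝓝 (u x)) := hZae.mono fun x hx =>
    tendsto_nhds_of_eventually_eq ((hloc x hx).mono fun k hk => hk.eq_of_nhds)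
  have t2 : ∀ᵐ x, Tendsto (fun k => fderiv ℝ (U k) x) atTop (𝓝 (fderiv ℝ u x)) := hZae.mono fun x hx =>
    tendsto_nhds_of_eventually_eq ((hloc x hx).mono fun k hk => hk.fderiv_eq)
  have m1 : AEStronglyMeasurable u volume :=
    aestronglyMeasurable_of_tendsto_ae atTop (fun k => (hcont k).aestronglyMeasurable) t1
  have m2 : AEStronglyMeasurable (fderiv ℝ u) volume :=
    aestronglyMeasurable_of_tendsto_ae atTop
      (fun k => (measurable_fderiv ℝ (U k)).aestronglyMeasurable) t2
  have b1 : ∀ᵐ x, ‖u x‖ ≤ M := t1.mono fun x hx =>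
    le_of_tendsto' hx.norm fun k => hM k x
  have b2 : ∀ᵐ x, ‖fderiv ℝ u x‖ ≤ g x := by
    filter_upwards [t2, hZae] with x hx hz
    exact le_of_tendsto' hx.norm fun k => hder k x hz
  have l1 : LocallyIntegrable u := (locallyIntegrable_const M).mono m1
    (b1.mono fun x hx => hx.trans (le_abs_self M))
  have l2 : LocallyIntegrable (fderiv ℝ u) := hg.mono m2
    (b2.mono fun x hx => hx.trans (le_abs_self _))
  refine ⟨l1, l2, fun φ p1 p2 p3 => ?_, fun x hx => by
    obtain ⟨k, hk⟩ := (hloc x hx).exists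
    rw [← hk.fderiv_eq]; exact hder k x hx⟩
  have lk : ∀ k, ∫ x, U k x • fderiv ℝ φ x = -∫ x, φ x • fderiv ℝ (U k) x := fun k => by
    obtain ⟨K, hK⟩ := hL k
    simpa only [Measure.restrict_univ] using wk_lip hK φ p1 p2 p3
  simp only [Measure.restrict_univ]
  have hc : Continuous (fderiv ℝ φ) := p1.continuous_fderiv (by simp)
  have s1 : Tendsto (fun k => ∫ x, U k x • fderiv ℝ φ x) atTop (𝓝 (∫ x, u x • fderiv ℝ φ x)) := by
    refine tendsto_integral_of_dominated_convergence (fun x => ‖M • fderiv ℝ φ x‖) ?_ ?_ ?_ ?_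
    · exact fun k => ((hcont k).smul hc).aestronglyMeasurable
    · exact (il1 (locallyIntegrable_const M) p1 p2).norm
    · intro k
      refine Eventually.of_forall fun x => ?_
      rw [norm_smul, norm_smul]
      exact mul_le_mul_of_nonneg_right ((hM k x).trans (le_abs_self M)) (norm_nonneg _)
    · exact t1.mono fun x hx => hx.smul_const _
  have s2 : Tendsto (fun k => ∫ x, φ x • fderiv ℝ (U k) x) atTop (𝓝 (∫ x, φ x • fderiv ℝ u x)) := by
    refine tendsto_integral_of_dominated_convergence (fun x => ‖φ x • g x‖) ?_ ?_ ?_ ?_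
    · exact fun k => p1.continuous.aestronglyMeasurable.smul
        (measurable_fderiv ℝ (U k)).aestronglyMeasurable
    · exact (hg.integrable_smul_left_of_hasCompactSupport p1.continuous p2).norm
    · intro k
      refine hZae.mono fun x hx => ?_
      rw [norm_smul, norm_smul]
      exact mul_le_mul_of_nonneg_left ((hder k x hx).trans (le_abs_self _)) (norm_nonneg _)
    · exact t2.mono fun x hx => hx.const_smul _
  simp only [lk] at s1
  exact tendsto_nhds_unique s1 s2.neg

lemma co (x y : Euc d) (i : Fin d) : |x i - y i| ≤ dist x y := by
  rw [dist_eq_norm, ← Real.norm_eq_abs]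
  exact PiLp.norm_apply_le (x - y) i

lemma hold {q : ℝ} (hq : 1 < q) {V : Type*} [NormedAddCommGroup V] {G : Euc d → V} {A : Set (Euc d)}
    (hG : AEStronglyMeasurable G (volume.restrict A)) :
    ∫⁻ y in A, ‖G y‖ₑ ≤ (∫⁻ y in A, ‖G y‖ₑ ^ q) ^ (1 / q) * volume A ^ (1 - 1 / q) := by
  have hc : q.HolderConjugate (q / (q - 1)) := Real.HolderConjugate.conjExponent hq
  have := ENNReal.lintegral_mul_le_Lp_mul_Lq (volume.restrict A) hc hG.enorm
    (aemeasurable_const (b := (1:ℝ≥0∞)))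
  simp only [Pi.mul_apply, mul_one, ENNReal.one_rpow, lintegral_one, Measure.restrict_apply_univ] at this
  convert this using 3
  have : q - 1 ≠ 0 := by linarith
  have : q ≠ 0 := by linarith
  field_simp

lemma memLp_fin {s : ℝ} (hs : 1 < s) {G : Euc d → Euc d →L[ℝ] ℝ} {μ : Measure (Euc d)}
    (h : MemLp (fun x => ‖G x‖) (ENNReal.ofReal s) μ) : ∫⁻ y, ‖G y‖ₑ ^ s ∂μ < ⊤ := by
  have := lintegral_rpow_enorm_lt_top_of_eLpNorm_lt_top (p := ENNReal.ofReal s)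
    (by simp; linarith) ENNReal.ofReal_ne_top h.2
  rw [ENNReal.toReal_ofReal (by linarith)] at this
  simpa using this

lemma vol_cb (x : Euc d) {r : ℝ} (hr : 0 ≤ r) : volume (closedBall x r) =
    ENNReal.ofReal (r ^ d) * volume (closedBall (0 : Euc d) 1) := by
  rw [Measure.addHaar_closedBall' _ _ hr]; simp

end RM


noncomputable section CB

variable {d : ℕ}

def ro (j : ℕ) : ℝ := (1/2 : ℝ) ^ (j + 7)
lemma ro_pos (j : ℕ) : 0 < ro j := by unfold ro; positivity
lemma ro_le (j : ℕ) : ro j ≤ 1 / 128 := by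
  unfold ro
  calc (1/2 : ℝ) ^ (j + 7) ≤ (1/2 : ℝ) ^ 7 := pow_le_pow_of_le_one (by norm_num) (by norm_num) (by omega)
    _ = 1 / 128 := by norm_num
lemma ro_lt {j k : ℕ} (h : j < k) : 2 * ro k ≤ ro j := by
  unfold ro
  calc 2 * (1/2 : ℝ) ^ (k + 7) = (1/2 : ℝ) ^ (k + 6) := by rw [pow_succ' _ (k+6)]; ring
    _ ≤ (1/2 : ℝ) ^ (j + 7) := pow_le_pow_of_le_one (by norm_num) (by norm_num) (by omega)

def xc (i0 i1 : Fin d) (j : ℕ) : Euc d := EuclideanSpace.single i0 1 + EuclideanSpace.single i1 (64 * ro j)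

def al (d : ℕ) (pm : ℝ) (j : ℕ) : ℝ := ro j ^ (1 - d / pm) / ((j : ℝ) + 1) ^ 2

lemma al_pos (pm : ℝ) (j : ℕ) : 0 < al d pm j := by
  have := ro_pos j
  unfold al; positivity

lemma al_le {pm : ℝ} (h0 : 0 < pm) (h : (d : ℝ) ≤ pm) (j : ℕ) : al d pm j ≤ 1 := by
  unfold al
  have h1 : ro j ^ (1 - d / pm) ≤ 1 := Real.rpow_le_one (ro_pos j).le ((ro_le j).trans (by norm_num))
    (by rw [sub_nonneg, div_le_one h0]; exact h)
  rw [div_le_one (by positivity)]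
  refine h1.trans ?_
  have : (0:ℝ) ≤ j := Nat.cast_nonneg j
  nlinarith

def tent (i0 i1 : Fin d) (pm : ℝ) (j : ℕ) (x : Euc d) : ℝ :=
  al d pm j * max 0 (min 1 (2 - dist x (xc i0 i1 j) / (4 * ro j)))

variable {i0 i1 : Fin d} {pm : ℝ}

lemma tent_in {j : ℕ} {x : Euc d} (h : dist x (xc i0 i1 j) ≤ 4 * ro j) :
    tent i0 i1 pm j x = al d pm j := by
  have := ro_pos j
  have h1 : dist x (xc i0 i1 j) / (4 * ro j) ≤ 1 := (div_le_one (by positivity)).2 h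
  unfold tent
  rw [min_eq_left (by linarith), max_eq_right (by norm_num), mul_one]

lemma tent_out {j : ℕ} {x : Euc d} (h : 8 * ro j ≤ dist x (xc i0 i1 j)) :
    tent i0 i1 pm j x = 0 := by
  have := ro_pos j
  have h1 : 2 ≤ dist x (xc i0 i1 j) / (4 * ro j) := (le_div_iff₀ (by positivity)).2 (by linarith)
  unfold tent
  rw [max_eq_left (min_le_of_right_le (by linarith)), mul_zero]

lemma abs_min_le (a b c : ℝ) : |min a c - min b c| ≤ |a - b| := by
  have := abs_max_sub_max_le_abs (-a) (-b) (-c)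
  rw [max_neg_neg, max_neg_neg, neg_sub_neg, neg_sub_neg, abs_sub_comm, abs_sub_comm b a] at this
  exact this

lemma tent_lip (j : ℕ) : LipschitzWith (al d pm j / (4 * ro j)).toNNReal (tent i0 i1 pm j) := by
  have hr := ro_pos j
  have ha := al_pos (d := d) pm j
  refine LipschitzWith.of_dist_le_mul fun x y => ?_
  rw [Real.coe_toNNReal _ (by positivity), Real.dist_eq]
  unfold tent
  rw [← mul_sub, abs_mul, abs_of_pos ha]
  have h1 : |max 0 (min 1 (2 - dist x (xc i0 i1 j) / (4 * ro j))) -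
      max 0 (min 1 (2 - dist y (xc i0 i1 j) / (4 * ro j)))| ≤ dist x y / (4 * ro j) := by
    rw [max_comm, max_comm 0 (min 1 (2 - dist y (xc i0 i1 j) / (4 * ro j))), min_comm, min_comm 1]
    refine (abs_max_sub_max_le_abs _ _ _).trans ((abs_min_le _ _ _).trans ?_)
    rw [show 2 - dist x (xc i0 i1 j) / (4 * ro j) - (2 - dist y (xc i0 i1 j) / (4 * ro j))
      = (dist y (xc i0 i1 j) - dist x (xc i0 i1 j)) / (4 * ro j) by ring, abs_div,
      abs_of_pos (show 0 < 4 * ro j by positivity)]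
    gcongr
    rw [dist_comm x y]
    exact abs_dist_sub_le _ _ _
  calc _ ≤ al d pm j * (dist x y / (4 * ro j)) := mul_le_mul_of_nonneg_left h1 ha.le
    _ = _ := by ring

lemma tent_le {j : ℕ} (x : Euc d) : |tent i0 i1 pm j x| ≤ al d pm j := by
  have ha := al_pos (d := d) pm j
  unfold tent
  rw [abs_mul, abs_of_pos ha, abs_of_nonneg (le_max_left _ _)]
  refine mul_le_of_le_one_right ha.le (max_le zero_le_one (min_le_left _ _))

lemma xc_dist (hi : i0 ≠ i1) (j k : ℕ) : 64 * |ro j - ro k| ≤ dist (xc i0 i1 j) (xc i0 i1 k) := by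
  have := co (xc i0 i1 j) (xc i0 i1 k) i1
  simp only [xc, PiLp.add_apply, PiLp.single_apply, if_neg hi.symm, if_true, zero_add] at this
  rwa [← mul_sub, abs_mul, abs_of_pos (by norm_num : (0:ℝ) < 64)] at this

lemma disj (hi : i0 ≠ i1) {j k : ℕ} {x : Euc d} (h1 : dist x (xc i0 i1 j) ≤ 8 * ro j)
    (h2 : dist x (xc i0 i1 k) ≤ 20 * ro k) : j = k := by
  by_contra hne
  have h3 := xc_dist hi j k
  have h4 : dist (xc i0 i1 j) (xc i0 i1 k) ≤ 8 * ro j + 20 * ro k :=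
    (dist_triangle_left _ _ x).trans (add_le_add h1 h2)
  have := ro_pos j
  have := ro_pos k
  rcases lt_or_gt_of_ne hne with h | h
  · have h5 := ro_lt h
    rw [abs_of_nonneg (by linarith)] at h3
    linarith
  · have h5 := ro_lt h
    rw [abs_of_nonpos (by linarith)] at h3
    linarith

def ub (i0 i1 : Fin d) (pm : ℝ) (x : Euc d) : ℝ := ∑' j, tent i0 i1 pm j x

lemma ub_single (hi : i0 ≠ i1) {k : ℕ} {x : Euc d} (h : dist x (xc i0 i1 k) ≤ 20 * ro k) :
    ub i0 i1 pm x = tent i0 i1 pm k x := by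
  refine tsum_eq_single k fun j hj => tent_out ?_
  by_contra hc
  exact hj (disj hi (not_le.1 hc).le h)

lemma sum_single (hi : i0 ≠ i1) {k n : ℕ} {x : Euc d} (h : dist x (xc i0 i1 k) ≤ 20 * ro k) :
    ∑ j ∈ Finset.range n, tent i0 i1 pm j x = if k < n then tent i0 i1 pm k x else 0 := by
  have h0 : ∀ j, j ≠ k → tent i0 i1 pm j x = 0 := fun j hj => tent_out (by
    by_contra hc
    exact hj (disj hi (not_le.1 hc).le h))
  split_ifs with hk
  · exact Finset.sum_eq_single_of_mem k (Finset.mem_range.2 hk) fun j _ hj => h0 j hj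
  · refine Finset.sum_eq_zero fun j hj => h0 j ?_
    have := Finset.mem_range.1 hj
    omega

def gb (i0 i1 : Fin d) (pm : ℝ) (x : Euc d) : ℝ :=
  ∑' j, (closedBall (xc i0 i1 j) (8 * ro j)).indicator (fun _ => al d pm j / (4 * ro j)) x

lemma gb_in (hi : i0 ≠ i1) {k : ℕ} {x : Euc d} (h : x ∈ closedBall (xc i0 i1 k) (8 * ro k)) :
    gb i0 i1 pm x = al d pm k / (4 * ro k) := by
  have h' : dist x (xc i0 i1 k) ≤ 20 * ro k := (mem_closedBall.1 h).trans (by linarith [ro_pos k])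
  unfold gb
  rw [tsum_eq_single k, indicator_of_mem h]
  intro j hj
  have hn : x ∉ closedBall (xc i0 i1 j) (8 * ro j) := fun hx => hj (disj hi hx h')
  exact indicator_of_notMem hn _

lemma gb_out {x : Euc d} (h : ∀ k, x ∉ closedBall (xc i0 i1 k) (8 * ro k)) :
    gb i0 i1 pm x = 0 := by
  unfold gb
  refine (tsum_congr fun j => indicator_of_notMem (h j) _).trans tsum_zero

lemma gb_nonneg (x : Euc d) : 0 ≤ gb i0 i1 pm x := by
  refine tsum_nonneg fun j => indicator_nonneg (fun _ _ => ?_) _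
  have := al_pos (d := d) pm j
  have := ro_pos j
  positivity

lemma gb_meas : Measurable (gb i0 i1 pm) := by
  refine Measurable.tsum fun j => ?_
  exact measurable_const.indicator isClosed_closedBall.measurableSet

lemma gb_energy (hi : i0 ≠ i1) (hpm : 1 < pm) :
    ∫⁻ x, ENNReal.ofReal (gb i0 i1 pm x ^ pm) < ⊤ := by
  set B := fun j => closedBall (xc i0 i1 j) (8 * ro j) with hB
  have h1 : ∫⁻ x, ENNReal.ofReal (gb i0 i1 pm x ^ pm) =
      ∫⁻ x in ⋃ j, B j, ENNReal.ofReal (gb i0 i1 pm x ^ pm) := by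
    rw [← lintegral_indicator (MeasurableSet.iUnion fun j => isClosed_closedBall.measurableSet)]
    refine lintegral_congr fun x => ?_
    by_cases hx : x ∈ ⋃ j, B j
    · rw [indicator_of_mem hx]
    · rw [indicator_of_notMem hx, gb_out (fun k hk => hx (mem_iUnion.2 ⟨k, hk⟩)),
        Real.zero_rpow (by linarith), ENNReal.ofReal_zero]
  have h2 : ∀ j, ∫⁻ x in B j, ENNReal.ofReal (gb i0 i1 pm x ^ pm) ≤
      ENNReal.ofReal (1 / ((j : ℝ) + 1) ^ 2) * (ENNReal.ofReal (8 ^ d) * volume (closedBall (0 : Euc d) 1)) := by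
    intro j
    have hr := ro_pos j
    have ha := al_pos (d := d) pm j
    rw [setLIntegral_congr_fun (g := fun _ => ENNReal.ofReal ((al d pm j / (4 * ro j)) ^ pm))
      isClosed_closedBall.measurableSet (fun x hx => by rw [gb_in hi hx]),
      setLIntegral_const, vol_cb _ (by positivity), ← mul_assoc, ← mul_assoc,
      ← ENNReal.ofReal_mul (by positivity), ← ENNReal.ofReal_mul (by positivity)]
    refine mul_le_mul_left (ENNReal.ofReal_le_ofReal ?_) _
    have e1 : (al d pm j / (4 * ro j)) ^ pm ≤ (al d pm j / ro j) ^ pm := by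
      refine Real.rpow_le_rpow (by positivity) ?_ (by linarith)
      refine div_le_div_of_nonneg_left ha.le hr (by linarith)
    have e2 : (al d pm j / ro j) ^ pm = ro j ^ (-(d:ℝ)) * ((1 / ((j : ℝ) + 1) ^ 2)) ^ pm := by
      unfold al
      rw [show ro j ^ (1 - d / pm) / ((j : ℝ) + 1) ^ 2 / ro j
        = ro j ^ (-(d / pm)) * (1 / ((j : ℝ) + 1) ^ 2) by
          rw [show (1 : ℝ) - d / pm = -(d/pm) + 1 by ring, Real.rpow_add_one hr.ne']
          field_simp]
      rw [Real.mul_rpow (by positivity) (by positivity), ← Real.rpow_mul hr.le]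
      congr 2
      have : pm ≠ 0 := by linarith
      field_simp
    have e3 : ((1 / ((j : ℝ) + 1) ^ 2)) ^ pm ≤ 1 / ((j : ℝ) + 1) ^ 2 := by
      refine (Real.rpow_le_rpow_of_exponent_ge (by positivity) ?_ hpm.le).trans_eq (Real.rpow_one _)
      rw [div_le_one (by positivity)]
      have : (0:ℝ) ≤ j := Nat.cast_nonneg j
      nlinarith
    calc (al d pm j / (4 * ro j)) ^ pm * (8 * ro j) ^ d
        ≤ (ro j ^ (-(d:ℝ)) * (1 / ((j : ℝ) + 1) ^ 2)) * (8 * ro j) ^ d := by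
          refine mul_le_mul_of_nonneg_right ((e1.trans_eq e2).trans ?_) (by positivity)
          exact mul_le_mul_of_nonneg_left e3 (by positivity)
      _ = 1 / ((j : ℝ) + 1) ^ 2 * 8 ^ d := by
          rw [Real.rpow_neg hr.le, Real.rpow_natCast, mul_pow]
          field_simp
  rw [h1]
  refine (lintegral_iUnion_le _ _).trans_lt ((ENNReal.tsum_le_tsum h2).trans_lt ?_)
  rw [ENNReal.tsum_mul_right]
  refine ENNReal.mul_lt_top ?_ (ENNReal.mul_lt_top ENNReal.ofReal_lt_top measure_closedBall_lt_top)
  have hs : Summable fun j : ℕ => 1 / ((j : ℝ) + 1) ^ 2 := by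
    have := (_root_.summable_nat_add_iff 1).2 (Real.summable_one_div_nat_pow.2 (show 1 < 2 by norm_num))
    simpa using this
  exact hs.tsum_ofReal_lt_top

lemma gb_loc (hi : i0 ≠ i1) (hpm : 1 < pm) : LocallyIntegrable (gb i0 i1 pm) := by
  have h1 : Integrable (fun x => gb i0 i1 pm x ^ pm) := by
    refine ⟨(gb_meas.pow_const pm).aestronglyMeasurable, ?_⟩
    rw [hasFiniteIntegral_iff_ofReal (Eventually.of_forall fun x => Real.rpow_nonneg (gb_nonneg x) _)]
    exact gb_energy hi hpm
  refine ((locallyIntegrable_const (1:ℝ)).add h1.locallyIntegrable).mono gb_meas.aestronglyMeasurable ?_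
  refine Eventually.of_forall fun x => ?_
  have h0 := gb_nonneg (i0 := i0) (i1 := i1) (pm := pm) x
  have h3 : 0 ≤ gb i0 i1 pm x ^ pm := Real.rpow_nonneg h0 _
  rw [Real.norm_of_nonneg h0, Pi.add_apply, Real.norm_of_nonneg (by linarith)]
  rcases le_total (gb i0 i1 pm x) 1 with h | h
  · linarith
  · have : gb i0 i1 pm x ^ (1:ℝ) ≤ gb i0 i1 pm x ^ pm := Real.rpow_le_rpow_of_exponent_le h hpm.le
    rw [Real.rpow_one] at this
    linarith

lemma ub_spec (hi : i0 ≠ i1) (hpm : 1 < pm) (hdp : (d : ℝ) ≤ pm) :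
    LocallyIntegrable (ub i0 i1 pm) ∧ LocallyIntegrable (fderiv ℝ (ub i0 i1 pm)) ∧
      HasWeakFDerivOn univ (ub i0 i1 pm) (fderiv ℝ (ub i0 i1 pm)) ∧
      ∀ x, x ∉ ({EuclideanSpace.single i0 1} : Set (Euc d)) → ‖fderiv ℝ (ub i0 i1 pm) x‖ ≤ gb i0 i1 pm x := by
  have hne : Nonempty (Fin d) := ⟨i0⟩
  refine removable (U := fun n x => ∑ j ∈ Finset.range n, tent i0 i1 pm j x) (M := 1) ?_ ?_ ?_ ?_
    (gb_loc hi hpm) ?_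
  · intro n
    induction n with
    | zero => exact ⟨0, by simp [LipschitzWith.const]⟩
    | succ n ih =>
      obtain ⟨K, hK⟩ := ih
      exact ⟨_, by simpa only [Finset.sum_range_succ] using hK.add (tent_lip n)⟩
  · intro n x
    by_cases h : ∃ k, dist x (xc i0 i1 k) ≤ 20 * ro k
    · obtain ⟨k, hk⟩ := h
      rw [sum_single hi hk]
      split_ifs
      · exact (tent_le x).trans (al_le (by linarith) hdp k)
      · simp
    · push Not at h
      rw [Finset.sum_eq_zero fun j _ => tent_out (by linarith [h j, ro_pos j])]
      simp
  · exact measure_singleton _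
  · intro x hx
    have hr : 0 < dist x (EuclideanSpace.single i0 1) := dist_pos.2 hx
    have ht : Tendsto ro atTop (𝓝 0) := by
      unfold ro
      exact (_root_.tendsto_pow_atTop_nhds_zero_of_lt_one (by norm_num) (by norm_num)).comp (tendsto_add_atTop_nat 7)
    obtain ⟨N, hN⟩ := eventually_atTop.1 (ht.eventually_lt_const
      (show (0:ℝ) < dist x (EuclideanSpace.single i0 1) / 144 by positivity))
    filter_upwards [eventually_ge_atTop N] with n hn
    filter_upwards [ball_mem_nhds x (show 0 < dist x (EuclideanSpace.single i0 1) / 2 by positivity)] with y hy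
    refine (tsum_eq_sum fun j hj => tent_out ?_).symm
    have hj' : N ≤ j := hn.trans (by simpa using hj)
    have h1 := hN j hj'
    have h2 : dist (xc i0 i1 j) (EuclideanSpace.single i0 1) = 64 * ro j := by
      rw [dist_eq_norm, xc, add_sub_cancel_left, PiLp.norm_single, Real.norm_of_nonneg]
      linarith [ro_pos j]
    have h3 := dist_triangle y (xc i0 i1 j) (EuclideanSpace.single i0 1)
    have h4 := dist_triangle_left x (EuclideanSpace.single i0 1) y
    rw [mem_ball] at hy
    linarith
  · intro n x _
    by_cases h : ∃ k, x ∈ closedBall (xc i0 i1 k) (8 * ro k)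
    · obtain ⟨k, hk⟩ := h
      rw [gb_in hi hk]
      have hr := ro_pos k
      have ha := al_pos (d := d) pm k
      have e : (fun x => ∑ j ∈ Finset.range n, tent i0 i1 pm j x) =ᶠ[𝓝 x]
          fun x => if k < n then tent i0 i1 pm k x else 0 := by
        filter_upwards [ball_mem_nhds x hr] with y hy
        refine sum_single hi ?_
        have := dist_triangle y x (xc i0 i1 k)
        rw [mem_ball] at hy
        rw [mem_closedBall] at hk
        linarith
      rw [e.fderiv_eq]
      split_ifs
      · refine (norm_fderiv_le_of_lipschitz ℝ (tent_lip k)).trans_eq ?_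
        exact Real.coe_toNNReal _ (by positivity)
      · simp; positivity
    · push Not at h
      rw [gb_out h]
      have e : (fun x => ∑ j ∈ Finset.range n, tent i0 i1 pm j x) =ᶠ[𝓝 x] fun x => 0 := by
        have : ∀ᶠ y in 𝓝 x, ∀ j ∈ Finset.range n, y ∉ closedBall (xc i0 i1 j) (8 * ro j) := by
          rw [Filter.eventually_all_finset]
          intro j _
          exact isClosed_closedBall.isOpen_compl.mem_nhds (h j)
        filter_upwards [this] with y hy
        exact Finset.sum_eq_zero fun j hj => tent_out (by
          have := hy j hj
          rw [mem_closedBall, not_le] at this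
          exact this.le)
      rw [e.fderiv_eq]; simp

end CB


noncomputable section CB2

variable {d : ℕ} {i0 i1 : Fin d} {pm : ℝ}

lemma lin3 {a b c : Euc d} {h r : ℝ} {x : Euc d} (hx : x ∈ segment ℝ a b)
    (ha : dist a c ≤ r) (hb : dist b c ≤ r) : closedBall x h ⊆ closedBall c (r + h) := by
  have : x ∈ closedBall c r := (convex_closedBall c r).segment_subset ha hb hx
  refine closedBall_subset_closedBall' ?_
  rw [mem_closedBall] at this
  linarith

lemma seg_coord {a b x : Euc d} (hx : x ∈ segment ℝ a b) (i : Fin d) {m M : ℝ}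
    (ha : a i ∈ Icc m M) (hb : b i ∈ Icc m M) : x i ∈ Icc m M := by
  have hc : Convex ℝ {x : Euc d | x i ∈ Icc m M} :=
    (convex_Icc m M).is_linear_preimage (f := fun x : Euc d => x i) ⟨fun _ _ => rfl, fun _ _ => rfl⟩
  exact hc.segment_subset ha hb hx

lemma caseB_est (hi : i0 ≠ i1) (hpm : 1 < pm) (hdp : (d : ℝ) ≤ pm) {w : Euc d → ℝ}
    {H : Euc d → Euc d →L[ℝ] ℝ} (hZ : ZC w H) (j : ℕ) :
    ENNReal.ofReal (al d pm j) ≤ 3 * (ENNReal.ofReal (16 * ro j * (kc d * ((ro j)⁻¹) ^ d)) *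
      ∫⁻ y in closedBall (xc i0 i1 j) (19 * ro j) ∩ Box d, ‖fderiv ℝ (ub i0 i1 pm) y + H y‖ₑ) := by
  obtain ⟨l1, l2, hw, -⟩ := ub_spec (i0 := i0) (i1 := i1) hi hpm hdp
  set u := ub i0 i1 pm with hu
  set v : Euc d → ℝ := fun x => u x + w x with hv
  set G : Euc d → Euc d →L[ℝ] ℝ := fun x => fderiv ℝ u x + H x with hG
  have lv : LocallyIntegrable v := l1.add hZ.iw.locallyIntegrable
  have wv : HasWeakFDerivOn univ v G := wk_add_loc l1 l2 hZ.iw.locallyIntegrable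
    hZ.iH.locallyIntegrable hw hZ.wk
  set ρ := ro j with hρ
  have hr : 0 < ρ := ro_pos j
  have hr2 : ρ ≤ 1 / 128 := ro_le j
  set c := xc i0 i1 j with hc
  have c0 : c i0 = 1 := by simp [hc, xc, hi]
  have c1 : c i1 = 64 * ρ := by simp [hc, xc, hi.symm, hρ]
  have ci : ∀ i, i ≠ i0 → i ≠ i1 → c i = 0 := fun i h0 h1 => by simp [hc, xc, h0, h1]
  have bx : ∀ y, dist y c ≤ 19 * ρ → y i0 ≤ 1 - ρ → y ∈ Box d := by
    intro y hy h1 i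
    have h2 := (co y c i).trans hy
    rw [abs_le] at h2
    rw [abs_lt]
    by_cases e0 : i = i0
    · rw [e0] at h2 ⊢; rw [c0] at h2; constructor <;> linarith
    by_cases e1 : i = i1
    · rw [e1] at h2 ⊢; rw [c1] at h2; constructor <;> linarith
    rw [ci i e0 e1] at h2
    constructor <;> linarith
  have nb : ∀ y : Euc d, 1 < y i0 → w y = 0 := fun y hy => hZ.w0 y fun hb => by
    have := hb i0
    rw [abs_lt] at this; linarith
  set e0 : Euc d := EuclideanSpace.single i0 ρ with he0
  set e1 : Euc d := EuclideanSpace.single i1 ρ with he1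
  have n0 : ‖e0‖ = ρ := by rw [he0, PiLp.norm_single, Real.norm_of_nonneg hr.le]
  have n1 : ‖e1‖ = ρ := by rw [he1, PiLp.norm_single, Real.norm_of_nonneg hr.le]
  have e00 : e0 i0 = ρ := by simp [he0]
  have e01 : e0 i1 = 0 := by simp [he0, hi.symm]
  have e10 : e1 i0 = 0 := by simp [he1, hi]
  have e11 : e1 i1 = ρ := by simp [he1]
  set A := c + (2:ℝ) • e0 with hA
  set A' := c - (2:ℝ) • e0 with hA'
  set B' := c - (2:ℝ) • e0 + (16:ℝ) • e1 with hB'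
  set B := c + (2:ℝ) • e0 + (16:ℝ) • e1 with hB
  have dA : dist A c ≤ 2 * ρ := by
    rw [dist_eq_norm, hA, add_sub_cancel_left, norm_smul, n0]; norm_num
  have dA' : dist A' c ≤ 2 * ρ := by
    rw [dist_eq_norm, hA', sub_sub_cancel_left, norm_neg, norm_smul, n0]; norm_num
  have dB' : dist B' c ≤ 18 * ρ := by
    rw [dist_eq_norm, hB', show c - (2:ℝ) • e0 + (16:ℝ) • e1 - c = -((2:ℝ) • e0) + (16:ℝ) • e1 by abel]
    refine (norm_add_le _ _).trans ?_
    rw [norm_neg, norm_smul, norm_smul, n0, n1]; norm_num; linarith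
  have dB : dist B c ≤ 18 * ρ := by
    rw [dist_eq_norm, hB, show c + (2:ℝ) • e0 + (16:ℝ) • e1 - c = ((2:ℝ) • e0) + (16:ℝ) • e1 by abel]
    refine (norm_add_le _ _).trans ?_
    rw [norm_smul, norm_smul, n0, n1]; norm_num; linarith
  have A0 : A i0 = 1 + 2 * ρ := by simp [hA, c0, e00]
  have A'0 : A' i0 = 1 - 2 * ρ := by simp [hA', c0, e00]
  have B'0 : B' i0 = 1 - 2 * ρ := by simp [hB', c0, e00, e10]
  have B0 : B i0 = 1 + 2 * ρ := by simp [hB, c0, e00, e10]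
  have B'1 : B' i1 = 80 * ρ := by simp [hB', c1, e01, e11]; ring
  have B1 : B i1 = 80 * ρ := by simp [hB, c1, e01, e11]; ring
  have uin : ∀ y, dist y c ≤ 4 * ρ → u y = al d pm j := fun y hy => by
    rw [hu, ub_single hi (k := j) (hy.trans (by linarith)), tent_in hy]
  have uout : ∀ y, dist y c ≤ 20 * ρ → 8 * ρ ≤ dist y c → u y = 0 := fun y hy h8 => by
    rw [hu, ub_single hi (k := j) hy, tent_out h8]
  have vA : avg ρ v A = al d pm j := by
    rw [avg_congr (v := fun _ => al d pm j) A, avg_const hr]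
    refine Eventually.of_forall fun y hy => ?_
    rw [mem_closedBall] at hy
    have h1 := (co y A i0).trans hy
    rw [A0, abs_le] at h1
    have h2 := dist_triangle y A c
    rw [hv]; simp only
    rw [nb y (by linarith), uin y (by linarith), add_zero]
  have vB : avg ρ v B = 0 := by
    rw [avg_congr (v := fun _ => (0:ℝ)) B, avg_const hr]
    refine Eventually.of_forall fun y hy => ?_
    rw [mem_closedBall] at hy
    have h1 := (co y B i0).trans hy
    rw [B0, abs_le] at h1
    have h3 := (co y B i1).trans hy
    rw [B1, abs_le] at h3
    have h4 := co y c i1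
    rw [c1] at h4
    have h5 := (le_abs_self _).trans h4
    have h2 := dist_triangle y B c
    rw [hv]; simp only
    rw [nb y (by linarith), uout y (by linarith) (by linarith), add_zero]
  have hGE : ∀ E : Set (Euc d), E ⊆ closedBall c (19 * ρ) → (∀ y ∈ E, y ∉ Box d → fderiv ℝ u y = 0) →
      MeasurableSet E → ∫⁻ y in E, ‖G y‖ₑ ≤ ∫⁻ y in closedBall c (19 * ρ) ∩ Box d, ‖G y‖ₑ := by
    intro E h1 h2 h3
    rw [← lintegral_indicator h3, ← lintegral_indicator
      (isClosed_closedBall.measurableSet.inter (box_open d).measurableSet)]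
    refine lintegral_mono fun y => ?_
    by_cases hy : y ∈ E
    · by_cases hb : y ∈ Box d
      · rw [indicator_of_mem hy, indicator_of_mem (show y ∈ closedBall c (19 * ρ) ∩ Box d from ⟨h1 hy, hb⟩)]
      · have : G y = 0 := by
          rw [hG]; simp only
          rw [h2 y hy hb, hZ.H0 y hb]; exact add_zero _
        rw [indicator_of_mem hy, this]
        refine le_trans (le_of_eq ?_) zero_le
        exact enorm_zero (E := Euc d →L[ℝ] ℝ)
    · rw [indicator_of_notMem hy]; exact zero_le
  have S1 := avg_seg hr lv wv (p := A) (q := A') (E := closedBall c (2 * ρ + ρ)) fun x hx =>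
    lin3 hx dA dA'
  have S2 := avg_seg hr lv wv (p := A') (q := B')
    (E := closedBall c (18 * ρ + ρ) ∩ {y | y i0 ≤ 1 - ρ}) fun x hx => by
      refine subset_inter (lin3 hx (dA'.trans (by linarith)) dB') fun y hy => ?_
      have h1 := seg_coord hx i0 (m := 1 - 2 * ρ) (M := 1 - 2 * ρ) (by rw [A'0]; simp) (by rw [B'0]; simp)
      have h2 := (le_abs_self _).trans ((co y x i0).trans hy)
      simp only [mem_setOf_eq]
      linarith [h1.2]
  have S3 := avg_seg hr lv wv (p := B') (q := B)
    (E := closedBall c (18 * ρ + ρ) ∩ {y | 79 * ρ ≤ y i1}) fun x hx => by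
      refine subset_inter (lin3 hx dB' dB) fun y hy => ?_
      have h1 := seg_coord hx i1 (m := 80 * ρ) (M := 80 * ρ) (by rw [B'1]; simp) (by rw [B1]; simp)
      have h2 := (neg_abs_le _).trans' (neg_le_neg ((co y x i1).trans hy))
      simp only [mem_setOf_eq]
      linarith [h1.1]
  have F1 := hGE (closedBall c (2 * ρ + ρ)) (closedBall_subset_closedBall (by linarith)) (fun y hy _ => by
    have : u =ᶠ[𝓝 y] fun _ => al d pm j := by
      filter_upwards [ball_mem_nhds y hr] with z hz
      rw [mem_ball] at hz; rw [mem_closedBall] at hy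
      exact uin z (by linarith [dist_triangle z y c])
    rw [this.fderiv_eq]; simp) isClosed_closedBall.measurableSet
  have m0 : ∀ i : Fin d, Measurable fun y : Euc d => y i := fun i => by fun_prop
  have F2 := hGE (closedBall c (18 * ρ + ρ) ∩ {y | y i0 ≤ 1 - ρ})
    (inter_subset_left.trans (closedBall_subset_closedBall (by linarith))) (fun y hy hb => absurd
      (bx y ((mem_closedBall.1 hy.1).trans (by linarith)) hy.2) hb)
    (isClosed_closedBall.measurableSet.inter (measurableSet_le (m0 i0) measurable_const))
  have F3 := hGE (closedBall c (18 * ρ + ρ) ∩ {y | 79 * ρ ≤ y i1})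
    (inter_subset_left.trans (closedBall_subset_closedBall (by linarith))) (fun y hy _ => by
    have : u =ᶠ[𝓝 y] fun _ => 0 := by
      filter_upwards [ball_mem_nhds y hr] with z hz
      have hy1 := mem_closedBall.1 hy.1
      have hy2 : 79 * ρ ≤ y i1 := hy.2
      rw [mem_ball] at hz
      have h4 := (le_abs_self _).trans (co y c i1)
      rw [c1] at h4
      have h5 := dist_triangle_left y c z
      exact uout z (by linarith [dist_triangle z y c]) (by linarith)
    rw [this.fderiv_eq]; simp)
    (isClosed_closedBall.measurableSet.inter (measurableSet_le measurable_const (m0 i1)))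
  set I := ∫⁻ y in closedBall c (19 * ρ) ∩ Box d, ‖G y‖ₑ with hI
  set D := ENNReal.ofReal (16 * ρ * (kc d * (ρ⁻¹) ^ d)) with hD
  have hk := kc_nonneg (d := d)
  have L1 : ‖A' - A‖ ≤ 16 * ρ := by
    rw [← dist_eq_norm]; linarith [dist_triangle_right A' A c]
  have L2 : ‖B' - A'‖ ≤ 16 * ρ := by
    rw [hA', hB', add_sub_cancel_left, norm_smul, n1]; norm_num
  have L3 : ‖B - B'‖ ≤ 16 * ρ := by
    rw [hB, hB', show c + (2:ℝ) • e0 + (16:ℝ) • e1 - (c - (2:ℝ) • e0 + (16:ℝ) • e1) = (4:ℝ) • e0 by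
      rw [show (4:ℝ) = 2 + 2 by norm_num, add_smul]; abel, norm_smul, n0]
    norm_num; linarith
  have fin : ∀ L J : _, L ≤ 16 * ρ → J ≤ I → ENNReal.ofReal (L * (kc d * (ρ⁻¹) ^ d)) * J ≤ D * I := by
    intro L J h1 h2
    refine mul_le_mul' (ENNReal.ofReal_le_ofReal ?_) h2
    gcongr
  have T1 := S1.trans (fin _ _ L1 F1)
  have T2 := S2.trans (fin _ _ L2 F2)
  have T3 := S3.trans (fin _ _ L3 F3)
  have ha := al_pos (d := d) pm j
  calc ENNReal.ofReal (al d pm j) = ‖avg ρ v B - avg ρ v A‖ₑ := by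
        rw [vA, vB, zero_sub, enorm_neg, Real.enorm_eq_ofReal ha.le]
    _ = ‖(avg ρ v A' - avg ρ v A) + (avg ρ v B' - avg ρ v A') + (avg ρ v B - avg ρ v B')‖ₑ := by
        congr 1; ring
    _ ≤ D * I + D * I + D * I := (enorm_add_le _ _).trans (add_le_add ((enorm_add_le _ _).trans
        (add_le_add T1 T2)) T3)
    _ = 3 * (D * I) := by ring

end CB2


noncomputable section CB3

variable {d : ℕ} {pm pp : ℝ}

lemma en_full {p : Euc d → ℝ} (hpm : 1 < pm) (hpp : 1 < pp) (hpv : ∀ x, p x = pm ∨ p x = pp)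
    (G : Euc d → Euc d →L[ℝ] ℝ) :
    ∫⁻ x in Box d, ENNReal.ofReal (‖G x‖ ^ p x) ≤ ENNReal.ofReal (pm + pp) * en p G := by
  rw [en_def, ← lintegral_const_mul' _ _ ENNReal.ofReal_ne_top]
  refine lintegral_mono fun x => ?_
  rw [← ENNReal.ofReal_mul (by linarith)]
  refine ENNReal.ofReal_le_ofReal ?_
  have h0 : 0 ≤ ‖G x‖ ^ p x := Real.rpow_nonneg (norm_nonneg _) _
  have h1 : 0 < p x ∧ p x ≤ pm + pp := by rcases hpv x with h | h <;> rw [h] <;> constructor <;> linarith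
  rw [mul_div_assoc', le_div_iff₀ h1.1, mul_comm]
  exact mul_le_mul_of_nonneg_right h1.2 h0

theorem caseB (hd : 2 ≤ d) (hpm : 1 < pm) (hdp : (d : ℝ) ≤ pm) (hpmpp : pm < pp) :
    ∃ (p : Euc d → ℝ) (u : Euc d → ℝ) (G : Euc d → Euc d →L[ℝ] ℝ),
      Measurable p ∧ (∀ x, p x = pm ∨ p x = pp) ∧
      W11On (Box d) u G ∧
      (∫⁻ x in Box d, ENNReal.ofReal (‖G x‖ ^ p x)) < ⊤ ∧
      IsLocalMinimizer (Box d) (fun x t => t ^ p x / p x) u G ∧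
      (∀ s : ℝ, pm < s →
        ¬ MemLp (fun x => ‖G x‖) (ENNReal.ofReal s) (volume.restrict (Box d))) := by
  have hpp : 1 < pp := by linarith
  let i0 : Fin d := ⟨0, by omega⟩
  let i1 : Fin d := ⟨1, by omega⟩
  have hi : i0 ≠ i1 := by simp [i0, i1]
  have hne : Nonempty (Fin d) := ⟨i0⟩
  obtain ⟨l1, l2, hw, hb⟩ := ub_spec (i0 := i0) (i1 := i1) hi hpm hdp
  set p : Euc d → ℝ := fun _ => pm with hp
  have hpv : ∀ x, p x = pm ∨ p x = pp := fun x => Or.inl rfl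
  have hpmeas : Measurable p := measurable_const
  have hfin : en p (fderiv ℝ (ub i0 i1 pm)) < ⊤ := by
    refine lt_of_le_of_lt ?_ (gb_energy (i0 := i0) (i1 := i1) hi hpm)
    rw [en_def]
    refine (setLIntegral_le_lintegral _ _).trans (lintegral_mono_ae ?_)
    filter_upwards [measure_eq_zero_iff_ae_notMem.1 (measure_singleton
      (EuclideanSpace.single i0 (1:ℝ) : Euc d) (μ := volume))] with x hx
    refine ENNReal.ofReal_le_ofReal ?_
    have h0 : 0 ≤ ‖fderiv ℝ (ub i0 i1 pm) x‖ ^ pm := Real.rpow_nonneg (norm_nonneg _) _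
    exact (div_le_self h0 hpm.le).trans (Real.rpow_le_rpow (norm_nonneg _) (hb x hx) (by linarith))
  have h0 := w11_of_loc l1 l2 hw
  obtain ⟨w, H, hZ, hle, hmin⟩ := exists_min (by omega) hpm hpp hpmeas hpv h0 hfin
  refine ⟨p, _, _, hpmeas, hpv, hmin.1, ?_, hmin, ?_⟩
  · refine (en_full hpm hpp hpv _).trans_lt (ENNReal.mul_lt_top ENNReal.ofReal_lt_top ?_)
    exact hle.trans_lt hfin
  intro s hs hmem
  have hs1 : 1 < s := by linarith
  have hS := memLp_fin hs1 hmem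
  set G : Euc d → Euc d →L[ℝ] ℝ := fun x => fderiv ℝ (ub i0 i1 pm) x + H x with hG
  set S := (∫⁻ y in Box d, ‖G y‖ₑ ^ s) ^ (1 / s) with hSd
  have hSt : S ≠ ⊤ := ENNReal.rpow_ne_top_of_nonneg (by positivity) hS.ne
  set ω := volume.real (closedBall (0 : Euc d) 1) with hω
  have hω0 : 0 ≤ ω := measureReal_nonneg
  have hθ : 0 ≤ 1 - 1 / s := by rw [sub_nonneg, div_le_one (by linarith)]; exact hs1.le
  have hk := kc_nonneg (d := d)
  set C := 48 * kc d * S.toReal * (19 ^ d * ω) ^ (1 - 1 / s) with hC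
  have hC0 : 0 ≤ C := by positivity
  have key : ∀ j : ℕ, al d pm j ≤ C * ro j ^ (1 - d / s) := by
    intro j
    have hr := ro_pos j
    have h1 := caseB_est (i0 := i0) (i1 := i1) hi hpm hdp hZ j
    have mG : AEStronglyMeasurable G (volume.restrict (Box d)) := hmin.1.2.1.1
    have h2 := hold hs1 (mG.mono_measure (Measure.restrict_mono
      (inter_subset_right (s := closedBall (xc i0 i1 j) (19 * ro j))) le_rfl))
    have h3 : ∫⁻ y in closedBall (xc i0 i1 j) (19 * ro j) ∩ Box d, ‖G y‖ₑ ≤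
        S * volume (closedBall (xc i0 i1 j) (19 * ro j)) ^ (1 - 1 / s) := by
      refine h2.trans (mul_le_mul' ?_ ?_)
      · exact ENNReal.rpow_le_rpow (lintegral_mono_set inter_subset_right) (by positivity)
      · exact ENNReal.rpow_le_rpow (measure_mono inter_subset_left) hθ
    have hvol : volume (closedBall (xc i0 i1 j) (19 * ro j)) = ENNReal.ofReal ((19 * ro j) ^ d * ω) := by
      rw [vol_cb _ (by positivity), ENNReal.ofReal_mul (by positivity), hω, ofReal_measureReal (h := measure_closedBall_lt_top.ne)]
    rw [hvol, ENNReal.ofReal_rpow_of_nonneg (by positivity) hθ,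
      ← ENNReal.ofReal_toReal hSt, ← ENNReal.ofReal_mul (by positivity)] at h3
    have h4 := h1.trans (mul_le_mul_right (mul_le_mul_right h3 _) 3)
    rw [← ENNReal.ofReal_mul (by positivity), show (3 : ℝ≥0∞) = ENNReal.ofReal 3 by simp,
      ← ENNReal.ofReal_mul (by norm_num), ENNReal.ofReal_le_ofReal_iff (by positivity)] at h4
    refine h4.trans_eq ?_
    rw [hC, mul_pow, show (19:ℝ) ^ d * ro j ^ d * ω = (19 ^ d * ω) * ro j ^ d by ring,
      Real.mul_rpow (by positivity) (by positivity), ← Real.rpow_natCast (ro j) d, ← Real.rpow_mul hr.le,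
      inv_pow, ← Real.rpow_natCast (ro j) d,
      show (1 : ℝ) - d / s = 1 + (-(d:ℝ) + d * (1 - 1 / s)) by ring,
      Real.rpow_add hr, Real.rpow_add hr, Real.rpow_one, Real.rpow_neg hr.le]
    ring
  set η := (d:ℝ) / pm - d / s with hη
  have hdR : (0:ℝ) < d := by exact_mod_cast (by omega : 0 < d)
  have hη0 : 0 < η := by
    rw [hη, sub_pos]
    exact div_lt_div_of_pos_left hdR (by linarith) hs
  have key2 : ∀ j : ℕ, ((2:ℝ) ^ η) ^ (j + 1) ≤ C * ((j:ℝ) + 1) ^ 2 := by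
    intro j
    have hr := ro_pos j
    have h1 := key j
    unfold al at h1
    rw [div_le_iff₀ (by positivity)] at h1
    have h2 : ro j ^ (1 - d / s) = ro j ^ (1 - d / pm) * ro j ^ η := by
      rw [← Real.rpow_add hr]; congr 1; rw [hη]; ring
    rw [h2] at h1
    have h3 : 0 < ro j ^ (1 - d / pm) := by positivity
    have h4 : 1 ≤ C * ((j:ℝ) + 1) ^ 2 * ro j ^ η := by
      have : ro j ^ (1 - d / pm) * 1 ≤ ro j ^ (1 - d / pm) * (C * ((j:ℝ) + 1) ^ 2 * ro j ^ η) := by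
        rw [mul_one]; refine h1.trans_eq (by ring)
      exact le_of_mul_le_mul_left this h3
    have h5 : ((2:ℝ) ^ η) ^ (j + 7) * ro j ^ η = 1 := by
      rw [ro, ← Real.rpow_natCast (1/2 : ℝ), ← Real.rpow_mul (by norm_num), mul_comm _ η,
        Real.rpow_mul (by norm_num), Real.rpow_natCast, ← mul_pow,
        ← Real.mul_rpow (by norm_num) (by norm_num)]
      norm_num
    have h6 : 1 ≤ (2:ℝ) ^ η := Real.one_le_rpow (by norm_num) hη0.le
    have h7 : ((2:ℝ) ^ η) ^ (j + 1) ≤ ((2:ℝ) ^ η) ^ (j + 7) := pow_le_pow_right₀ h6 (by omega)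
    have h8 : 0 < ro j ^ η := by positivity
    refine h7.trans (le_of_mul_le_mul_right ?_ h8)
    rw [h5]; exact h4
  have hb1 : 1 < (2:ℝ) ^ η := Real.one_lt_rpow (by norm_num) hη0
  have ht := (tendsto_pow_const_div_const_pow_of_one_lt 2 hb1).comp (tendsto_add_atTop_nat 1)
  obtain ⟨j, hj⟩ := (ht.eventually_lt_const (show (0:ℝ) < 1 / (C + 1) by positivity)).exists
  have h1 := key2 j
  simp only [Function.comp] at hj
  rw [div_lt_div_iff₀ (by positivity) (by positivity)] at hj
  push_cast at hj
  have : (0:ℝ) < ((j:ℝ) + 1) ^ 2 := by positivity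
  nlinarith

end CB3


noncomputable section CA1

/-- dyadic scale -/
def hs (k : ℕ) : ℝ := (1 / 2) ^ k

lemma hs_pos (k : ℕ) : 0 < hs k := by unfold hs; positivity
lemma hs_zero : hs 0 = 1 := by simp [hs]
lemma hs_succ (k : ℕ) : hs (k + 1) = hs k / 2 := by unfold hs; rw [pow_succ]; ring
lemma hs_le (k : ℕ) : hs k ≤ 1 := pow_le_one₀ (by norm_num) (by norm_num)

/-- binary expansion with given digits -/
def xs (b : ℕ → Bool) : ℝ := ∑' j, (if b j then hs (j + 3) else 0)

/-- integer truncation -/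
def tr (b : ℕ → Bool) : ℕ → ℤ
  | 0 => 0
  | k + 1 => 2 * tr b k + (if b k then 1 else 0)

lemma hs_sum : Summable fun j => hs (j + 3) := by
  unfold hs
  simp_rw [pow_add]
  exact (summable_geometric_of_lt_one (by norm_num) (by norm_num)).mul_right _

lemma dg_le (b : ℕ → Bool) (j : ℕ) : (if b j then hs (j + 3) else 0) ≤ hs (j + 3) := by
  split_ifs
  · exact le_rfl
  · exact (hs_pos _).le

lemma dg_nn (b : ℕ → Bool) (j : ℕ) : 0 ≤ (if b j then hs (j + 3) else 0) := by
  split_ifs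
  · exact (hs_pos _).le
  · exact le_rfl

lemma dg_sum (b : ℕ → Bool) : Summable fun j => (if b j then hs (j + 3) else 0) :=
  Summable.of_nonneg_of_le (dg_nn b) (dg_le b) hs_sum

lemma tr_part (b : ℕ → Bool) (k : ℕ) :
    ∑ j ∈ Finset.range k, (if b j then hs (j + 3) else 0) = tr b k * hs (k + 2) := by
  induction k with
  | zero => simp [tr]
  | succ k ih =>
    rw [Finset.sum_range_succ, ih, tr, hs_succ (k + 2)]
    push_cast
    split_ifs <;> ring

lemma tail_le (b : ℕ → Bool) (k : ℕ) : ∑' j, (if b (j + k) then hs (j + k + 3) else 0) ≤ hs (k + 2) := by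
  have h1 : HasSum (fun j => hs (j + k + 3)) (hs (k + 2)) := by
    have := (hasSum_geometric_of_lt_one (r := (1/2:ℝ)) (by norm_num) (by norm_num)).mul_right (hs (k + 3))
    have e1 : (fun j => hs (j + k + 3)) = fun i => (1 / 2 : ℝ) ^ i * hs (k + 3) := by
      ext j; unfold hs; rw [← pow_add, add_assoc]
    have e2 : hs (k + 2) = (1 - 1 / 2)⁻¹ * hs (k + 3) := by
      rw [show k + 3 = (k + 2) + 1 by ring, hs_succ (k + 2)]; norm_num; ring
    rw [e1, e2]; exact this
  rw [← h1.tsum_eq]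
  exact Summable.tsum_le_tsum (fun j => dg_le b (j + k)) ((_root_.summable_nat_add_iff k).2 (dg_sum b)) h1.summable

lemma xs_tr (b : ℕ → Bool) (k : ℕ) : tr b k * hs (k + 2) ≤ xs b ∧ xs b ≤ (tr b k + 1) * hs (k + 2) := by
  have h := (dg_sum b).sum_add_tsum_nat_add k
  rw [tr_part] at h
  have h2 := tail_le b k
  have h3 : 0 ≤ ∑' j, (if b (j + k) then hs (j + k + 3) else 0) := tsum_nonneg fun j => dg_nn b (j + k)
  unfold xs
  constructor <;> linarith

lemma tr_inj {b b' : ℕ → Bool} {k : ℕ} (h : tr b k = tr b' k) : ∀ j < k, b j = b' j := by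
  induction k with
  | zero => intro j hj; omega
  | succ k ih =>
    rw [tr, tr] at h
    have h1 : tr b k = tr b' k ∧ b k = b' k := by
      cases hb : b k <;> cases hb' : b' k <;> simp [hb, hb'] at h ⊢ <;> omega
    intro j hj
    rcases Nat.lt_succ_iff_lt_or_eq.1 hj with h2 | h2
    · exact ih h1.1 j h2
    · rw [h2]; exact h1.2

lemma tr_congr {b b' : ℕ → Bool} {k : ℕ} (h : ∀ j < k, b j = b' j) : tr b k = tr b' k := by
  induction k with
  | zero => rfl
  | succ k ih => rw [tr, tr, ih fun j hj => h j (by omega), h k (by omega)]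

variable {d : ℕ}

/-- the point with address -/
def pt (i0 : Fin d) (a : ℕ → Bool) (ε : ℕ × Fin d → Bool) : Euc d :=
  WithLp.toLp 2 fun i => if i = i0 then 0 else xs fun j => a j && ε (j, i)

lemma pt_i0 (i0 : Fin d) (a : ℕ → Bool) (ε : ℕ × Fin d → Bool) : pt i0 a ε i0 = 0 := by simp [pt]
lemma pt_i {i0 i : Fin d} (h : i ≠ i0) (a : ℕ → Bool) (ε : ℕ × Fin d → Bool) :
    pt i0 a ε i = xs fun j => a j && ε (j, i) := by simp [pt, h]

lemma pt_cont (i0 : Fin d) (a : ℕ → Bool) : Continuous (pt i0 a) := by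
  refine (PiLp.continuous_toLp 2 _).comp (continuous_pi fun i => ?_)
  by_cases h : i = i0
  · simp only [h, if_true]; exact continuous_const
  · simp only [h, if_false]
    unfold xs
    refine continuous_tsum (fun j => ?_) hs_sum (fun j ε => ?_)
    · have hc : Continuous fun ε : ℕ × Fin d → Bool => ε (j, i) := continuous_apply (j, i)
      exact (continuous_of_discreteTopology (f := fun b : Bool => if (a j && b) then hs (j + 3) else 0)).comp hc
    · rw [Real.norm_of_nonneg (dg_nn (fun j => a j && ε (j, i)) j)]; exact dg_le (fun j => a j && ε (j, i)) j

/-- digit index set -/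
def sk (i0 : Fin d) (a : ℕ → Bool) (k : ℕ) : Finset (ℕ × Fin d) :=
  ((Finset.range k).filter fun j => a j) ×ˢ (Finset.univ.erase i0)

lemma sk_mem {i0 : Fin d} {a : ℕ → Bool} {k : ℕ} {q : ℕ × Fin d} :
    q ∈ sk i0 a k ↔ (q.1 < k ∧ a q.1 = true) ∧ q.2 ≠ i0 := by simp [sk]

/-- coin measure -/
def coin : Measure Bool := (2⁻¹ : ℝ≥0∞) • Measure.count

lemma coin_single (b : Bool) : coin {b} = 2⁻¹ := by simp [coin]

instance coin_prob : IsProbabilityMeasure coin := ⟨by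
  rw [coin, Measure.smul_apply, Measure.count_univ]
  simp [ENat.card_eq_coe_fintype_card]
  exact ENNReal.inv_mul_cancel (by norm_num) (by norm_num)⟩

/-- coin sequence measure -/
def coins (d : ℕ) : Measure (ℕ × Fin d → Bool) := Measure.infinitePi fun _ => coin

instance coins_prob : IsProbabilityMeasure (coins d) := by unfold coins; infer_instance

lemma coins_cyl (s : Finset (ℕ × Fin d)) (ε : ℕ × Fin d → Bool) :
    coins d {η | ∀ q ∈ s, η q = ε q} = 2⁻¹ ^ s.card := by
  have h := Measure.infinitePi_pi (μ := fun _ : ℕ × Fin d => coin) (s := s) (t := fun q => {ε q})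
    (fun q _ => measurableSet_singleton _)
  rw [show {η : ℕ × Fin d → Bool | ∀ q ∈ s, η q = ε q} = (s : Set _).pi fun q => {ε q} by ext; simp]
  rw [coins, h]
  simp [coin_single]

/-- Cantor measure -/
def muA (i0 : Fin d) (a : ℕ → Bool) : Measure (Euc d) := (coins d).map (pt i0 a)

instance muA_prob (i0 : Fin d) (a : ℕ → Bool) : IsProbabilityMeasure (muA i0 a) :=
  Measure.isProbabilityMeasure_map (pt_cont i0 a).measurable.aemeasurable

lemma card_Icc {x y : ℝ} (h : 0 ≤ y) : ((Finset.Icc ⌈x⌉ ⌊x + y⌋).card : ℝ) ≤ y + 1 := by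
  rw [Int.card_Icc]
  have h1 := Int.le_ceil x
  have h2 := Int.floor_le (x + y)
  rcases le_total (⌊x + y⌋ + 1 - ⌈x⌉) 0 with h3 | h3
  · rw [Int.toNat_of_nonpos h3]; simp; linarith
  · have : (((⌊x + y⌋ + 1 - ⌈x⌉).toNat : ℤ) : ℝ) = ((⌊x + y⌋ + 1 - ⌈x⌉ : ℤ) : ℝ) := by
      rw [Int.toNat_of_nonneg h3]
    rw [← Int.cast_natCast, this]; push_cast; linarith

lemma tr_cyl {i0 : Fin d} {a : ℕ → Bool} (k : ℕ) (v : Fin d → ℤ) :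
    coins d {ε | ∀ i, i ≠ i0 → tr (fun j => a j && ε (j, i)) k = v i} ≤ 2⁻¹ ^ (sk i0 a k).card := by
  rcases Set.eq_empty_or_nonempty {ε : ℕ × Fin d → Bool | ∀ i, i ≠ i0 → tr (fun j => a j && ε (j, i)) k = v i} with h | ⟨ε, hε⟩
  · rw [h]; simp
  rw [← coins_cyl (sk i0 a k) ε]
  refine measure_mono fun η hη q hq => ?_
  obtain ⟨⟨h1, h2⟩, h3⟩ := sk_mem.1 hq
  have := tr_inj ((hη q.2 h3).trans (hε q.2 h3).symm) q.1 h1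
  simpa [h2] using this

lemma muA_ball (i0 : Fin d) (a : ℕ → Bool) (k : ℕ) (z : Euc d) :
    muA i0 a (closedBall z (13 * hs k)) ≤ ENNReal.ofReal (106 ^ d) * 2⁻¹ ^ (sk i0 a k).card := by
  rw [muA, Measure.map_apply (pt_cont i0 a).measurable measurableSet_closedBall]
  set l : Fin d → ℝ := fun i => (z i - 13 * hs k) * 2 ^ (k + 2) - 1 with hl
  set T := Fintype.piFinset fun i : Fin d => Finset.Icc ⌈l i⌉ ⌊l i + 105⌋ with hT
  have hk : hs k * 2 ^ (k + 2) = 4 := by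
    unfold hs; rw [pow_add, ← mul_assoc, ← mul_pow]; norm_num
  have hk2 : hs (k + 2) * 2 ^ (k + 2) = 1 := by
    unfold hs; rw [← mul_pow]; norm_num
  have hsub : pt i0 a ⁻¹' closedBall z (13 * hs k) ⊆
      ⋃ v ∈ T, {ε | ∀ i, i ≠ i0 → tr (fun j => a j && ε (j, i)) k = v i} := by
    intro ε hε
    rw [mem_preimage, mem_closedBall] at hε
    refine mem_iUnion₂.2 ⟨fun i => if i = i0 then ⌈l i⌉ else tr (fun j => a j && ε (j, i)) k, ?_, ?_⟩
    · rw [hT, Fintype.mem_piFinset]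
      intro i
      rw [Finset.mem_Icc]
      by_cases hi : i = i0
      · simp only [hi, if_true]
        refine ⟨le_rfl, Int.le_floor.2 ?_⟩
        linarith [Int.ceil_lt_add_one (l i0)]
      · simp only [hi, if_false]
        have h1 := (co _ _ i).trans hε
        rw [pt_i hi, abs_le] at h1
        have h2 := xs_tr (fun j => a j && ε (j, i)) k
        set X := xs (fun j => a j && ε (j, i))
        set t := tr (fun j => a j && ε (j, i)) k
        have hp : (0:ℝ) < 2 ^ (k + 2) := by positivity
        have h3 := mul_le_mul_of_nonneg_right h2.1 hp.le
        have h4 := mul_le_mul_of_nonneg_right h2.2 hp.le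
        have h5 := mul_le_mul_of_nonneg_right h1.1 hp.le
        have h6 := mul_le_mul_of_nonneg_right h1.2 hp.le
        rw [mul_assoc, hk2] at h3 h4
        constructor
        · rw [Int.ceil_le]; simp only [hl]; nlinarith
        · rw [Int.le_floor]; simp only [hl]; nlinarith
    · intro i hi; simp [hi]
  refine (measure_mono hsub).trans ((measure_biUnion_finset_le T _).trans ?_)
  refine (Finset.sum_le_sum fun v _ => tr_cyl (i0 := i0) (a := a) k v).trans ?_
  rw [Finset.sum_const, nsmul_eq_mul]
  refine mul_le_mul_left ?_ _
  rw [← ENNReal.ofReal_natCast]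
  refine ENNReal.ofReal_le_ofReal ?_
  rw [hT, Fintype.card_piFinset]
  push_cast
  calc ∏ i : Fin d, ((Finset.Icc ⌈l i⌉ ⌊l i + 105⌋).card : ℝ) ≤ ∏ i : Fin d, (106:ℝ) :=
        Finset.prod_le_prod (fun _ _ => by positivity) fun i _ => (card_Icc (by norm_num)).trans (by norm_num)
    _ = 106 ^ d := by simp

lemma pt_cover (i0 : Fin d) (a : ℕ → Bool) (k : ℕ) (ε η : ℕ × Fin d → Bool)
    (h : ∀ q ∈ sk i0 a k, ε q = η q) : dist (pt i0 a ε) (pt i0 a η) ≤ d * hs k := by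
  have h1 : ∀ i, |pt i0 a ε i - pt i0 a η i| ≤ hs k := by
    intro i
    by_cases hi : i = i0
    · rw [hi, pt_i0, pt_i0]; simp [(hs_pos k).le]
    rw [pt_i hi, pt_i hi]
    have e := tr_congr (b := fun j => a j && ε (j, i)) (b' := fun j => a j && η (j, i)) (k := k) (by
      intro j hj
      cases ha : a j
      · simp
      · simp [h (j, i) (sk_mem.2 ⟨⟨hj, ha⟩, hi⟩)])
    have h2 := xs_tr (fun j => a j && ε (j, i)) k
    have h3 := xs_tr (fun j => a j && η (j, i)) k
    rw [e] at h2
    have h4 : hs (k + 2) ≤ hs k := by rw [hs_succ, hs_succ]; linarith [hs_pos k]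
    rw [abs_le]
    constructor <;> linarith
  rw [EuclideanSpace.dist_eq]
  refine Real.sqrt_le_iff.2 ⟨mul_nonneg (by positivity) (hs_pos k).le, ?_⟩
  calc ∑ i, dist (pt i0 a ε i) (pt i0 a η i) ^ 2 ≤ ∑ i : Fin d, hs k ^ 2 :=
        Finset.sum_le_sum fun i _ => pow_le_pow_left₀ dist_nonneg (h1 i) 2
    _ = d * hs k ^ 2 := by simp
    _ ≤ (d * hs k) ^ 2 := by
      rw [mul_pow]
      refine mul_le_mul_of_nonneg_right ?_ (by positivity)
      rcases Nat.eq_zero_or_pos d with h0 | h0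
      · simp [h0]
      · have : (1:ℝ) ≤ d := by exact_mod_cast h0
        nlinarith

end CA1


noncomputable section CA2

variable {d : ℕ}

/-- exponent counting function -/
def nk (δ : ℝ) (k : ℕ) : ℕ := ⌊δ * (k - √k)⌋₊

lemma sqrt_le_nat (k : ℕ) : √(k:ℝ) ≤ k := by
  rcases Nat.eq_zero_or_pos k with h | h
  · simp [h]
  · have : (1:ℝ) ≤ k := by exact_mod_cast h
    rw [Real.sqrt_le_left (by positivity)]; nlinarith

lemma nk_step {δ : ℝ} (h0 : 0 ≤ δ) (h1 : δ ≤ 1) (k : ℕ) :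
    nk δ k ≤ nk δ (k + 1) ∧ nk δ (k + 1) ≤ nk δ k + 1 := by
  have ha : √(k:ℝ) ≤ √((k:ℝ) + 1) := Real.sqrt_le_sqrt (by linarith)
  have hb : √((k:ℝ) + 1) ≤ √k + 1 := by
    rw [Real.sqrt_le_left (by positivity)]
    nlinarith [Real.sq_sqrt (show (0:ℝ) ≤ k by positivity), Real.sqrt_nonneg (k:ℝ)]
  have hk := sqrt_le_nat k
  unfold nk
  constructor
  · refine Nat.floor_le_floor (mul_le_mul_of_nonneg_left ?_ h0)
    push_cast; linarith
  · rw [← Nat.floor_add_one (mul_nonneg h0 (by linarith))]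
    refine Nat.floor_le_floor ?_
    push_cast
    nlinarith

/-- digit activity -/
def ak (δ : ℝ) (k : ℕ) : Bool := decide (nk δ k < nk δ (k + 1))

lemma ak_card {δ : ℝ} (h0 : 0 ≤ δ) (h1 : δ ≤ 1) (k : ℕ) :
    ((Finset.range k).filter fun j => ak δ j).card = nk δ k := by
  induction k with
  | zero => simp [nk]
  | succ k ih =>
    have := nk_step h0 h1 k
    rw [Finset.range_add_one, Finset.filter_insert]
    split_ifs with h
    · rw [Finset.card_insert_of_notMem (by simp), ih]
      simp [ak] at h; omega
    · rw [ih]; simp [ak] at h; omega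

/-- model growth -/
def Xk (d : ℕ) (pm : ℝ) (k : ℕ) : ℝ := 2 ^ (((d:ℝ) - pm) * (k - √k))

structure Geo (i0 : Fin d) (pm : ℝ) (S : Set (Euc d)) (μ : Measure (Euc d)) (N : ℕ → ℝ) (C : ℝ) : Prop where
  cpt : IsCompact S
  ne : S.Nonempty
  prob : IsProbabilityMeasure μ
  supp : μ Sᶜ = 0
  pl : ∀ x ∈ S, x i0 = 0
  qu : ∀ x ∈ S, ∀ i, |x i| ≤ 1 / 4
  C1 : 1 ≤ C
  Npos : ∀ k, 0 < N k
  Nle : ∀ k, N k ≤ Xk d pm k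
  leN : ∀ k, Xk d pm k ≤ C * N k
  ball : ∀ k a, μ (closedBall a (13 * hs k)) ≤ ENNReal.ofReal (C / N k)
  cov : ∀ k, ∃ (M : ℕ) (t : Fin M → Set (Euc d)), (M : ℝ) ≤ N k ∧ S ⊆ ⋃ i, t i ∧
    ∀ i, ∀ x ∈ t i, ∀ y ∈ t i, dist x y ≤ d * hs k

lemma geo_exists (hd : 2 ≤ d) {pm : ℝ} (hpm : 1 < pm) (hpd : pm < d) (i0 : Fin d) :
    ∃ S μ N C, Geo i0 pm S μ N C := by
  set δ := ((d:ℝ) - pm) / (d - 1) with hδ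
  have hd1 : (1:ℝ) < d := by exact_mod_cast (by omega : 1 < d)
  have h0 : 0 ≤ δ := div_nonneg (by linarith) (by linarith)
  have h1 : δ ≤ 1 := by rw [hδ, div_le_one (by linarith)]; linarith
  have hδd : ((d:ℝ) - 1) * δ = d - pm := by rw [hδ]; field_simp [show (d:ℝ) - 1 ≠ 0 by linarith]
  set a := ak δ with ha
  have hcard : ∀ k, (sk i0 a k).card = nk δ k * (d - 1) := by
    intro k; rw [sk, Finset.card_product, ak_card h0 h1]; simp
  have hcd : ∀ k, ((nk δ k * (d - 1) : ℕ) : ℝ) = nk δ k * ((d:ℝ) - 1) := by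
    intro k; rw [Nat.cast_mul, Nat.cast_sub (by omega)]; simp
  have hf : ∀ k : ℕ, 0 ≤ δ * (k - √k) := fun k => mul_nonneg h0 (by linarith [sqrt_le_nat k])
  refine ⟨range (pt i0 a), muA i0 a, fun k => 2 ^ (nk δ k * (d - 1)), 106 ^ d, ?_⟩
  refine ⟨isCompact_range (pt_cont i0 a), range_nonempty _, inferInstance, ?_, ?_, ?_, ?_, ?_, ?_, ?_, ?_, ?_⟩
  · rw [muA, Measure.map_apply (pt_cont i0 a).measurable (isCompact_range (pt_cont i0 a)).measurableSet.compl]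
    convert measure_empty (μ := coins d)
    ext ε; simp
  · rintro _ ⟨ε, rfl⟩; exact pt_i0 _ _ _
  · rintro _ ⟨ε, rfl⟩ i
    by_cases hi : i = i0
    · rw [hi, pt_i0]; norm_num
    rw [pt_i hi]
    have := xs_tr (fun j => a j && ε (j, i)) 0
    simp [tr, hs] at this
    rw [abs_of_nonneg this.1]; norm_num; linarith
  · exact one_le_pow₀ (by norm_num)
  · intro k; positivity
  · intro k
    rw [Xk, ← Real.rpow_natCast, hcd]
    refine Real.rpow_le_rpow_of_exponent_le (by norm_num) ?_
    have := Nat.floor_le (hf k)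
    rw [← hδd]; unfold nk; nlinarith
  · intro k
    have : Xk d pm k ≤ 2 ^ (d:ℝ) * 2 ^ (((nk δ k * (d - 1) : ℕ)) : ℝ) := by
      rw [Xk, ← Real.rpow_add (by norm_num), hcd]
      refine Real.rpow_le_rpow_of_exponent_le (by norm_num) ?_
      have := Nat.lt_floor_add_one (δ * (k - √k))
      rw [← hδd]; unfold nk; nlinarith
    refine this.trans ?_
    rw [Real.rpow_natCast, Real.rpow_natCast]
    refine mul_le_mul_of_nonneg_right (pow_le_pow_left₀ (by norm_num) (by norm_num) _) (by positivity)
  · intro k z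
    refine (muA_ball i0 a k z).trans_eq ?_
    rw [hcard, div_eq_mul_inv, ENNReal.ofReal_mul (by positivity), ENNReal.ofReal_inv_of_pos (by positivity),
      ENNReal.ofReal_pow (p := (2:ℝ)) (by norm_num), ENNReal.inv_pow]
    norm_num
  · intro k
    have e := Fintype.equivFin ({x // x ∈ sk i0 a k} → Bool)
    refine ⟨_, fun i => pt i0 a '' {ε | ∀ q : {x // x ∈ sk i0 a k}, ε q = e.symm i q}, ?_, ?_, ?_⟩
    · simp [hcard]
    · rintro _ ⟨ε, rfl⟩
      exact mem_iUnion.2 ⟨e fun q => ε q, ε, fun q => by simp, rfl⟩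
    · rintro i _ ⟨ε, h1, rfl⟩ _ ⟨η, h2, rfl⟩
      exact pt_cover i0 a k ε η fun q hq => (h1 ⟨q, hq⟩).trans (h2 ⟨q, hq⟩).symm

end CA2


noncomputable section CA3

variable {d : ℕ} {i0 : Fin d} {pm : ℝ} {S : Set (Euc d)} {μ : Measure (Euc d)} {N : ℕ → ℝ} {C : ℝ}

lemma sum_sqrt {b : ℝ} (hb : 0 < b) : Summable fun k : ℕ => (2:ℝ) ^ (-(b * √k)) := by
  have hl : 0 < Real.log 2 := Real.log_pos (by norm_num)
  have h1 := isLittleO_exp_neg_mul_rpow_atTop (a := Real.log 2 * b) (by positivity) (-4)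
  have h2 : Tendsto (fun k : ℕ => √(k:ℝ)) atTop atTop :=
    Real.tendsto_sqrt_atTop.comp tendsto_natCast_atTop_atTop
  have h3 := (h1.comp_tendsto h2).isBigO
  refine summable_of_isBigO_nat (g := fun k : ℕ => (k:ℝ) ^ (-2:ℝ)) (Real.summable_nat_rpow.2 (by norm_num)) ?_
  refine (h3.congr_left fun k => ?_).congr_right fun k => ?_
  · simp only [Function.comp]
    rw [Real.rpow_def_of_pos (by norm_num)]; ring_nf
  · simp only [Function.comp]
    rw [Real.sqrt_eq_rpow, ← Real.rpow_mul (by positivity)]; norm_num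

lemma sum_lin {α : ℝ} (hα : 0 < α) (β : ℝ) :
    Summable fun k : ℕ => (2:ℝ) ^ (-(α * k) + β * √k) := by
  refine Summable.of_norm_bounded_eventually_nat (sum_sqrt one_pos) ?_
  have h2 : Tendsto (fun k : ℕ => √(k:ℝ)) atTop atTop :=
    Real.tendsto_sqrt_atTop.comp tendsto_natCast_atTop_atTop
  filter_upwards [h2.eventually_ge_atTop ((β + 1) / α)] with k hk
  rw [Real.norm_of_nonneg (by positivity)]
  refine Real.rpow_le_rpow_of_exponent_le (by norm_num) ?_
  rw [div_le_iff₀ hα] at hk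
  have h3 := Real.sq_sqrt (show (0:ℝ) ≤ k by positivity)
  have h4 := Real.sqrt_nonneg (k:ℝ)
  nlinarith

lemma hs_rpow (k : ℕ) : hs k = 2 ^ (-(k:ℝ)) := by
  rw [Real.rpow_neg (by norm_num), Real.rpow_natCast, hs]; simp

/-- neighbourhood -/
def nb (S : Set (Euc d)) (k : ℕ) : Set (Euc d) := {y | infDist y S ≤ 13 * hs k}

lemma nb_meas (k : ℕ) : MeasurableSet (nb S k) :=
  (isClosed_le (continuous_infDist_pt S) continuous_const).measurableSet

lemma nb_vol (hg : Geo i0 pm S μ N C) : ∃ C2 : ℝ, 0 ≤ C2 ∧ ∀ k,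
    volume (nb S k) ≤ ENNReal.ofReal (C2 * (N k * hs k ^ d)) := by
  refine ⟨(13 + d) ^ d * volume.real (closedBall (0 : Euc d) 1), by positivity, fun k => ?_⟩
  obtain ⟨M, t, hM, hS, ht⟩ := hg.cov k
  have hh := hs_pos k
  have key : ∀ i, ∃ z : Euc d, t i ⊆ closedBall z (d * hs k) := by
    intro i
    rcases (t i).eq_empty_or_nonempty with h | ⟨z, hz⟩
    · exact ⟨0, by simp [h]⟩
    · exact ⟨z, fun x hx => ht i x hx z hz⟩
  choose z hz using key
  have hsub : nb S k ⊆ ⋃ i, closedBall (z i) ((13 + d) * hs k) := by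
    intro y hy
    obtain ⟨x, hx, hxy⟩ := hg.cpt.exists_infDist_eq_dist hg.ne y
    obtain ⟨i, hi⟩ := mem_iUnion.1 (hS hx)
    refine mem_iUnion.2 ⟨i, ?_⟩
    have h1 := hz i hi
    rw [mem_closedBall] at h1 ⊢
    have h2 : infDist y S ≤ 13 * hs k := hy
    have := dist_triangle y x (z i)
    linarith
  refine (measure_mono hsub).trans ((measure_iUnion_fintype_le _ _).trans ?_)
  simp_rw [vol_cb _ (show (0:ℝ) ≤ (13 + d) * hs k by positivity)]
  rw [Finset.sum_const, nsmul_eq_mul, Finset.card_univ, Fintype.card_fin]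
  rw [← ofReal_measureReal (s := closedBall (0 : Euc d) 1) (h := measure_closedBall_lt_top.ne),
    ← ENNReal.ofReal_mul (by positivity), ← ENNReal.ofReal_natCast, ← ENNReal.ofReal_mul (by positivity)]
  refine ENNReal.ofReal_le_ofReal ?_
  rw [mul_pow]
  calc (M:ℝ) * ((13 + d) ^ d * hs k ^ d * volume.real (closedBall (0 : Euc d) 1))
      ≤ N k * ((13 + d) ^ d * hs k ^ d * volume.real (closedBall (0 : Euc d) 1)) :=
        mul_le_mul_of_nonneg_right hM (by positivity)
    _ = _ := by ring

lemma msF {B : Set (Euc d)} (hB : MeasurableSet B) {f : Euc d → ℝ≥0∞}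
    (hf : AEMeasurable f (volume.restrict B)) :
    ∃ g : Euc d → ℝ≥0∞, Measurable g ∧ (∀ A, ∫⁻ y in A ∩ B, f y = ∫⁻ y in A, g y) := by
  refine ⟨B.indicator (hf.mk f), hf.measurable_mk.indicator hB, fun A => ?_⟩
  rw [lintegral_indicator hB, Measure.restrict_restrict hB, inter_comm]
  refine lintegral_congr_ae ?_
  exact ae_restrict_of_ae_restrict_of_subset inter_subset_left hf.ae_eq_mk

lemma msball {g : Euc d → ℝ≥0∞} (hg : Measurable g) (r : ℝ) :
    Measurable fun q : Euc d × Euc d => (closedBall q.1 r).indicator g q.2 := by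
  have hm : MeasurableSet {q : Euc d × Euc d | dist q.2 q.1 ≤ r} :=
    (isClosed_le (continuous_snd.dist continuous_fst) continuous_const).measurableSet
  have : (fun q : Euc d × Euc d => (closedBall q.1 r).indicator g q.2) =
      {q : Euc d × Euc d | dist q.2 q.1 ≤ r}.indicator fun q => g q.2 := by
    ext q; simp [indicator, mem_closedBall]
  rw [this]
  exact (hg.comp measurable_snd).indicator hm

lemma ms_lint {B : Set (Euc d)} (hB : MeasurableSet B) {f : Euc d → ℝ≥0∞}
    (hf : AEMeasurable f (volume.restrict B)) (r : ℝ) :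
    Measurable fun x => ∫⁻ y in closedBall x r ∩ B, f y := by
  obtain ⟨g, hg, h⟩ := msF hB hf
  simp_rw [h, ← lintegral_indicator measurableSet_closedBall]
  exact (msball hg r).lintegral_prod_right'

lemma fub (hg : Geo i0 pm S μ N C) {B : Set (Euc d)} (hB : MeasurableSet B) {f : Euc d → ℝ≥0∞}
    (hf : AEMeasurable f (volume.restrict B)) (k : ℕ) :
    ∫⁻ x, (∫⁻ y in closedBall x (13 * hs k) ∩ B, f y) ∂μ ≤
      ENNReal.ofReal (C / N k) * ∫⁻ y in nb S k ∩ B, f y := by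
  have := hg.prob
  obtain ⟨g, hgm, h⟩ := msF hB hf
  simp_rw [h, ← lintegral_indicator measurableSet_closedBall]
  rw [lintegral_lintegral_swap (msball hgm _).aemeasurable, ← lintegral_indicator (nb_meas k),
    ← lintegral_const_mul' _ _ ENNReal.ofReal_ne_top]
  refine lintegral_mono fun y => ?_
  have e : ∀ x : Euc d, (closedBall x (13 * hs k)).indicator g y =
      (closedBall y (13 * hs k)).indicator (fun _ => g y) x := by
    intro x; simp [indicator, mem_closedBall, dist_comm]
  simp_rw [e]
  rw [lintegral_indicator measurableSet_closedBall, lintegral_const, Measure.restrict_apply_univ, mul_comm]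
  by_cases hy : y ∈ nb S k
  · rw [indicator_of_mem hy]
    exact mul_le_mul' (hg.ball k y) le_rfl
  · have : μ (closedBall y (13 * hs k)) = 0 := by
      refine measure_mono_null (t := Sᶜ) (fun x hx (hxS : x ∈ S) => hy ?_) hg.supp
      rw [mem_closedBall, dist_comm] at hx
      exact (infDist_le_dist_of_mem hxS).trans hx
    rw [this]; simp

/-- weight -/
def wt (d : ℕ) (k : ℕ) : ℝ := hs k * (kc d * ((hs k)⁻¹) ^ d)

lemma wt_nn (k : ℕ) : 0 ≤ wt d k := by
  have := hs_pos k; have := kc_nonneg (d := d); unfold wt; positivity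

lemma main_est (hg : Geo i0 pm S μ N C) {q : ℝ} (hq1 : 1 < q) (hq : pm < q) :
    ∃ β : ℕ → ℝ, (∀ k, 0 ≤ β k) ∧ Summable β ∧ ∀ (B : Set (Euc d)) (_ : MeasurableSet B)
      (G : Euc d → Euc d →L[ℝ] ℝ) (_ : AEStronglyMeasurable G (volume.restrict B)) (k : ℕ),
      ∫⁻ x, (ENNReal.ofReal (wt d k) * ∫⁻ y in closedBall x (13 * hs k) ∩ B, ‖G y‖ₑ) ∂μ ≤
        ENNReal.ofReal (β k) * (∫⁻ y in B, ‖G y‖ₑ ^ q) ^ (1 / q) := by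
  obtain ⟨C2, hC2, hv⟩ := nb_vol hg
  have hC : 0 < C := zero_lt_one.trans_le hg.C1
  have hθ : 0 ≤ 1 - 1 / q := by rw [sub_nonneg, div_le_one (by linarith)]; exact hq1.le
  have hk := kc_nonneg (d := d)
  have hq0 : 0 < q := by linarith
  refine ⟨fun k => wt d k * (C / N k) * (C2 * (N k * hs k ^ d)) ^ (1 - 1 / q), ?_, ?_, ?_⟩
  · intro k
    have := hg.Npos k; have := hs_pos k; have := wt_nn (d := d) k
    positivity
  · refine Summable.of_nonneg_of_le (f := fun k : ℕ => (kc d * C * C2 ^ (1 - 1 / q) * C ^ (1 / q)) *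
      (2:ℝ) ^ (-((q - pm) / q * k) + ((d:ℝ) - pm) / q * √k)) ?_ ?_
      ((sum_lin (div_pos (by linarith) hq0) _).mul_left _)
    · intro k
      have := hg.Npos k; have := hs_pos k; have := wt_nn (d := d) k
      positivity
    intro k
    have hN := hg.Npos k
    have hh := hs_pos k
    have hX : 0 < Xk d pm k := by unfold Xk; positivity
    have e1 : wt d k * (C / N k) * (C2 * (N k * hs k ^ d)) ^ (1 - 1 / q) =
        (kc d * C * C2 ^ (1 - 1 / q)) * (hs k ^ (1 - d / q) * (N k) ^ (-(1 / q))) := by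
      rw [Real.mul_rpow hC2 (by positivity), Real.mul_rpow hN.le (by positivity), wt,
        ← Real.rpow_natCast (hs k) d, ← Real.rpow_mul hh.le, inv_pow, ← Real.rpow_natCast (hs k) d,
        show (1:ℝ) - d / q = 1 + (-(d:ℝ) + d * (1 - 1 / q)) by ring,
        Real.rpow_add hh, Real.rpow_add hh, Real.rpow_one, Real.rpow_neg hh.le,
        show -(1 / q) = -1 + (1 - 1 / q) by ring, Real.rpow_add hN, Real.rpow_neg_one]
      ring
    have e2 : (N k) ^ (-(1 / q)) ≤ C ^ (1 / q) * Xk d pm k ^ (-(1 / q)) := by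
      have : Xk d pm k / C ≤ N k := by rw [div_le_iff₀ hC, mul_comm]; exact hg.leN k
      refine (Real.rpow_le_rpow_of_nonpos (by positivity) this (by simp; exact hq0.le)).trans_eq ?_
      rw [Real.div_rpow hX.le hC.le, Real.rpow_neg hC.le (1 / q), div_inv_eq_mul, mul_comm]
    have e3 : hs k ^ (1 - d / q) * Xk d pm k ^ (-(1 / q)) =
        2 ^ (-((q - pm) / q * k) + ((d:ℝ) - pm) / q * √k) := by
      rw [hs_rpow, Xk, ← Real.rpow_mul (by norm_num), ← Real.rpow_mul (by norm_num),
        ← Real.rpow_add (by norm_num)]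
      congr 1
      field_simp
      ring
    rw [e1, ← e3]
    calc (kc d * C * C2 ^ (1 - 1 / q)) * (hs k ^ (1 - d / q) * (N k) ^ (-(1 / q)))
        ≤ (kc d * C * C2 ^ (1 - 1 / q)) * (hs k ^ (1 - d / q) * (C ^ (1 / q) * Xk d pm k ^ (-(1 / q)))) := by gcongr
      _ = _ := by ring
  · intro B hB G hG k
    have hN := hg.Npos k
    have hh := hs_pos k
    rw [lintegral_const_mul' _ _ ENNReal.ofReal_ne_top]
    have h1 := fub hg hB hG.enorm k
    have h2 := hold hq1 (hG.mono_measure (Measure.restrict_mono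
      (inter_subset_right (s := nb S k)) le_rfl))
    have h3 : ∫⁻ y in nb S k ∩ B, ‖G y‖ₑ ≤
        (∫⁻ y in B, ‖G y‖ₑ ^ q) ^ (1 / q) * ENNReal.ofReal ((C2 * (N k * hs k ^ d)) ^ (1 - 1 / q)) := by
      refine h2.trans (mul_le_mul' ?_ ?_)
      · exact ENNReal.rpow_le_rpow (lintegral_mono_set inter_subset_right) (by positivity)
      · rw [← ENNReal.ofReal_rpow_of_nonneg (by positivity) hθ]
        exact ENNReal.rpow_le_rpow ((measure_mono inter_subset_left).trans (hv k)) hθ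
    refine (mul_le_mul' le_rfl (h1.trans (mul_le_mul' le_rfl h3))).trans_eq ?_
    rw [ENNReal.ofReal_mul (mul_nonneg (wt_nn k) (by positivity)), ENNReal.ofReal_mul (wt_nn k)]
    ring

end CA3


noncomputable section CA4

variable {d : ℕ} {i0 : Fin d} {pm : ℝ} {S : Set (Euc d)} {μ : Measure (Euc d)} {N : ℕ → ℝ} {C : ℝ}

/-- clamped quotient -/
def Qf (a m : ℝ) : ℝ := max (-(m / 2)) (min (m / 2) a) / m

lemma tc_abs {m : ℝ} (a : ℝ) (hm : 0 ≤ m) : |max (-(m / 2)) (min (m / 2) a)| ≤ m / 2 :=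
  abs_le.2 ⟨le_max_left _ _, max_le (by linarith) (min_le_left _ _)⟩

lemma Qf_abs {m : ℝ} (a : ℝ) (hm : 0 ≤ m) : |Qf a m| ≤ 1 / 2 := by
  rw [Qf, abs_div, abs_of_nonneg hm]
  refine div_le_of_le_mul₀ hm (by norm_num) ?_
  linarith [tc_abs a hm]

lemma Qf_lip {a m a' m' : ℝ} (hm : 0 < m) (hm' : 0 < m') :
    |Qf a m - Qf a' m'| ≤ (|a - a'| + |m - m'|) / m' := by
  unfold Qf
  set T := max (-(m / 2)) (min (m / 2) a) with hT
  set T' := max (-(m' / 2)) (min (m' / 2) a') with hT'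
  have h1 : |T| ≤ m / 2 := tc_abs a hm.le
  have h2 : |T - T'| ≤ |a - a'| + |m - m'| / 2 := by
    have e1 := abs_max_sub_max_le_max (-(m / 2)) (min (m / 2) a) (-(m' / 2)) (min (m' / 2) a')
    have e2 := abs_min_sub_min_le_max (m / 2) a (m' / 2) a'
    have e3 : |-(m / 2) - -(m' / 2)| = |m - m'| / 2 := by
      rw [show -(m / 2) - -(m' / 2) = -((m - m') / 2) by ring, abs_neg, abs_div]; norm_num
    have e4 : |m / 2 - m' / 2| = |m - m'| / 2 := by
      rw [show m / 2 - m' / 2 = (m - m') / 2 by ring, abs_div]; norm_num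
    rw [e3] at e1
    rw [e4] at e2
    have p1 := abs_nonneg (a - a'); have p2 := abs_nonneg (m - m')
    refine e1.trans (max_le (by linarith) (e2.trans (max_le (by linarith) (by linarith))))
  have h3 : T / m - T' / m' = (T / m * (m' - m) + (T - T')) / m' := by field_simp; ring
  rw [h3, abs_div, abs_of_pos hm']
  refine div_le_div_of_nonneg_right ?_ hm'.le
  refine (abs_add_le _ _).trans ?_
  rw [abs_mul, abs_div, abs_of_pos hm, abs_sub_comm m' m]
  have h4 : |T| / m ≤ 1 / 2 := by rw [div_le_iff₀ hm]; linarith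
  have := mul_le_mul_of_nonneg_right h4 (abs_nonneg (m - m'))
  linarith

/-- the jump profile -/
def u0 (S : Set (Euc d)) (i0 : Fin d) (x : Euc d) : ℝ := Qf (4 * x i0) (infDist x S)

/-- the double cone region -/
def Kc (S : Set (Euc d)) (i0 : Fin d) : Set (Euc d) := {x | infDist x S / 8 < |x i0|}

lemma co_cont (i0 : Fin d) : Continuous fun x : Euc d => x i0 := by fun_prop

lemma Kc_open : IsOpen (Kc S i0) :=
  isOpen_lt ((continuous_infDist_pt S).div_const 8) (co_cont i0).abs

lemma u0_eq {x : Euc d} (hx : x ∈ Kc S i0) (h : 0 < x i0) (hD : 0 < infDist x S) : u0 S i0 x = 1 / 2 := by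
  have h1 : infDist x S / 8 < |x i0| := hx
  rw [abs_of_pos h] at h1
  rw [u0, Qf, min_eq_left (by linarith), max_eq_right (by linarith)]
  field_simp

lemma u0_eq' {x : Euc d} (hx : x ∈ Kc S i0) (h : x i0 < 0) (hD : 0 < infDist x S) : u0 S i0 x = -(1 / 2) := by
  have h1 : infDist x S / 8 < |x i0| := hx
  rw [abs_of_neg h] at h1
  rw [u0, Qf, min_eq_right (by linarith), max_eq_left (by linarith)]
  field_simp

lemma D_ge (hg : Geo i0 pm S μ N C) (x : Euc d) : |x i0| ≤ infDist x S := by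
  obtain ⟨z, hz, h⟩ := hg.cpt.exists_infDist_eq_dist hg.ne x
  have := co x z i0
  rw [hg.pl z hz, sub_zero] at this
  rw [h]; exact this

lemma Kc_D (hg : Geo i0 pm S μ N C) {x : Euc d} (hx : x ∈ Kc S i0) : 0 < infDist x S ∧ x i0 ≠ 0 := by
  have h1 : infDist x S / 8 < |x i0| := hx
  have h0 : 0 ≤ infDist x S := infDist_nonneg
  have h2 : 0 < |x i0| := by linarith
  exact ⟨h2.trans_le (D_ge hg x), abs_pos.1 h2⟩

lemma Kc_fd (hg : Geo i0 pm S μ N C) {x : Euc d} (hx : x ∈ Kc S i0) : fderiv ℝ (u0 S i0) x = 0 := by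
  rcases lt_or_gt_of_ne (Kc_D hg hx).2 with h | h
  · have : u0 S i0 =ᶠ[𝓝 x] fun _ => -(1 / 2) := by
      filter_upwards [Kc_open.mem_nhds hx, (isOpen_lt (co_cont i0) continuous_const).mem_nhds h] with y h1 h2
      exact u0_eq' h1 h2 (Kc_D hg h1).1
    rw [this.fderiv_eq, fderiv_fun_const]; rfl
  · have : u0 S i0 =ᶠ[𝓝 x] fun _ => (1 / 2) := by
      filter_upwards [Kc_open.mem_nhds hx, (isOpen_lt continuous_const (co_cont i0)).mem_nhds h] with y h1 h2
      exact u0_eq h1 h2 (Kc_D hg h1).1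
    rw [this.fderiv_eq, fderiv_fun_const]; rfl

lemma volS (hg : Geo i0 pm S μ N C) : volume S = 0 := by
  let L : Euc d →ₗ[ℝ] ℝ := (EuclideanSpace.proj i0 : Euc d →L[ℝ] ℝ).toLinearMap
  refine measure_mono_null (t := (LinearMap.ker L : Set (Euc d))) (fun x hx => ?_)
    (Measure.addHaar_submodule volume _ ?_)
  · exact hg.pl x hx
  · intro h
    have h1 : EuclideanSpace.single i0 (1:ℝ) ∈ LinearMap.ker L := by rw [h]; trivial
    have h2 : L (EuclideanSpace.single i0 (1:ℝ)) = 0 := h1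
    simp [L] at h2

lemma Dint (hg : Geo i0 pm S μ N C) (hpm : 1 < pm) (hpd : pm < d) {A : Set (Euc d)} (hA : volume A < ⊤) :
    ∫⁻ x in A, ENNReal.ofReal ((infDist x S)⁻¹ ^ pm) < ⊤ := by
  obtain ⟨C2, hC2, hv⟩ := nb_vol hg
  have hpt : ∀ x, ENNReal.ofReal ((infDist x S)⁻¹ ^ pm) ≤
      1 + ∑' k, (nb S k).indicator (fun _ => ENNReal.ofReal ((hs (k + 1))⁻¹ ^ pm)) x := by
    intro x
    have h0 : 0 ≤ infDist x S := infDist_nonneg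
    rcases le_or_gt 1 (infDist x S) with h | h
    · refine le_add_right ?_
      rw [ENNReal.ofReal_le_one]
      exact Real.rpow_le_one (by positivity) (inv_le_one_of_one_le₀ h) (by linarith)
    rcases h0.eq_or_lt with h1 | h1
    · rw [← h1]; simp [Real.zero_rpow (by linarith : pm ≠ 0)]
    obtain ⟨k, hk1, hk2⟩ := exists_nat_pow_near_of_lt_one h1 h.le (show (0:ℝ) < 1 / 2 by norm_num) (by norm_num)
    refine le_add_left (le_trans ?_ (ENNReal.le_tsum k))
    have hm : x ∈ nb S k := by
      show infDist x S ≤ 13 * hs k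
      have := hs_pos k
      have h3 : infDist x S ≤ hs k := hk2
      linarith
    rw [indicator_of_mem hm]
    refine ENNReal.ofReal_le_ofReal (Real.rpow_le_rpow (by positivity) ?_ (by linarith))
    exact inv_anti₀ (hs_pos _) hk1.le
  refine (lintegral_mono hpt).trans_lt ?_
  rw [lintegral_add_left measurable_const, ENNReal.add_lt_top]
  refine ⟨by simpa using hA, ?_⟩
  rw [lintegral_tsum fun k => (measurable_const.indicator (nb_meas k)).aemeasurable]
  have hsum := (sum_sqrt (b := (d:ℝ) - pm) (by linarith)).mul_left (C2 * 2 ^ pm)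
  refine lt_of_le_of_lt (ENNReal.tsum_le_tsum fun k => ?_) hsum.tsum_ofReal_lt_top
  refine (setLIntegral_le_lintegral _ _).trans ?_
  rw [lintegral_indicator (nb_meas k), lintegral_const, Measure.restrict_apply_univ]
  refine (mul_le_mul' le_rfl (hv k)).trans ?_
  have hh := hs_pos k
  have hN := hg.Npos k
  rw [← ENNReal.ofReal_mul (by have := hs_pos (k+1); positivity)]
  refine ENNReal.ofReal_le_ofReal ?_
  have e1 : (hs (k + 1))⁻¹ ^ pm = 2 ^ (((k:ℝ) + 1) * pm) := by
    rw [hs_rpow, ← Real.rpow_neg (by norm_num), ← Real.rpow_mul (by norm_num)]; congr 1; push_cast; ring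
  have e2 : hs k ^ d = 2 ^ (-((k:ℝ) * d)) := by
    rw [hs_rpow, ← Real.rpow_natCast, ← Real.rpow_mul (by norm_num)]; congr 1; ring
  rw [e1, e2]
  calc (2:ℝ) ^ (((k:ℝ) + 1) * pm) * (C2 * (N k * 2 ^ (-((k:ℝ) * d))))
      ≤ 2 ^ (((k:ℝ) + 1) * pm) * (C2 * (Xk d pm k * 2 ^ (-((k:ℝ) * d)))) := by
        have := hg.Nle k
        gcongr
    _ = C2 * 2 ^ pm * 2 ^ (-(((d:ℝ) - pm) * √k)) := by
        rw [Xk, show (2:ℝ) ^ (((k:ℝ) + 1) * pm) * (C2 * (2 ^ (((d:ℝ) - pm) * (k - √k)) * 2 ^ (-((k:ℝ) * d)))) =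
          C2 * (2 ^ (((k:ℝ) + 1) * pm) * 2 ^ (((d:ℝ) - pm) * (k - √k)) * 2 ^ (-((k:ℝ) * d))) by ring,
          mul_assoc C2, ← Real.rpow_add (by norm_num), ← Real.rpow_add (by norm_num), ← Real.rpow_add (by norm_num)]
        congr 2; ring

lemma u0_spec (hg : Geo i0 pm S μ N C) (hpm : 1 < pm) (hpd : pm < d) :
    LocallyIntegrable (u0 S i0) ∧ LocallyIntegrable (fderiv ℝ (u0 S i0)) ∧
      HasWeakFDerivOn univ (u0 S i0) (fderiv ℝ (u0 S i0)) ∧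
      ∀ x ∉ S, ‖fderiv ℝ (u0 S i0) x‖ ≤ 5 * (infDist x S)⁻¹ := by
  set U : ℕ → Euc d → ℝ := fun k x => Qf (4 * x i0) (max (infDist x S) (hs k)) with hU
  have hmp : ∀ k x, 0 < max (infDist x S) (hs k) := fun k x => (hs_pos k).trans_le (le_max_right _ _)
  have hbd : ∀ k x y, |U k y - U k x| ≤ 5 / max (infDist x S) (hs k) * dist y x := by
    intro k x y
    refine (Qf_lip (hmp k y) (hmp k x)).trans ?_
    rw [div_mul_eq_mul_div]
    refine div_le_div_of_nonneg_right ?_ (hmp k x).le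
    have h1 : |4 * y i0 - 4 * x i0| ≤ 4 * dist y x := by
      rw [← mul_sub, abs_mul, abs_of_pos (by norm_num : (0:ℝ) < 4)]
      linarith [co y x i0]
    have h2 : |max (infDist y S) (hs k) - max (infDist x S) (hs k)| ≤ dist y x := by
      refine (abs_max_sub_max_le_max _ _ _ _).trans ?_
      simp only [sub_self, abs_zero]
      refine max_le ?_ dist_nonneg
      have := (lipschitz_infDist_pt S).dist_le_mul y x
      simpa [Real.dist_eq] using this
    linarith
  have hDo : ∀ x ∉ S, 0 < infDist x S := fun x hx => by
    have := (hg.cpt.isClosed.notMem_iff_infDist_pos hg.ne).1 hx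
    exact this
  refine removable (U := U) (M := 1 / 2) (Z := S) ?_ ?_ (volS hg) ?_ ?_ ?_
  · intro k
    refine ⟨Real.toNNReal (5 / hs k), LipschitzWith.of_dist_le_mul fun y x => ?_⟩
    rw [Real.dist_eq, Real.coe_toNNReal _ (div_nonneg (by norm_num) (hs_pos k).le)]
    refine (hbd k x y).trans (mul_le_mul_of_nonneg_right ?_ dist_nonneg)
    exact div_le_div_of_nonneg_left (by norm_num) (hs_pos k) (le_max_right _ _)
  · intro k x; exact Qf_abs _ (hmp k x).le
  · intro x hx
    have h1 := hDo x hx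
    have ht : Tendsto hs atTop (𝓝 0) := _root_.tendsto_pow_atTop_nhds_zero_of_lt_one (by norm_num) (by norm_num)
    filter_upwards [ht.eventually (gt_mem_nhds (half_pos h1))] with k hk
    filter_upwards [(continuous_infDist_pt S).continuousAt.eventually (lt_mem_nhds (half_lt_self h1))] with y hy
    simp only [hU, u0]
    rw [max_eq_left (hk.trans hy).le]
  · have hm : AEStronglyMeasurable (fun x : Euc d => 5 * (infDist x S)⁻¹) volume :=
      ((continuous_infDist_pt S).measurable.inv.const_mul 5).aestronglyMeasurable
    rw [locallyIntegrable_iff]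
    intro A hA
    have hI : IntegrableOn (fun x : Euc d => 5 * (1 + (infDist x S)⁻¹ ^ pm)) A := by
      refine Integrable.const_mul (Integrable.add (integrableOn_const hA.measure_lt_top.ne) ?_) 5
      refine ⟨(by fun_prop : Measurable fun x : Euc d => (infDist x S)⁻¹ ^ pm).aestronglyMeasurable, ?_⟩
      rw [hasFiniteIntegral_iff_ofReal (ae_of_all _ fun x => Real.rpow_nonneg (inv_nonneg.2 infDist_nonneg) _)]
      exact Dint hg hpm hpd hA.measure_lt_top
    refine hI.mono' hm.restrict (ae_of_all _ fun x => ?_)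
    have h0 : 0 ≤ (infDist x S)⁻¹ := inv_nonneg.2 infDist_nonneg
    rw [Real.norm_of_nonneg (by positivity)]
    refine mul_le_mul_of_nonneg_left ?_ (by norm_num)
    rcases le_total (infDist x S)⁻¹ 1 with h | h
    · linarith [Real.rpow_nonneg h0 pm]
    · linarith [Real.self_le_rpow_of_one_le h hpm.le]
  · intro k x hx
    have h1 := hDo x hx
    refine norm_fderiv_le_of_lip' ℝ (by positivity) (Eventually.of_forall fun y => ?_)
    rw [Real.norm_eq_abs, ← dist_eq_norm]
    refine (hbd k x y).trans (mul_le_mul_of_nonneg_right ?_ dist_nonneg)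
    rw [← div_eq_mul_inv]
    exact div_le_div_of_nonneg_left (by norm_num) h1 (le_max_left _ _)

/-- the exponent -/
def pe (S : Set (Euc d)) (i0 : Fin d) (pm pp : ℝ) (x : Euc d) : ℝ :=
  open Classical in if x ∈ Kc S i0 then pp else pm

lemma pe_meas (pp : ℝ) : Measurable (pe S i0 pm pp) := by
  unfold pe
  exact Measurable.ite Kc_open.measurableSet measurable_const measurable_const

lemma pe_v (pp : ℝ) (x : Euc d) : pe S i0 pm pp x = pm ∨ pe S i0 pm pp x = pp := by
  unfold pe; split_ifs <;> simp

lemma u0_en (hg : Geo i0 pm S μ N C) (hpm : 1 < pm) (hpd : pm < d) {pp : ℝ} (hpp : 1 < pp) :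
    ∃ E : ℝ≥0∞, E < ⊤ ∧ ∀ t : ℝ, 0 < t →
      en (pe S i0 pm pp) (fun x => t • fderiv ℝ (u0 S i0) x) ≤ ENNReal.ofReal (t ^ pm) * E := by
  refine ⟨ENNReal.ofReal (5 ^ pm) * ∫⁻ x in Box d, ENNReal.ofReal ((infDist x S)⁻¹ ^ pm),
    ENNReal.mul_lt_top ENNReal.ofReal_lt_top (Dint hg hpm hpd (box_fin d)), fun t ht => ?_⟩
  rw [en_def, ← lintegral_const_mul' _ _ ENNReal.ofReal_ne_top, ← lintegral_const_mul' _ _ ENNReal.ofReal_ne_top]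
  refine lintegral_mono_ae (ae_restrict_of_ae ?_)
  filter_upwards [measure_eq_zero_iff_ae_notMem.1 (volS hg)] with x hx
  rw [← ENNReal.ofReal_mul (by positivity), ← ENNReal.ofReal_mul (by positivity)]
  refine ENNReal.ofReal_le_ofReal ?_
  have h0 : 0 ≤ (infDist x S)⁻¹ := inv_nonneg.2 infDist_nonneg
  rw [norm_smul, Real.norm_of_nonneg ht.le]
  by_cases hK : x ∈ Kc S i0
  · rw [Kc_fd hg hK]
    have : pe S i0 pm pp x = pp := if_pos hK
    rw [this, norm_zero (E := Euc d →L[ℝ] ℝ), mul_zero, Real.zero_rpow (by linarith), zero_div]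
    positivity
  · have : pe S i0 pm pp x = pm := if_neg hK
    rw [this, ← Real.mul_rpow (by norm_num) h0, ← Real.mul_rpow ht.le (by positivity)]
    refine (div_le_self (by positivity) hpm.le).trans ?_
    refine Real.rpow_le_rpow (by positivity) ?_ (by linarith)
    exact mul_le_mul_of_nonneg_left ((u0_spec hg hpm hpd).2.2.2 x hx) ht.le

end CA4


noncomputable section CA5

variable {d : ℕ} {i0 : Fin d} {pm : ℝ} {S : Set (Euc d)} {μ : Measure (Euc d)} {N : ℕ → ℝ} {C : ℝ}

/-- base points in the cone -/
def pk (i0 : Fin d) (σ : ℝ) (k : ℕ) (x : Euc d) : Euc d := x + EuclideanSpace.single i0 (σ * 8 * hs k)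

lemma pk_i0 (σ : ℝ) (k : ℕ) (x : Euc d) : pk i0 σ k x i0 = x i0 + σ * 8 * hs k := by simp [pk]

lemma pk_dist {σ : ℝ} (hσ : |σ| = 1) (k : ℕ) (x : Euc d) : dist (pk i0 σ k x) x = 8 * hs k := by
  rw [pk, dist_eq_norm, add_sub_cancel_left, PiLp.norm_single, Real.norm_eq_abs, abs_mul, abs_mul, hσ,
    abs_of_pos (hs_pos k)]
  norm_num

lemma near (hg : Geo i0 pm S μ N C) {σ : ℝ} (hσ : |σ| = 1) (k : ℕ) {x : Euc d} (hx : x ∈ S) {y : Euc d}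
    (hy : dist y (pk i0 σ k x) ≤ 9 / 2 * hs k) :
    7 / 2 * hs k ≤ σ * y i0 ∧ dist y x ≤ 13 * hs k ∧ y ∈ Kc S i0 := by
  have hh := hs_pos k
  have h1 := (co y _ i0).trans hy
  rw [pk_i0, hg.pl x hx, zero_add] at h1
  have hs1 : σ * σ = 1 := by rw [← abs_mul_abs_self, hσ, one_mul]
  have h2 : |σ * y i0 - 8 * hs k| ≤ 9 / 2 * hs k := by
    have : σ * y i0 - 8 * hs k = σ * (y i0 - σ * 8 * hs k) := by linear_combination (8 * hs k) * hs1
    rw [this, abs_mul, hσ, one_mul]; exact h1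
  have h3 : 7 / 2 * hs k ≤ σ * y i0 := by have := (abs_le.1 h2).1; linarith
  have h4 : dist y x ≤ 25 / 2 * hs k := by
    have := dist_triangle y (pk i0 σ k x) x
    rw [pk_dist hσ] at this; linarith
  refine ⟨h3, by linarith, ?_⟩
  show infDist y S / 8 < |y i0|
  have h5 : infDist y S ≤ dist y x := infDist_le_dist_of_mem hx
  have h6 : σ * y i0 ≤ |y i0| := by
    calc σ * y i0 ≤ |σ * y i0| := le_abs_self _
      _ = |y i0| := by rw [abs_mul, hσ, one_mul]
  linarith

lemma stepA (hg : Geo i0 pm S μ N C) {w : Euc d → ℝ} {H : Euc d → Euc d →L[ℝ] ℝ} (hZ : ZC w H) (t : ℝ)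
    {σ : ℝ} (hσ : |σ| = 1) (k : ℕ) {x : Euc d} (hx : x ∈ S) :
    ‖avg (hs (k + 1)) w (pk i0 σ (k + 1) x) - avg (hs k) w (pk i0 σ k x)‖ₑ ≤
      ENNReal.ofReal (6 * 2 ^ d) * (ENNReal.ofReal (wt d k) *
        ∫⁻ y in closedBall x (13 * hs k) ∩ (Kc S i0 ∩ Box d), ‖t • fderiv ℝ (u0 S i0) y + H y‖ₑ) := by
  have hh := hs_pos k
  have hw := wt_nn (d := d) k
  set p := pk i0 σ k x with hp
  set q := pk i0 σ (k + 1) x with hq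
  set I := ∫⁻ y in closedBall x (13 * hs k) ∩ (Kc S i0 ∩ Box d), ‖t • fderiv ℝ (u0 S i0) y + H y‖ₑ with hI
  have hlw : LocallyIntegrable w := hZ.iw.locallyIntegrable
  have hpq : dist q p = 4 * hs k := by
    rw [hp, hq, pk, pk, dist_add_left, hs_succ, PiLp.dist_single_same, Real.dist_eq,
      show σ * 8 * (hs k / 2) - σ * 8 * hs k = -(σ * (4 * hs k)) by ring, abs_neg, abs_mul, hσ, one_mul,
      abs_of_pos (by linarith)]
  have hIb : ∫⁻ y in closedBall p (9 / 2 * hs k), ‖H y‖ₑ ≤ I := by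
    rw [hI, ← lintegral_indicator measurableSet_closedBall,
      ← lintegral_indicator (measurableSet_closedBall.inter (Kc_open.measurableSet.inter (box_open d).measurableSet))]
    refine lintegral_mono fun y => ?_
    by_cases hy : y ∈ closedBall p (9 / 2 * hs k)
    · rw [indicator_of_mem hy]
      by_cases hb : y ∈ Box d
      · obtain ⟨-, h2, h3⟩ := near hg hσ k hx hy
        have hm : y ∈ closedBall x (13 * hs k) ∩ (Kc S i0 ∩ Box d) := ⟨h2, h3, hb⟩
        rw [indicator_of_mem hm, Kc_fd hg h3]
        refine le_of_eq ?_
        congr 1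
        ext v; simp
      · rw [hZ.H0 y hb, enorm_zero (E := Euc d →L[ℝ] ℝ)]; exact zero_le
    · rw [indicator_of_notMem hy]; exact zero_le
  have h1 := avg_dil hh hlw hZ.wk p
  have h2 := avg_seg (half_pos hh) hlw hZ.wk (p := p) (q := q) (E := closedBall p (9 / 2 * hs k)) (by
    intro z hz
    refine (lin3 hz (c := p) (r := 4 * hs k) (by rw [dist_self]; linarith) hpq.le).trans ?_
    exact closedBall_subset_closedBall (by linarith))
  rw [hs_succ]
  calc ‖avg (hs k / 2) w q - avg (hs k) w p‖ₑ
      = ‖(avg (hs k / 2) w q - avg (hs k / 2) w p) + (avg (hs k / 2) w p - avg (hs k) w p)‖ₑ := by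
        rw [sub_add_sub_cancel]
    _ ≤ ‖avg (hs k / 2) w q - avg (hs k / 2) w p‖ₑ + ‖avg (hs k / 2) w p - avg (hs k) w p‖ₑ := enorm_add_le _ _
    _ ≤ ENNReal.ofReal (4 * 2 ^ d * wt d k) * I + ENNReal.ofReal (2 * 2 ^ d * wt d k) * I := by
        refine add_le_add ?_ ?_
        · refine h2.trans (mul_le_mul' (le_of_eq ?_) hIb)
          rw [← dist_eq_norm, hpq, wt, inv_div, div_eq_mul_inv, mul_pow]; congr 1; ring
        · rw [enorm_sub_rev]
          refine h1.trans (mul_le_mul' (le_of_eq ?_)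
            ((lintegral_mono_set (closedBall_subset_closedBall (by linarith))).trans hIb))
          rw [wt, pow_succ]; congr 1; ring
    _ = _ := by
        rw [← add_mul, ← ENNReal.ofReal_add (by positivity) (by positivity), ← mul_assoc,
          ← ENNReal.ofReal_mul (by positivity)]
        congr 2; ring

lemma startA (hg : Geo i0 pm S μ N C) {w : Euc d → ℝ} {H : Euc d → Euc d →L[ℝ] ℝ} (hZ : ZC w H)
    {σ : ℝ} (hσ : |σ| = 1) {x : Euc d} (hx : x ∈ S) : avg (hs 0) w (pk i0 σ 0 x) = 0 := by
  rw [avg_congr (v := fun _ => (0:ℝ)), avg_const (hs_pos 0)]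
  refine ae_of_all _ fun y hy => hZ.w0 y fun hb => ?_
  rw [mem_closedBall] at hy
  have := (near hg hσ 0 hx (hy.trans (by rw [hs_zero]; norm_num))).1
  have h2 := hb i0
  rw [hs_zero] at this
  have h3 : σ * y i0 ≤ |σ * y i0| := le_abs_self _
  rw [abs_mul, hσ, one_mul] at h3
  linarith

lemma avU (hg : Geo i0 pm S μ N C) (t : ℝ)
    {σ : ℝ} (hσ : |σ| = 1) (k : ℕ) {x : Euc d} (hx : x ∈ S) :
    avg (hs k) (fun y => t * u0 S i0 y) (pk i0 σ k x) = t * (σ / 2) := by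
  have hh := hs_pos k
  rw [avg_congr (v := fun _ => t * (σ / 2)), avg_const hh]
  refine ae_of_all _ fun y hy => ?_
  rw [mem_closedBall] at hy
  obtain ⟨h1, -, h3⟩ := near hg hσ k hx (hy.trans (by linarith))
  rcases (_root_.abs_eq zero_le_one).1 hσ with h | h
  · rw [u0_eq h3 (by rw [h] at h1; linarith) (Kc_D hg h3).1, h]
  · rw [u0_eq' h3 (by rw [h] at h1; linarith) (Kc_D hg h3).1, h]; ring

/-- the potential -/
def Fk (S : Set (Euc d)) (i0 : Fin d) (G : Euc d → Euc d →L[ℝ] ℝ) (k : ℕ) (x : Euc d) : ℝ≥0∞ :=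
  ENNReal.ofReal (wt d k) * ∫⁻ y in closedBall x (13 * hs k) ∩ (Kc S i0 ∩ Box d), ‖G y‖ₑ

/-- the jump of averages -/
def ck (i0 : Fin d) (v : Euc d → ℝ) (k : ℕ) (x : Euc d) : ℝ≥0∞ :=
  ‖avg (hs k) v (pk i0 1 k x) - avg (hs k) v (pk i0 (-1) k x)‖ₑ

lemma avA (hg : Geo i0 pm S μ N C) {w : Euc d → ℝ} {H : Euc d → Euc d →L[ℝ] ℝ} (hZ : ZC w H) (t : ℝ)
    {σ : ℝ} (hσ : |σ| = 1) (k : ℕ) {x : Euc d} (hx : x ∈ S) :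
    ‖avg (hs k) w (pk i0 σ k x)‖ₑ ≤ ENNReal.ofReal (6 * 2 ^ d) *
      ∑' j, Fk S i0 (fun y => t • fderiv ℝ (u0 S i0) y + H y) j x := by
  set F := fun j => Fk S i0 (fun y => t • fderiv ℝ (u0 S i0) y + H y) j x with hF
  have h1 : ‖avg (hs k) w (pk i0 σ k x)‖ₑ ≤ ENNReal.ofReal (6 * 2 ^ d) * ∑ j ∈ Finset.range k, F j := by
    induction k with
    | zero => rw [startA hg hZ hσ hx]; simp
    | succ k ih =>
      rw [Finset.sum_range_succ, mul_add]
      have := stepA hg hZ t hσ k hx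
      calc _ = ‖avg (hs k) w (pk i0 σ k x) +
            (avg (hs (k + 1)) w (pk i0 σ (k + 1) x) - avg (hs k) w (pk i0 σ k x))‖ₑ := by
              rw [add_sub_cancel]
        _ ≤ _ := (enorm_add_le _ _).trans (add_le_add ih this)
  exact h1.trans (mul_le_mul' le_rfl (ENNReal.sum_le_tsum _))

lemma jump (hg : Geo i0 pm S μ N C) (hpm : 1 < pm) (hpd : pm < d)
    {w : Euc d → ℝ} {H : Euc d → Euc d →L[ℝ] ℝ} (hZ : ZC w H) {t : ℝ}
    (k : ℕ) {x : Euc d} (hx : x ∈ S) :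
    ENNReal.ofReal t ≤ ck i0 (fun y => t * u0 S i0 y + w y) k x + ENNReal.ofReal (12 * 2 ^ d) *
      ∑' j, Fk S i0 (fun y => t • fderiv ℝ (u0 S i0) y + H y) j x := by
  have hs1 : |(1:ℝ)| = 1 := by simp
  have hs2 : |(-1:ℝ)| = 1 := by simp
  have a1 := avA hg hZ t hs1 k hx
  have a2 := avA hg hZ t hs2 k hx
  have l1 : LocallyIntegrable fun y => t * u0 S i0 y := by
    simpa [Pi.smul_def] using (u0_spec hg hpm hpd).1.smul t
  have hlw : LocallyIntegrable w := hZ.iw.locallyIntegrable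
  rw [ck, avg_add (hs_pos k) l1 hlw, avg_add (hs_pos k) l1 hlw, avU hg t hs1 k hx, avU hg t hs2 k hx]
  set A := avg (hs k) w (pk i0 1 k x)
  set B := avg (hs k) w (pk i0 (-1) k x)
  set R := ∑' j, Fk S i0 (fun y => t • fderiv ℝ (u0 S i0) y + H y) j x
  calc ENNReal.ofReal t ≤ ‖t‖ₑ := Real.ofReal_le_enorm t
    _ = ‖(t * (1 / 2) + A - (t * (-1 / 2) + B)) + (B + -A)‖ₑ := by congr 1; ring
    _ ≤ ‖t * (1 / 2) + A - (t * (-1 / 2) + B)‖ₑ + (‖B‖ₑ + ‖A‖ₑ) :=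
        (enorm_add_le _ _).trans (add_le_add le_rfl ((enorm_add_le _ _).trans_eq (by rw [enorm_neg])))
    _ ≤ _ := by
        refine add_le_add le_rfl ((add_le_add a2 a1).trans_eq ?_)
        rw [← add_mul, ← ENNReal.ofReal_add (by positivity) (by positivity)]
        congr 2; ring

lemma ck_grad (hg : Geo i0 pm S μ N C) {v : Euc d → ℝ} {G : Euc d → Euc d →L[ℝ] ℝ}
    (lv : LocallyIntegrable v) (wv : HasWeakFDerivOn univ v G) {k : ℕ} (hk : 4 ≤ k) {x : Euc d} (hx : x ∈ S) :
    ck i0 v k x ≤ ENNReal.ofReal 16 * (ENNReal.ofReal (wt d k) *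
      ∫⁻ y in closedBall x (13 * hs k) ∩ Box d, ‖G y‖ₑ) := by
  have hh := hs_pos k
  have hs1 : |(1:ℝ)| = 1 := by simp
  have hs2 : |(-1:ℝ)| = 1 := by simp
  have hk4 : hs k ≤ 1 / 16 := by
    have : hs k ≤ (1 / 2) ^ 4 := pow_le_pow_of_le_one (by norm_num) (by norm_num) hk
    linarith
  have h2 := avg_seg hh lv wv (p := pk i0 (-1) k x) (q := pk i0 1 k x)
    (E := closedBall x (13 * hs k) ∩ Box d) (by
    intro z hz
    have h3 := lin3 hz (h := hs k) (pk_dist (i0 := i0) hs2 k x).le (pk_dist (i0 := i0) hs1 k x).le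
    intro y hy
    have h4 := h3 hy
    rw [mem_closedBall] at h4
    refine ⟨by rw [mem_closedBall]; linarith, fun i => ?_⟩
    have h5 := (co y x i).trans h4
    have h6 := hg.qu x hx i
    rw [abs_le] at h5 h6
    rw [abs_lt]; constructor <;> linarith)
  refine h2.trans_eq ?_
  rw [← mul_assoc (ENNReal.ofReal 16), ← ENNReal.ofReal_mul (by norm_num), ← dist_eq_norm]
  have : dist (pk i0 1 k x) (pk i0 (-1) k x) = 16 * hs k := by
    rw [pk, pk, dist_add_left, PiLp.dist_single_same, Real.dist_eq,
      show 1 * 8 * hs k - -1 * 8 * hs k = 16 * hs k by ring, abs_of_pos (by linarith)]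
  rw [this, wt]; congr 2; ring

lemma ck_leb {v : Euc d → ℝ} (lv : LocallyIntegrable v) {x : Euc d}
    (h : ¬ IsNonLebesguePoint v x) : Tendsto (fun k => ck i0 v k x) atTop (𝓝 0) := by
  rw [IsNonLebesguePoint, not_not] at h
  obtain ⟨c, hc⟩ := h
  have ht : Tendsto hs atTop (𝓝 0) := _root_.tendsto_pow_atTop_nhds_zero_of_lt_one (by norm_num) (by norm_num)
  have ht2 : Tendsto (fun k => 10 * hs k) atTop (𝓝[>] 0) := by
    refine tendsto_nhdsWithin_iff.2 ⟨by simpa using ht.const_mul 10, Eventually.of_forall fun k => ?_⟩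
    have := hs_pos k
    show 0 < 10 * hs k
    positivity
  have h1 := hc.comp ht2
  set ω := volume.real (closedBall (0 : Euc d) 1) with hω
  have hkc := kc_nonneg (d := d)
  have key : ∀ σ : ℝ, |σ| = 1 → ∀ k, |avg (hs k) v (pk i0 σ k x) - c| ≤
      kc d * (10 ^ d * ω) * ⨍ y in ball x (10 * hs k), |v y - c| := by
    intro σ hσ k
    have hh := hs_pos k
    have iv : IntegrableOn (fun y => |v y - c|) (closedBall x (10 * hs k)) :=
      (((lv.sub (locallyIntegrable_const c)).integrableOn_isCompact (isCompact_closedBall _ _))).abs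
    refine (avg_sub_const_le hh lv c _).trans ?_
    have e1 : ∫ y in closedBall (pk i0 σ k x) (hs k), |v y - c| ≤ ∫ y in ball x (10 * hs k), |v y - c| := by
      refine setIntegral_mono_set (iv.mono_set ball_subset_closedBall) (ae_of_all _ fun y => abs_nonneg _)
        (LE.le.eventuallyLE fun y hy => ?_)
      rw [mem_closedBall] at hy
      rw [mem_ball]
      have := dist_triangle y (pk i0 σ k x) x
      rw [pk_dist hσ] at this; linarith
    have e2 : ∫ y in ball x (10 * hs k), |v y - c| =
        volume.real (ball x (10 * hs k)) * ⨍ y in ball x (10 * hs k), |v y - c| := by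
      rw [setAverage_eq, smul_eq_mul, mul_inv_cancel_left₀]
      exact (ENNReal.toReal_pos (measure_ball_pos _ _ (by positivity)).ne' measure_ball_lt_top.ne).ne'
    have e3 : volume.real (ball x (10 * hs k)) ≤ (10 * hs k) ^ d * ω := by
      have : volume.real (closedBall x (10 * hs k)) = (10 * hs k) ^ d * ω := by
        rw [measureReal_def, vol_cb x (by positivity), ENNReal.toReal_mul, ENNReal.toReal_ofReal (by positivity), hω,
          measureReal_def]
      rw [← this]
      exact measureReal_mono ball_subset_closedBall measure_closedBall_lt_top.ne
    have e4 : 0 ≤ ⨍ y in ball x (10 * hs k), |v y - c| := by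
      rw [setAverage_eq]; exact smul_nonneg (by positivity) (integral_nonneg fun _ => abs_nonneg _)
    calc kc d * (hs k)⁻¹ ^ d * ∫ y in closedBall (pk i0 σ k x) (hs k), |v y - c|
        ≤ kc d * (hs k)⁻¹ ^ d * (((10 * hs k) ^ d * ω) * ⨍ y in ball x (10 * hs k), |v y - c|) := by
          refine mul_le_mul_of_nonneg_left (e1.trans ?_) (by positivity)
          rw [e2]; exact mul_le_mul_of_nonneg_right e3 e4
      _ = _ := by rw [mul_pow, inv_pow]; field_simp
  have lim : ∀ σ : ℝ, |σ| = 1 → Tendsto (fun k => avg (hs k) v (pk i0 σ k x)) atTop (𝓝 c) := by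
    intro σ hσ
    rw [tendsto_iff_dist_tendsto_zero]
    have h3 := h1.const_mul (kc d * (10 ^ d * ω))
    rw [mul_zero] at h3
    exact squeeze_zero (fun _ => dist_nonneg) (fun k => key σ hσ k) h3
  have h2 := ((lim 1 (by simp)).sub (lim (-1) (by simp))).enorm
  simpa [ck] using h2

end CA5


noncomputable section CA6

variable {d : ℕ} {i0 : Fin d} {pm : ℝ} {S : Set (Euc d)} {μ : Measure (Euc d)} {N : ℕ → ℝ} {C : ℝ}

lemma hs_lim : Tendsto hs atTop (𝓝 0) :=
  _root_.tendsto_pow_atTop_nhds_zero_of_lt_one (by norm_num) (by norm_num)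

lemma dim_up (hg : Geo i0 pm S μ N C) (hpd : pm < d) {K : Set (Euc d)} (hK : K ⊆ S) :
    dimH K ≤ ENNReal.ofReal ((d:ℝ) - pm) := by
  have hγ : 0 < (d:ℝ) - pm := by linarith
  refine (dimH_mono hK).trans ?_
  refine dimH_le_of_hausdorffMeasure_ne_top (d := Real.toNNReal ((d:ℝ) - pm)) ?_
  rw [Real.coe_toNNReal _ hγ.le]
  choose M t hM hS ht using hg.cov
  have hdi : ∀ k i, ediam (t k i) ≤ ENNReal.ofReal (d * hs k) := by
    intro k i
    refine ediam_le fun x hx y hy => ?_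
    rw [edist_dist]
    exact ENNReal.ofReal_le_ofReal (ht k i x hx y hy)
  have hr : Tendsto (fun k => ENNReal.ofReal (d * hs k)) atTop (𝓝 0) := by
    have := ENNReal.tendsto_ofReal (hs_lim.const_mul (d:ℝ))
    simpa using this
  have h := Measure.hausdorffMeasure_le_liminf_sum ((d:ℝ) - pm) S _ hr t
    (Eventually.of_forall hdi) (Eventually.of_forall hS)
  have hb : ∀ k, ∑ i, ediam (t k i) ^ ((d:ℝ) - pm) ≤ ENNReal.ofReal ((d:ℝ) ^ ((d:ℝ) - pm)) := by
    intro k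
    have hh := hs_pos k
    calc ∑ i, ediam (t k i) ^ ((d:ℝ) - pm) ≤ ∑ i : Fin (M k), ENNReal.ofReal ((d * hs k) ^ ((d:ℝ) - pm)) := by
          refine Finset.sum_le_sum fun i _ => ?_
          rw [← ENNReal.ofReal_rpow_of_nonneg (by positivity) hγ.le]
          exact ENNReal.rpow_le_rpow (hdi k i) hγ.le
      _ = ENNReal.ofReal (M k * (d * hs k) ^ ((d:ℝ) - pm)) := by
          rw [Finset.sum_const, nsmul_eq_mul, Finset.card_univ, Fintype.card_fin,
            ENNReal.ofReal_mul (by positivity), ENNReal.ofReal_natCast]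
      _ ≤ _ := by
          refine ENNReal.ofReal_le_ofReal ?_
          rw [Real.mul_rpow (by positivity) hh.le]
          have h1 : (M k : ℝ) * hs k ^ ((d:ℝ) - pm) ≤ 1 := by
            calc (M k : ℝ) * hs k ^ ((d:ℝ) - pm) ≤ Xk d pm k * hs k ^ ((d:ℝ) - pm) := by
                  have := (hM k).trans (hg.Nle k); gcongr
              _ = 2 ^ (-(((d:ℝ) - pm) * √k)) := by
                  rw [Xk, hs_rpow, ← Real.rpow_mul (by norm_num), ← Real.rpow_add (by norm_num)]
                  congr 1; ring
              _ ≤ 1 := Real.rpow_le_one_of_one_le_of_nonpos (by norm_num) (by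
                  have := Real.sqrt_nonneg (k:ℝ); nlinarith)
          have h2 : (0:ℝ) ≤ (d:ℝ) ^ ((d:ℝ) - pm) := by positivity
          nlinarith
  refine (lt_of_le_of_lt (h.trans ?_) (ENNReal.ofReal_lt_top (r := (d:ℝ) ^ ((d:ℝ) - pm)))).ne
  exact liminf_le_of_le (by isBoundedDefault) fun b hb2 => by
    obtain ⟨k, hk⟩ := hb2.exists
    exact hk.trans (hb k)

lemma dim_low (hg : Geo i0 pm S μ N C) {K : Set (Euc d)} (hK : μ K ≠ 0) :
    ENNReal.ofReal ((d:ℝ) - pm) ≤ dimH K := by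
  refine ENNReal.le_of_forall_nnreal_lt fun s hs1 => ?_
  rcases eq_or_ne s 0 with h0 | h0
  · rw [h0]; simp
  have hs0 : 0 < (s:ℝ) := by exact_mod_cast pos_iff_ne_zero.2 h0
  have hsγ : (s:ℝ) < (d:ℝ) - pm := by
    rw [← ENNReal.ofReal_coe_nnreal] at hs1
    exact (ENNReal.ofReal_lt_ofReal_iff_of_nonneg s.2).1 hs1
  refine le_dimH_of_hausdorffMeasure_ne_zero fun hz => hK ?_
  have hC : 0 < C := zero_lt_one.trans_le hg.C1
  have hev : ∀ᶠ k : ℕ in atTop, C / N k ≤ hs (k + 1) ^ (s:ℝ) := by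
    have h1 := ((sum_lin (α := (d:ℝ) - pm - s) (by linarith) ((d:ℝ) - pm)).mul_left (C ^ 2 * 2 ^ (s:ℝ))).tendsto_atTop_zero
    filter_upwards [h1.eventually (gt_mem_nhds one_pos)] with k hk
    have hN := hg.Npos k
    have hX : 0 < Xk d pm k := by unfold Xk; positivity
    have e1 : C / N k ≤ C ^ 2 / Xk d pm k := by
      rw [div_le_div_iff₀ hN hX]
      have := hg.leN k
      nlinarith
    refine e1.trans ?_
    have e2 : C ^ 2 / Xk d pm k = (C ^ 2 * 2 ^ (s:ℝ) * 2 ^ (-(((d:ℝ) - pm - s) * k) + ((d:ℝ) - pm) * √k)) *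
        hs (k + 1) ^ (s:ℝ) := by
      rw [Xk, hs_rpow, ← Real.rpow_mul (by norm_num), mul_assoc, mul_assoc, ← Real.rpow_add (by norm_num),
        ← Real.rpow_add (by norm_num), div_eq_mul_inv, ← Real.rpow_neg (by norm_num)]
      congr 2; push_cast; ring
    rw [e2]
    have : 0 ≤ hs (k + 1) ^ (s:ℝ) := Real.rpow_nonneg (hs_pos _).le _
    nlinarith
  obtain ⟨k0, hk0⟩ := eventually_atTop.1 hev
  have hA : ∀ (A : Set (Euc d)) (k : ℕ), k0 ≤ k → ediam A ≤ ENNReal.ofReal (hs k) →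
      μ A ≤ ENNReal.ofReal (hs (k + 1) ^ (s:ℝ)) := by
    intro A k hk hd
    rcases A.eq_empty_or_nonempty with h | ⟨a, ha⟩
    · rw [h]; simp
    have hh := hs_pos k
    refine le_trans (measure_mono fun y hy => ?_) ((hg.ball k a).trans (ENNReal.ofReal_le_ofReal (hk0 k hk)))
    have h1 := edist_le_of_ediam_le hy ha hd
    rw [edist_dist, ENNReal.ofReal_le_ofReal_iff hh.le] at h1
    rw [mem_closedBall]; linarith
  have hle : μ ≤ μH[(s:ℝ)] := by
    refine Measure.le_hausdorffMeasure _ μ (ENNReal.ofReal (hs k0)) (ENNReal.ofReal_pos.2 (hs_pos k0)) fun A hd => ?_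
    rcases eq_or_ne (ediam A) 0 with hz0 | hz0
    · have h1 : Tendsto (fun k => ENNReal.ofReal (hs (k + 1) ^ (s:ℝ))) atTop (𝓝 0) := by
        have h2 := (hs_lim.comp (tendsto_add_atTop_nat 1)).rpow_const (p := (s:ℝ)) (Or.inr hs0.le)
        rw [Real.zero_rpow hs0.ne'] at h2
        simpa using ENNReal.tendsto_ofReal h2
      have h3 : μ A ≤ 0 := ge_of_tendsto h1 (eventually_atTop.2 ⟨k0, fun k hk => hA A k hk (by rw [hz0]; exact zero_le)⟩)
      exact h3.trans zero_le
    · have ht : ediam A ≠ ⊤ := (hd.trans_lt ENNReal.ofReal_lt_top).ne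
      set D := (ediam A).toReal with hD
      have hDe : ediam A = ENNReal.ofReal D := (ENNReal.ofReal_toReal ht).symm
      have hDp : 0 < D := ENNReal.toReal_pos hz0 ht
      rw [hDe, ENNReal.ofReal_le_ofReal_iff (hs_pos k0).le] at hd
      obtain ⟨k, hk1, hk2⟩ := exists_nat_pow_near_of_lt_one hDp (hd.trans (hs_le k0)) (show (0:ℝ) < 1 / 2 by norm_num) (by norm_num)
      have hkk : k0 < k + 1 := by
        by_contra hc
        push Not at hc
        have : hs k0 ≤ hs (k + 1) := pow_le_pow_of_le_one (by norm_num) (by norm_num) hc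
        have h5 : hs (k + 1) < D := hk1
        linarith
      have := hA A k (by omega) (by rw [hDe]; exact ENNReal.ofReal_le_ofReal hk2)
      refine this.trans ?_
      rw [hDe, ENNReal.ofReal_rpow_of_pos hDp]
      exact ENNReal.ofReal_le_ofReal (Real.rpow_le_rpow (hs_pos _).le hk1.le hs0.le)
  exact le_antisymm ((hle K).trans hz.le) zero_le

end CA6


noncomputable section CA7

variable {d : ℕ} {pm pp : ℝ}

lemma exists_t (K0 : ℝ) (h1 : 1 < pm) (h : pm < pp) : ∃ t : ℝ, 0 < t ∧ K0 * t ^ (pm / pp) < t := by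
  have hpp : 0 < pp := by linarith
  have hθ : 0 < 1 - pm / pp := by rw [sub_pos, div_lt_one hpp]; exact h
  obtain ⟨t, ht1, ht2⟩ := (((_root_.tendsto_rpow_atTop hθ).eventually_gt_atTop K0).and (eventually_gt_atTop 0)).exists
  refine ⟨t, ht2, ?_⟩
  calc K0 * t ^ (pm / pp) < t ^ (1 - pm / pp) * t ^ (pm / pp) :=
        mul_lt_mul_of_pos_right ht1 (by positivity)
    _ = t := by rw [← Real.rpow_add ht2]; simp

theorem caseA (hd : 2 ≤ d) (hpm : 1 < pm) (hpd : pm < d) (hpmpp : pm < pp) :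
    ∃ (p : Euc d → ℝ) (u : Euc d → ℝ) (G : Euc d → Euc d →L[ℝ] ℝ),
      Measurable p ∧ (∀ x, p x = pm ∨ p x = pp) ∧
      W11On (Box d) u G ∧
      (∫⁻ x in Box d, ENNReal.ofReal (‖G x‖ ^ p x)) < ⊤ ∧
      IsLocalMinimizer (Box d) (fun x t => t ^ p x / p x) u G ∧
      (∀ s : ℝ, pm < s →
        ¬ MemLp (fun x => ‖G x‖) (ENNReal.ofReal s) (volume.restrict (Box d))) ∧
      (pm < (d : ℝ) → ∃ Sig : Set (Euc d), IsClosed Sig ∧ Sig ⊆ Box d ∧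
        (∀ x ∈ Sig, IsNonLebesguePoint u x) ∧
        dimH Sig = ENNReal.ofReal ((d : ℝ) - pm)) := by
  have hpp : 1 < pp := by linarith
  let i0 : Fin d := ⟨0, by omega⟩
  obtain ⟨S, μ, N, C, hg⟩ := geo_exists hd hpm hpd i0
  have hprob := hg.prob
  obtain ⟨E, hE, hEn⟩ := u0_en hg hpm hpd hpp
  obtain ⟨β, hβ0, hβs, hβ⟩ := main_est hg hpp hpmpp
  set p := pe S i0 pm pp with hp
  have hpmeas : Measurable p := pe_meas pp
  have hpv : ∀ x, p x = pm ∨ p x = pp := pe_v pp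
  obtain ⟨t, ht, htK⟩ := exists_t (12 * 2 ^ d * (∑' k, β k) * (pp * E.toReal) ^ (1 / pp)) hpm hpmpp
  obtain ⟨l1, l2, hw, -⟩ := u0_spec hg hpm hpd
  have l1' : LocallyIntegrable fun y => t * u0 S i0 y := by
    simpa [Pi.smul_def] using l1.smul t
  have l2' : LocallyIntegrable fun y => t • fderiv ℝ (u0 S i0) y := l2.smul t
  have hw' := wk_smul t hw
  have h0 := w11_of_loc l1' l2' hw'
  have hfin : en p (fun y => t • fderiv ℝ (u0 S i0) y) < ⊤ :=
    (hEn t ht).trans_lt (ENNReal.mul_lt_top ENNReal.ofReal_lt_top hE)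
  obtain ⟨w, H, hZ, hle, hmin⟩ := exists_min (by omega) hpm hpp hpmeas hpv h0 hfin
  set G : Euc d → Euc d →L[ℝ] ℝ := fun x => t • fderiv ℝ (u0 S i0) x + H x with hG
  set v : Euc d → ℝ := fun x => t * u0 S i0 x + w x with hv
  have lv : LocallyIntegrable v := l1'.add hZ.iw.locallyIntegrable
  have wv : HasWeakFDerivOn univ v G := wk_add_loc l1' l2' hZ.iw.locallyIntegrable
    hZ.iH.locallyIntegrable hw' hZ.wk
  have mG : AEStronglyMeasurable G (volume.restrict (Box d)) := hmin.1.2.1.1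
  have mB : MeasurableSet (Box d) := (box_open d).measurableSet
  have mK : MeasurableSet (Kc S i0 ∩ Box d) := Kc_open.measurableSet.inter mB
  have mGK : AEStronglyMeasurable G (volume.restrict (Kc S i0 ∩ Box d)) :=
    mG.mono_measure (Measure.restrict_mono inter_subset_right le_rfl)
  -- energy in the cone
  have hcone : ∫⁻ y in Kc S i0 ∩ Box d, ‖G y‖ₑ ^ pp ≤ ENNReal.ofReal (pp * E.toReal * t ^ pm) := by
    calc ∫⁻ y in Kc S i0 ∩ Box d, ‖G y‖ₑ ^ pp
        = ∫⁻ y in Kc S i0 ∩ Box d, ENNReal.ofReal pp * ENNReal.ofReal (‖G y‖ ^ p y / p y) := by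
          refine setLIntegral_congr_fun mK fun y hy => ?_
          have : p y = pp := if_pos hy.1
          simp only [this]
          rw [← ENNReal.ofReal_mul (by linarith), mul_div_cancel₀ _ (by linarith : pp ≠ 0),
            ← ofReal_norm_eq_enorm, ENNReal.ofReal_rpow_of_nonneg (norm_nonneg _) (by linarith)]
      _ = ENNReal.ofReal pp * ∫⁻ y in Kc S i0 ∩ Box d, ENNReal.ofReal (‖G y‖ ^ p y / p y) :=
          lintegral_const_mul' _ _ ENNReal.ofReal_ne_top
      _ ≤ ENNReal.ofReal pp * en p G := by
          rw [en_def]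
          exact mul_le_mul' le_rfl (lintegral_mono_set inter_subset_right)
      _ ≤ ENNReal.ofReal pp * (ENNReal.ofReal (t ^ pm) * E) := mul_le_mul' le_rfl (hle.trans (hEn t ht))
      _ = _ := by
          rw [ENNReal.ofReal_mul (by positivity), ENNReal.ofReal_mul (by linarith), ENNReal.ofReal_toReal hE.ne]
          ring
  -- the potential
  set R : Euc d → ℝ≥0∞ := fun x => ENNReal.ofReal (12 * 2 ^ d) * ∑' j, Fk S i0 G j x with hR
  have mF : ∀ j, Measurable (Fk S i0 G j) := fun j => (ms_lint mK mGK.enorm _).const_mul _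
  have mR : Measurable R := (Measurable.ennreal_tsum mF).const_mul _
  have hRt : ∫⁻ x, R x ∂μ < ENNReal.ofReal t := by
    refine lt_of_le_of_lt ?_ ((ENNReal.ofReal_lt_ofReal_iff ht).2 htK)
    rw [hR, lintegral_const_mul' _ _ ENNReal.ofReal_ne_top, lintegral_tsum fun j => (mF j).aemeasurable]
    have h1 : ∀ j, ∫⁻ x, Fk S i0 G j x ∂μ ≤ ENNReal.ofReal (β j) *
        ENNReal.ofReal ((pp * E.toReal * t ^ pm) ^ (1 / pp)) := fun j => by
      refine (hβ _ mK G mGK j).trans (mul_le_mul' le_rfl ?_)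
      rw [← ENNReal.ofReal_rpow_of_nonneg (by positivity) (by positivity)]
      exact ENNReal.rpow_le_rpow hcone (by positivity)
    refine (mul_le_mul' le_rfl (ENNReal.tsum_le_tsum h1)).trans_eq ?_
    have hβt : 0 ≤ ∑' k, β k := tsum_nonneg hβ0
    rw [ENNReal.tsum_mul_right, ← ENNReal.ofReal_tsum_of_nonneg hβ0 hβs, ← ENNReal.ofReal_mul hβt,
      ← ENNReal.ofReal_mul (by positivity)]
    congr 1
    rw [Real.mul_rpow (by positivity) (by positivity), ← Real.rpow_mul ht.le, mul_one_div]
    ring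
  have hjump : ∀ x ∈ S, ∀ k, ENNReal.ofReal t ≤ ck i0 v k x + R x := fun x hx k => jump hg hpm hpd hZ k hx
  have aeS : ∀ᵐ x ∂μ, x ∈ S := hg.supp
  refine ⟨p, v, G, hpmeas, hpv, hmin.1, ?_, hmin, ?_, fun _ => ?_⟩
  · exact (en_full hpm hpp hpv _).trans_lt (ENNReal.mul_lt_top ENNReal.ofReal_lt_top (hle.trans_lt hfin))
  · intro s hsp hmem
    have hs1 : 1 < s := by linarith
    have hS := memLp_fin hs1 hmem
    set Q := (∫⁻ y in Box d, ‖G y‖ₑ ^ s) ^ (1 / s) with hQ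
    have hQt : Q ≠ ⊤ := ENNReal.rpow_ne_top_of_nonneg (by positivity) hS.ne
    obtain ⟨b, hb0, hbs, hb⟩ := main_est hg hs1 hsp
    have key : ∀ k, 4 ≤ k → ENNReal.ofReal t ≤ ENNReal.ofReal 16 * (ENNReal.ofReal (b k) * Q) + ∫⁻ x, R x ∂μ := by
      intro k hk
      calc ENNReal.ofReal t = ∫⁻ x, ENNReal.ofReal t ∂μ := by simp
        _ ≤ ∫⁻ x, (ENNReal.ofReal 16 * (ENNReal.ofReal (wt d k) *
              ∫⁻ y in closedBall x (13 * hs k) ∩ Box d, ‖G y‖ₑ) + R x) ∂μ := by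
            refine lintegral_mono_ae ?_
            filter_upwards [aeS] with x hx
            exact (hjump x hx k).trans (add_le_add (ck_grad hg lv wv hk hx) le_rfl)
        _ ≤ _ := by
            rw [lintegral_add_right _ mR, lintegral_const_mul' _ _ ENNReal.ofReal_ne_top]
            exact add_le_add (mul_le_mul' le_rfl (hb _ mB G mG k)) le_rfl
    have lim : Tendsto (fun k => ENNReal.ofReal 16 * (ENNReal.ofReal (b k) * Q) + ∫⁻ x, R x ∂μ) atTop
        (𝓝 (ENNReal.ofReal 16 * (ENNReal.ofReal 0 * Q) + ∫⁻ x, R x ∂μ)) := by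
      refine Tendsto.add ?_ tendsto_const_nhds
      refine ENNReal.Tendsto.const_mul ?_ (Or.inr ENNReal.ofReal_ne_top)
      exact ENNReal.Tendsto.mul_const (ENNReal.tendsto_ofReal hbs.tendsto_atTop_zero) (Or.inr hQt)
    have h3 := ge_of_tendsto lim (eventually_atTop.2 ⟨4, key⟩)
    simp only [ENNReal.ofReal_zero, zero_mul, mul_zero, zero_add] at h3
    exact absurd hRt (not_lt.2 h3)
  · set A : Set (Euc d) := S ∩ {x | R x < ENNReal.ofReal t} with hA
    have mA : MeasurableSet A := hg.cpt.measurableSet.inter (measurableSet_lt mR measurable_const)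
    have hA0 : 0 < μ A := by
      rw [pos_iff_ne_zero]
      intro hz
      refine absurd hRt (not_lt.2 ?_)
      calc ENNReal.ofReal t = ∫⁻ x, ENNReal.ofReal t ∂μ := by simp
        _ ≤ ∫⁻ x, R x ∂μ := by
          refine lintegral_mono_ae ?_
          filter_upwards [aeS, measure_eq_zero_iff_ae_notMem.1 hz] with x hx hx2
          by_contra hc
          exact hx2 ⟨hx, not_le.1 hc⟩
    obtain ⟨Sig, hsub, hcpt, hpos⟩ := mA.exists_lt_isCompact hA0
    refine ⟨Sig, hcpt.isClosed, fun x hx i => ?_, fun x hx => ?_, ?_⟩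
    · have := hg.qu x (hsub hx).1 i
      linarith
    · by_contra hc
      have h1 := (ck_leb (i0 := i0) lv hc).add_const (R x)
      have h2 := ge_of_tendsto h1 (Eventually.of_forall fun k => hjump x (hsub hx).1 k)
      rw [zero_add] at h2
      exact absurd (hsub hx).2 (not_lt.2 h2)
    · exact le_antisymm (dim_up hg hpd fun x hx => (hsub hx).1) (dim_low hg hpos.ne')

end CA7


/-- **Theorem 3, piecewise constant variable exponent.** For any
`1 < p_− < p_+ < ∞` there exist a measurable exponent `p : Ω → {p_−, p_+}` and a local
minimizer `u` of `F(w) = ∫_Ω |∇w|^{p(x)}/p(x) dx` with finite energy such that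
`∇u ∉ L^s(Ω)` for every `s > p_−`; if moreover `p_− < d`, there is a closed set `Σ ⊆ Ω` of
non-Lebesgue points of `u` with Hausdorff dimension `d − p_−`. -/
theorem piecewise_varexp_singular_minimizer
    {d : ℕ} (hd : 2 ≤ d) (pm pp : ℝ) (hpm : 1 < pm) (hpmpp : pm < pp) :
    ∃ (p : Euc d → ℝ) (u : Euc d → ℝ) (G : Euc d → Euc d →L[ℝ] ℝ),
      Measurable p ∧ (∀ x, p x = pm ∨ p x = pp) ∧
      W11On (Box d) u G ∧
      (∫⁻ x in Box d, ENNReal.ofReal (‖G x‖ ^ p x)) < ⊤ ∧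
      IsLocalMinimizer (Box d) (fun x t => t ^ p x / p x) u G ∧
      (∀ s : ℝ, pm < s →
        ¬ MemLp (fun x => ‖G x‖) (ENNReal.ofReal s) (volume.restrict (Box d))) ∧
      (pm < (d : ℝ) → ∃ Sig : Set (Euc d), IsClosed Sig ∧ Sig ⊆ Box d ∧
        (∀ x ∈ Sig, IsNonLebesguePoint u x) ∧
        dimH Sig = ENNReal.ofReal ((d : ℝ) - pm)) := by
  rcases lt_or_ge pm (d : ℝ) with h | h
  · exact caseA hd hpm h hpmpp
  · obtain ⟨p, u, G, h1, h2, h3, h4, h5, h6⟩ := caseB hd hpm h hpmpp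
    exact ⟨p, u, G, h1, h2, h3, h4, h5, h6, fun h7 => absurd h7 (not_lt.2 h)⟩
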